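/- There exist absolute constants C₀, C_d, C_T > 0 such that the following holds for every m ≥ n ≥ 1, r ≥ 1, μ ≥ 1 and every μ-incoherent rank-r matrix M ∈ ℝ^{m×n}. Set α = m/n, κ = Σmax/Σmin, δ = Σmin/(C_d·r^{3/2}·κ), and let Ω be drawn uniformly at random among all subsets of [m]×[n] of cardinality S with S ≥ C₀·α·n·r·κ²·max{μ·log n, √α·μ²·r⁶·κ⁴}, p = S/(mn). Then with probability at least 1 − 1/n⁴: every (X,Y) ∈ K₁ ∩ K₂ ∩ K(δ) that is a stationary point of F̃ (i.e. ∇_X F̃(X,Y) = 0 and ∇_Y F̃(X,Y) = 0) satisfies X·Yᵀ = M. -/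

import Mathlib

open Matrix
open scoped Classical

noncomputable section

/-- Frobenius norm of a real matrix. -/
def frob {m n : ℕ} (A : Matrix (Fin m) (Fin n) ℝ) : ℝ :=
  Real.sqrt (∑ i, ∑ j, A i j ^ 2)

/-- Euclidean norm of the `i`-th row of a matrix. -/
def rowNorm {m n : ℕ} (A : Matrix (Fin m) (Fin n) ℝ) (i : Fin m) : ℝ :=
  Real.sqrt (∑ j, A i j ^ 2)

/-- Frobenius inner product `⟨A,B⟩ = trace(AᵀB)`. -/
def finner {m n : ℕ} (A B : Matrix (Fin m) (Fin n) ℝ) : ℝ :=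
  ∑ i, ∑ j, A i j * B i j

/-- Projection onto the set of entries indexed by `Ω` (other entries are set to `0`). -/
def projOmega {m n : ℕ} (Ω : Finset (Fin m × Fin n)) (A : Matrix (Fin m) (Fin n) ℝ) :
    Matrix (Fin m) (Fin n) ℝ :=
  Matrix.of fun i j => if (i, j) ∈ Ω then A i j else 0

/-- `G₀(z) = (max{0, z-1})²`. -/
def G0 (z : ℝ) : ℝ := max 0 (z - 1) ^ 2

/-- `G₀′(z) = 2·max{0, z-1}`. -/
def G0' (z : ℝ) : ℝ := 2 * max 0 (z - 1)

/-- The matrix whose `i`-th row is the `i`-th row of `A` and whose other rows vanish. -/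
def rowMat {m n : ℕ} (A : Matrix (Fin m) (Fin n) ℝ) (i : Fin m) :
    Matrix (Fin m) (Fin n) ℝ :=
  Matrix.of fun i' j => if i' = i then A i j else 0

/-- The regularizer `G(X,Y)`. -/
def Greg {m n r : ℕ} (ρ β1 β2 βT : ℝ) (X : Matrix (Fin m) (Fin r) ℝ)
    (Y : Matrix (Fin n) (Fin r) ℝ) : ℝ :=
  ρ * ∑ i, G0 (3 * rowNorm X i ^ 2 / (2 * β1 ^ 2)) +
    ρ * ∑ j, G0 (3 * rowNorm Y j ^ 2 / (2 * β2 ^ 2)) +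
    ρ * G0 (3 * frob X ^ 2 / (2 * βT ^ 2)) +
    ρ * G0 (3 * frob Y ^ 2 / (2 * βT ^ 2))

/-- The regularized objective `F̃(X,Y)`. -/
def Ftilde {m n r : ℕ} (Ω : Finset (Fin m × Fin n)) (M : Matrix (Fin m) (Fin n) ℝ)
    (ρ β1 β2 βT : ℝ) (X : Matrix (Fin m) (Fin r) ℝ) (Y : Matrix (Fin n) (Fin r) ℝ) : ℝ :=
  (1 / 2) * frob (projOmega Ω (M - X * Yᵀ)) ^ 2 + Greg ρ β1 β2 βT X Y

/-- Gradient of the regularizer with respect to one of the factors. -/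
def gradG1 {m r : ℕ} (ρ β βT : ℝ) (X : Matrix (Fin m) (Fin r) ℝ) :
    Matrix (Fin m) (Fin r) ℝ :=
  (∑ i, (ρ * G0' (3 * rowNorm X i ^ 2 / (2 * β ^ 2)) * (3 / β ^ 2)) • rowMat X i) +
    (ρ * G0' (3 * frob X ^ 2 / (2 * βT ^ 2)) * (3 / βT ^ 2)) • X

/-- `∇_X F̃(X,Y)`. -/
def gradX {m n r : ℕ} (Ω : Finset (Fin m × Fin n)) (M : Matrix (Fin m) (Fin n) ℝ)
    (ρ β1 βT : ℝ) (X : Matrix (Fin m) (Fin r) ℝ) (Y : Matrix (Fin n) (Fin r) ℝ) :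
    Matrix (Fin m) (Fin r) ℝ :=
  projOmega Ω (X * Yᵀ - M) * Y + gradG1 ρ β1 βT X

/-- `∇_Y F̃(X,Y)`. -/
def gradY {m n r : ℕ} (Ω : Finset (Fin m × Fin n)) (M : Matrix (Fin m) (Fin n) ℝ)
    (ρ β2 βT : ℝ) (X : Matrix (Fin m) (Fin r) ℝ) (Y : Matrix (Fin n) (Fin r) ℝ) :
    Matrix (Fin n) (Fin r) ℝ :=
  (projOmega Ω (X * Yᵀ - M))ᵀ * X + gradG1 ρ β2 βT Y

/-- Membership in `K₁`. -/
def K1mem {m n r : ℕ} (β1 β2 : ℝ) (X : Matrix (Fin m) (Fin r) ℝ)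
    (Y : Matrix (Fin n) (Fin r) ℝ) : Prop :=
  (∀ i, rowNorm X i ≤ β1) ∧ ∀ j, rowNorm Y j ≤ β2

/-- Membership in `K₂`. -/
def K2mem {m n r : ℕ} (βT : ℝ) (X : Matrix (Fin m) (Fin r) ℝ)
    (Y : Matrix (Fin n) (Fin r) ℝ) : Prop :=
  frob X ≤ βT ∧ frob Y ≤ βT

/-- Membership in `K(t) = {(X,Y) : ‖M - XYᵀ‖_F ≤ t}`. -/
def Kmem {m n r : ℕ} (M : Matrix (Fin m) (Fin n) ℝ) (t : ℝ)
    (X : Matrix (Fin m) (Fin r) ℝ) (Y : Matrix (Fin n) (Fin r) ℝ) : Prop :=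
  frob (M - X * Yᵀ) ≤ t


/-! ### Part A: product (Bernoulli) sampling and transfer -/

/-- Bernoulli weight of a set. -/
def bw {ι : Type*} [Fintype ι] (p : ℝ) (Ω : Finset ι) : ℝ :=
  p ^ Ω.card * (1 - p) ^ (Fintype.card ι - Ω.card)

/-- Bernoulli probability of an event. -/
def BPr {ι : Type*} [Fintype ι] (p : ℝ) (Bad : Finset ι → Prop) : ℝ :=
  ∑ Ω : Finset ι, if Bad Ω then bw p Ω else 0

lemma bw_nonneg {ι : Type*} [Fintype ι] {p : ℝ} (h0 : 0 ≤ p) (h1 : p ≤ 1) (Ω : Finset ι) :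
    0 ≤ bw p Ω := by
  have : 0 ≤ 1 - p := by linarith
  unfold bw; positivity

lemma sum_bw_prod {ι : Type*} [Fintype ι] (p : ℝ) (x : ι → ℝ) :
    ∑ Ω : Finset ι, bw p Ω * ∏ e ∈ Ω, x e = ∏ e, (1 + p * (x e - 1)) := by
  have h : ∀ e, 1 + p * (x e - 1) = p * x e + (1 - p) := fun e => by ring
  simp_rw [h]
  rw [Finset.prod_add, Finset.powerset_univ]
  refine Finset.sum_congr rfl fun Ω _ => ?_
  rw [Finset.prod_mul_distrib, Finset.prod_const, Finset.prod_const, bw,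
    Finset.card_sdiff_of_subset (Finset.subset_univ _), Finset.card_univ]
  ring

lemma BPr_mono {ι : Type*} [Fintype ι] {p : ℝ} (h0 : 0 ≤ p) (h1 : p ≤ 1)
    {P Q : Finset ι → Prop} (h : ∀ Ω, P Ω → Q Ω) : BPr p P ≤ BPr p Q := by
  refine Finset.sum_le_sum fun Ω _ => ?_
  have := bw_nonneg h0 h1 Ω
  by_cases hP : P Ω
  · simp [hP, h Ω hP]
  · simp only [hP, if_false]; split_ifs <;> linarith

lemma BPr_union {ι τ : Type*} [Fintype ι] {p : ℝ} (h0 : 0 ≤ p) (h1 : p ≤ 1)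
    (s : Finset τ) (P : τ → Finset ι → Prop) :
    BPr p (fun Ω => ∃ t ∈ s, P t Ω) ≤ ∑ t ∈ s, BPr p (P t) := by
  unfold BPr
  rw [Finset.sum_comm]
  refine Finset.sum_le_sum fun Ω _ => ?_
  have hb := bw_nonneg h0 h1 Ω
  by_cases h : ∃ t ∈ s, P t Ω
  · obtain ⟨t, ht, hP⟩ := h
    have hx : ∃ t ∈ s, P t Ω := ⟨t, ht, hP⟩
    rw [if_pos hx]
    have := Finset.single_le_sum (f := fun t => if P t Ω then bw p Ω else 0)
      (fun i _ => by split_ifs <;> linarith) ht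
    simpa [hP] using this
  · rw [if_neg h]
    exact Finset.sum_nonneg fun i _ => by split_ifs <;> linarith

lemma BPr_or {ι : Type*} [Fintype ι] {p : ℝ} (h0 : 0 ≤ p) (h1 : p ≤ 1)
    (P Q : Finset ι → Prop) :
    BPr p (fun Ω => P Ω ∨ Q Ω) ≤ BPr p P + BPr p Q := by
  unfold BPr
  rw [← Finset.sum_add_distrib]
  refine Finset.sum_le_sum fun Ω _ => ?_
  have hb := bw_nonneg h0 h1 Ω
  by_cases hP : P Ω <;> by_cases hQ : Q Ω <;> simp [hP, hQ, hb]

lemma BPr_false {ι : Type*} [Fintype ι] {p : ℝ} (P : Finset ι → Prop) (h : ∀ Ω, ¬ P Ω) :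
    BPr p P = 0 := by
  unfold BPr; exact Finset.sum_eq_zero fun Ω _ => by simp [h Ω]

/-- Chernoff bound. -/
lemma BPr_chernoff {ι : Type*} [Fintype ι] {p : ℝ} (h0 : 0 ≤ p) (h1 : p ≤ 1)
    (c : ι → ℝ) (l s : ℝ) (hl : 0 ≤ l) :
    BPr p (fun Ω => s ≤ ∑ e ∈ Ω, c e) ≤
      Real.exp (-(l * s) + p * ∑ e, (Real.exp (l * c e) - 1)) := by
  have h2 : BPr p (fun Ω => s ≤ ∑ e ∈ Ω, c e) ≤
      ∑ Ω : Finset ι, Real.exp (-(l * s)) * (bw p Ω * ∏ e ∈ Ω, Real.exp (l * c e)) := by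
    refine Finset.sum_le_sum fun Ω _ => ?_
    have hb := bw_nonneg h0 h1 Ω
    have hx : Real.exp (-(l * s)) * (bw p Ω * ∏ e ∈ Ω, Real.exp (l * c e)) =
        bw p Ω * Real.exp (l * (∑ e ∈ Ω, c e - s)) := by
      rw [← Real.exp_sum, ← Finset.mul_sum, mul_sub, sub_eq_add_neg, Real.exp_add]
      ring
    rw [hx]
    split_ifs with h
    · have : 1 ≤ Real.exp (l * (∑ e ∈ Ω, c e - s)) :=
        Real.one_le_exp (mul_nonneg hl (by linarith))
      nlinarith
    · positivity
  refine h2.trans ?_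
  rw [← Finset.mul_sum, sum_bw_prod, Real.exp_add]
  refine mul_le_mul_of_nonneg_left ?_ (Real.exp_pos _).le
  rw [Finset.mul_sum, Real.exp_sum]
  refine Finset.prod_le_prod (fun e _ => ?_) fun e _ => ?_
  · have := Real.exp_pos (l * c e)
    nlinarith
  · have := Real.add_one_le_exp (p * (Real.exp (l * c e) - 1))
    linarith

lemma BPr_bern_one {ι : Type*} [Fintype ι] {p : ℝ} (h0 : 0 ≤ p) (h1 : p ≤ 1)
    (c : ι → ℝ) (l t R V : ℝ) (hl : 0 ≤ l) (hR : ∀ e, |c e| ≤ R) (hV : ∑ e, c e ^ 2 ≤ V)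
    (hlR : l * R ≤ 1) :
    BPr p (fun Ω => t + p * ∑ e, c e ≤ ∑ e ∈ Ω, c e) ≤
      Real.exp (-(l * t) + p * l ^ 2 * V) := by
  refine (BPr_chernoff h0 h1 c l _ hl).trans (Real.exp_le_exp.2 ?_)
  have h3 : ∑ e, (Real.exp (l * c e) - 1) ≤ ∑ e, (l * c e + l ^ 2 * c e ^ 2) := by
    refine Finset.sum_le_sum fun e _ => ?_
    have h4 : |l * c e| ≤ 1 := by
      rw [abs_mul, abs_of_nonneg hl]
      exact (mul_le_mul_of_nonneg_left (hR e) hl).trans hlR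
    have := (abs_le.1 (Real.abs_exp_sub_one_sub_id_le h4)).2
    nlinarith
  rw [Finset.sum_add_distrib, ← Finset.mul_sum, ← Finset.mul_sum] at h3
  have h5 : p * ∑ e, (Real.exp (l * c e) - 1) ≤ p * (l * ∑ e, c e + l ^ 2 * V) := by
    refine mul_le_mul_of_nonneg_left (h3.trans ?_) h0
    have := mul_le_mul_of_nonneg_left hV (sq_nonneg l)
    linarith
  nlinarith

/-- Bernstein bound. -/
lemma BPr_bern {ι : Type*} [Fintype ι] {p : ℝ} (h0 : 0 ≤ p) (h1 : p ≤ 1)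
    (c : ι → ℝ) (l t R V : ℝ) (hl : 0 ≤ l) (hR : ∀ e, |c e| ≤ R) (hV : ∑ e, c e ^ 2 ≤ V)
    (hlR : l * R ≤ 1) :
    BPr p (fun Ω => t ≤ |∑ e ∈ Ω, c e - p * ∑ e, c e|) ≤
      2 * Real.exp (-(l * t) + p * l ^ 2 * V) := by
  have e1 := BPr_bern_one h0 h1 c l t R V hl hR hV hlR
  have e2 := BPr_bern_one h0 h1 (fun e => - c e) l t R V hl (by simpa using hR)
    (by simpa using hV) hlR
  have e3 := BPr_or h0 h1 (fun Ω => t + p * ∑ e, c e ≤ ∑ e ∈ Ω, c e)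
    (fun Ω => t + p * ∑ e, - c e ≤ ∑ e ∈ Ω, - c e)
  have e4 : BPr p (fun Ω => t ≤ |∑ e ∈ Ω, c e - p * ∑ e, c e|) ≤ _ :=
    (BPr_mono h0 h1 (Q := fun Ω => (t + p * ∑ e, c e ≤ ∑ e ∈ Ω, c e) ∨
      (t + p * ∑ e, - c e ≤ ∑ e ∈ Ω, - c e)) (fun Ω h => ?_)).trans e3
  · linarith
  · simp only [Finset.sum_neg_distrib]
    rcases le_abs.1 h with h | h
    · left; linarith
    · right; linarith

/-- The binomial term at its mean is at least `1/(N+1)`. -/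
lemma binom_mode (N S : ℕ) (hS : S ≤ N) (hN : 0 < N) :
    1 ≤ ((N : ℝ) + 1) * ((N.choose S : ℝ) * (((S : ℝ) / N) ^ S * (1 - (S : ℝ) / N) ^ (N - S))) := by
  set p : ℝ := (S : ℝ) / N with hp
  have hN' : (0 : ℝ) < N := by exact_mod_cast hN
  have hSN : (S : ℝ) ≤ N := by exact_mod_cast hS
  have p0 : 0 ≤ p := by positivity
  have p1 : p ≤ 1 := by rw [hp, div_le_one hN']; exact hSN
  set f : ℕ → ℝ := fun k => (N.choose k : ℝ) * (p ^ k * (1 - p) ^ (N - k)) with hf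
  have hf0 : ∀ k, 0 ≤ f k := fun k => by
    have : 0 ≤ 1 - p := by linarith
    simp only [hf]; positivity
  have hpN : p * N = S := by rw [hp]; field_simp
  -- ratio identity
  have ratio : ∀ k, k < N → f (k + 1) * ((k + 1) * (1 - p)) = f k * ((N - k) * p) := by
    intro k hk
    have h1 : (N.choose (k + 1) : ℝ) * (k + 1) = N.choose k * (N - k) := by
      have := Nat.choose_succ_right_eq N k
      have h2 : ((N.choose (k + 1) * (k + 1) : ℕ) : ℝ) = ((N.choose k * (N - k) : ℕ) : ℝ) := by
        rw [this]
      push_cast [Nat.cast_sub hk.le] at h2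
      exact h2
    have h3 : (1 - p) ^ (N - k) = (1 - p) ^ (N - (k + 1)) * (1 - p) := by
      rw [← pow_succ]; congr 1; omega
    simp only [hf]
    rw [h3, pow_succ]
    linear_combination (p ^ k * p * (1 - p) ^ (N - (k + 1)) * (1 - p)) * h1
  have hup : ∀ k, k < S → f k ≤ f (k + 1) := by
    intro k hk
    have hkS : (k : ℝ) + 1 ≤ S := by exact_mod_cast hk
    have hr := ratio k (by omega)
    by_cases hq : p = 1
    · have h2 : S = N := by
        rw [hq, one_mul] at hpN; exact_mod_cast hpN.symm
      have : f k = 0 := by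
        simp only [hf, hq]
        rw [sub_self, zero_pow (by omega)]; simp
      rw [this]; exact hf0 _
    · have hq' : 0 < 1 - p := by
        rcases lt_or_eq_of_le p1 with h | h
        · linarith
        · exact absurd h hq
      have hc : ((k : ℝ) + 1) * (1 - p) ≤ (N - k) * p := by nlinarith
      have hpos : 0 < ((k : ℝ) + 1) * (1 - p) := by positivity
      have : f k * (((k : ℝ) + 1) * (1 - p)) ≤ f (k + 1) * (((k : ℝ) + 1) * (1 - p)) := by
        rw [hr]; exact mul_le_mul_of_nonneg_left hc (hf0 k)
      exact le_of_mul_le_mul_right this hpos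
  have hdn : ∀ k, S ≤ k → k < N → f (k + 1) ≤ f k := by
    intro k hk hkN
    have hkS : (S : ℝ) ≤ k := by exact_mod_cast hk
    have hkN' : (k : ℝ) + 1 ≤ N := by exact_mod_cast hkN
    have hr := ratio k hkN
    by_cases hq : p = 0
    · have : f (k + 1) = 0 := by
        simp only [hf, hq]
        rw [zero_pow (by omega)]; simp
      rw [this]; exact hf0 _
    · have hq' : 0 < p := lt_of_le_of_ne p0 (Ne.symm hq)
      have hc : ((N : ℝ) - k) * p ≤ ((k : ℝ) + 1) * (1 - p) := by nlinarith
      have hpos : 0 < ((N : ℝ) - k) * p := by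
        have : (0 : ℝ) < N - k := by linarith
        positivity
      have : f (k + 1) * (((N : ℝ) - k) * p) ≤ f k * (((N : ℝ) - k) * p) := by
        rw [← hr]; exact mul_le_mul_of_nonneg_left hc (hf0 _)
      exact le_of_mul_le_mul_right this hpos
  have hmax1 : ∀ d, d ≤ S → f (S - d) ≤ f S := by
    intro d
    induction d with
    | zero => intro _; simp
    | succ d ih =>
      intro h
      have h2 := hup (S - (d + 1)) (by omega)
      have h3 : S - (d + 1) + 1 = S - d := by omega
      rw [h3] at h2
      exact h2.trans (ih (by omega))
  have hmax2 : ∀ d, S + d ≤ N → f (S + d) ≤ f S := by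
    intro d
    induction d with
    | zero => intro _; simp
    | succ d ih =>
      intro h
      exact (hdn (S + d) (by omega) (by omega)).trans (ih (by omega))
  have hmax : ∀ k, k ≤ N → f k ≤ f S := by
    intro k hk
    rcases le_total k S with h | h
    · have := hmax1 (S - k) (by omega)
      rwa [show S - (S - k) = k by omega] at this
    · have := hmax2 (k - S) (by omega)
      rwa [show S + (k - S) = k by omega] at this
  have hsum : ∑ k ∈ Finset.range (N + 1), f k = 1 := by
    have := add_pow p (1 - p) N
    rw [show p + (1 - p) = 1 by ring, one_pow] at this
    rw [this]
    refine Finset.sum_congr rfl fun k _ => ?_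
    simp only [hf]; ring
  have : ∑ k ∈ Finset.range (N + 1), f k ≤ ∑ k ∈ Finset.range (N + 1), f S :=
    Finset.sum_le_sum fun k hk => hmax k (by
      have := Finset.mem_range.1 hk; omega)
  rw [hsum, Finset.sum_const, Finset.card_range, nsmul_eq_mul] at this
  push_cast at this
  exact this

/-- Transfer from Bernoulli sampling to uniform sampling of size `S`. -/
lemma transfer {ι : Type*} [Fintype ι] (S : ℕ) (hS : S ≤ Fintype.card ι)
    (hN : 0 < Fintype.card ι) (Good : Finset ι → Prop) (η : ℝ)
    (hη : ((Fintype.card ι : ℝ) + 1) *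
      BPr ((S : ℝ) / Fintype.card ι) (fun Ω => ¬ Good Ω) ≤ η) :
    (1 - η) * ((Finset.powersetCard S (Finset.univ : Finset ι)).card : ℝ) ≤
      (((Finset.powersetCard S (Finset.univ : Finset ι)).filter Good).card : ℝ) := by
  set N := Fintype.card ι with hNdef
  set p : ℝ := (S : ℝ) / N with hp
  have hN' : (0 : ℝ) < N := by exact_mod_cast hN
  have hSN : (S : ℝ) ≤ N := by exact_mod_cast hS
  have p0 : 0 ≤ p := by positivity
  have p1 : p ≤ 1 := by rw [hp, div_le_one hN']; exact hSN
  set w : ℝ := p ^ S * (1 - p) ^ (N - S) with hw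
  have hmode := binom_mode N S hS hN
  have hcard : (Finset.powersetCard S (Finset.univ : Finset ι)).card = N.choose S := by
    rw [Finset.card_powersetCard, Finset.card_univ]
  have hsplit := Finset.card_filter_add_card_filter_not
    (s := Finset.powersetCard S (Finset.univ : Finset ι)) Good
  have hbad : (((Finset.powersetCard S (Finset.univ : Finset ι)).filter
      (fun Ω => ¬ Good Ω)).card : ℝ) * w ≤ BPr p (fun Ω => ¬ Good Ω) := by
    have hB : BPr p (fun Ω => ¬ Good Ω) =
        ∑ Ω ∈ (Finset.univ : Finset (Finset ι)).filter (fun Ω => ¬ Good Ω), bw p Ω := by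
      unfold BPr
      rw [Finset.sum_filter]
      refine Finset.sum_congr rfl fun Ω _ => ?_
      by_cases hg : Good Ω <;> simp [hg]
    rw [hB]
    have : (((Finset.powersetCard S (Finset.univ : Finset ι)).filter
      (fun Ω => ¬ Good Ω)).card : ℝ) * w = ∑ Ω ∈ (Finset.powersetCard S
        (Finset.univ : Finset ι)).filter (fun Ω => ¬ Good Ω), bw p Ω := by
      rw [← nsmul_eq_mul, ← Finset.sum_const]
      refine Finset.sum_congr rfl fun Ω hΩ => ?_
      have := (Finset.mem_powersetCard.1 (Finset.mem_filter.1 hΩ).1).2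
      rw [bw, this]
    rw [this]
    refine Finset.sum_le_sum_of_subset_of_nonneg ?_ fun Ω _ _ => bw_nonneg p0 p1 Ω
    intro Ω hΩ
    simp only [Finset.mem_filter, Finset.mem_univ, true_and] at hΩ ⊢
    exact hΩ.2
  rw [hcard] at hsplit ⊢
  have hs : (((Finset.powersetCard S (Finset.univ : Finset ι)).filter Good).card : ℝ) +
      (((Finset.powersetCard S (Finset.univ : Finset ι)).filter
        (fun Ω => ¬ Good Ω)).card : ℝ) = N.choose S := by exact_mod_cast hsplit
  set g := (((Finset.powersetCard S (Finset.univ : Finset ι)).filter Good).card : ℝ)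
  set b := (((Finset.powersetCard S (Finset.univ : Finset ι)).filter
        (fun Ω => ¬ Good Ω)).card : ℝ)
  have hb0 : 0 ≤ b := Nat.cast_nonneg _
  have hC : (0 : ℝ) ≤ N.choose S := Nat.cast_nonneg _
  have h1 : b ≤ N.choose S * (((N : ℝ) + 1) * (b * w)) := by
    have := mul_le_mul_of_nonneg_left hmode hb0
    calc b = b * 1 := by ring
      _ ≤ b * (((N : ℝ) + 1) * ((N.choose S : ℝ) * w)) := this
      _ = _ := by ring
  have h2 : N.choose S * (((N : ℝ) + 1) * (b * w)) ≤ N.choose S * η := by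
    refine mul_le_mul_of_nonneg_left (le_trans ?_ hη) hC
    exact mul_le_mul_of_nonneg_left hbad (by positivity)
  nlinarith


/-! ### Part B: nets, peeling, staircases -/

lemma exists_net (ι : Type*) [Fintype ι] :
    ∃ N : Finset (ι → ℝ), N.card ≤ 5 ^ Fintype.card ι ∧ (∀ y ∈ N, ∑ i, y i ^ 2 ≤ 1) ∧
      ∀ x : ι → ℝ, ∑ i, x i ^ 2 ≤ 1 → ∃ y ∈ N, ∑ i, (x i - y i) ^ 2 ≤ 1 / 4 := by
  let good : Finset (EuclideanSpace ℝ ι) → Prop := fun s =>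
    (∀ c ∈ s, ‖c‖ ≤ 2) ∧ (∀ c ∈ s, ∀ d ∈ s, c ≠ d → 1 ≤ ‖c - d‖)
  have hbd : ∀ s, good s → s.card ≤ 5 ^ Fintype.card ι := fun s hs => by
    have := Besicovitch.card_le_of_separated s hs.1 hs.2
    simpa using this
  let P : ℕ → Prop := fun k => ∃ s, good s ∧ s.card = k
  have hP0 : P 0 := ⟨∅, ⟨by simp, by simp⟩, by simp⟩
  have hmem := Nat.findGreatest_spec (P := P) (Nat.zero_le (5 ^ Fintype.card ι)) hP0
  obtain ⟨s, hs, hcard⟩ := hmem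
  have hmax : ∀ t, good t → t.card ≤ s.card := fun t ht => by
    rw [hcard]
    exact Nat.le_findGreatest (hbd t ht) ⟨t, ht, rfl⟩
  refine ⟨s.image (fun c i => c i / 2), Finset.card_image_le.trans (hbd s hs), ?_, ?_⟩
  · intro y hy
    obtain ⟨c, hc, rfl⟩ := Finset.mem_image.1 hy
    have h1 := hs.1 c hc
    have h2 : ‖c‖ ^ 2 ≤ 4 := by nlinarith [norm_nonneg c]
    rw [EuclideanSpace.real_norm_sq_eq] at h2
    simp only [div_pow]
    rw [← Finset.sum_div]
    linarith
  · intro x hx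
    set z : EuclideanSpace ℝ ι := WithLp.toLp 2 (fun i => 2 * x i) with hz
    have hzn : ‖z‖ ≤ 2 := by
      have h2 : ‖z‖ ^ 2 ≤ 2 ^ 2 := by
        rw [EuclideanSpace.real_norm_sq_eq]
        simp only [hz, mul_pow]
        rw [← Finset.mul_sum]
        linarith
      exact (abs_le_of_sq_le_sq' h2 (by norm_num)).2
    have hex : ∃ c ∈ s, ‖z - c‖ ≤ 1 := by
      by_contra! hcon
      have hzs : z ∉ s := fun h => by
        have := hcon z h
        simp at this
        linarith
      have hg : good (insert z s) := by
        refine ⟨?_, ?_⟩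
        · intro c hc
          rcases Finset.mem_insert.1 hc with rfl | hc
          · exact hzn
          · exact hs.1 c hc
        · intro c hc d hd hcd
          rcases Finset.mem_insert.1 hc with rfl | hc
          · rcases Finset.mem_insert.1 hd with rfl | hd
            · exact absurd rfl hcd
            · exact (hcon d hd).le
          · rcases Finset.mem_insert.1 hd with rfl | hd
            · rw [norm_sub_rev]; exact (hcon c hc).le
            · exact hs.2 c hc d hd hcd
      have := hmax _ hg
      rw [Finset.card_insert_of_notMem hzs] at this
      omega
    obtain ⟨c, hc, hcz⟩ := hex
    refine ⟨fun i => c i / 2, Finset.mem_image.2 ⟨c, hc, rfl⟩, ?_⟩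
    have h2 : ‖z - c‖ ^ 2 ≤ 1 := by nlinarith [norm_nonneg (z - c)]
    rw [EuclideanSpace.real_norm_sq_eq] at h2
    have h3 : ∑ i, (x i - c i / 2) ^ 2 = (∑ i, (z - c) i ^ 2) / 4 := by
      rw [Finset.sum_div]
      refine Finset.sum_congr rfl fun i _ => ?_
      simp only [hz, PiLp.sub_apply]
      ring
    rw [h3]; linarith

/-- Being a half-net of the unit ball. -/
def IsNet {ι : Type*} [Fintype ι] (N : Finset (ι → ℝ)) : Prop :=
  (∀ y ∈ N, ∑ i, y i ^ 2 ≤ 1) ∧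
    ∀ x : ι → ℝ, ∑ i, x i ^ 2 ≤ 1 → ∃ y ∈ N, ∑ i, (x i - y i) ^ 2 ≤ 1 / 4

lemma abs_sum_mul_le {ι : Type*} (s : Finset ι) (x y : ι → ℝ) :
    |∑ i ∈ s, x i * y i| ≤ Real.sqrt (∑ i ∈ s, x i ^ 2) * Real.sqrt (∑ i ∈ s, y i ^ 2) := by
  rw [← Real.sqrt_mul (Finset.sum_nonneg fun i _ => sq_nonneg _)]
  exact Real.abs_le_sqrt (Finset.sum_mul_sq_le_sq_mul_sq s x y)

lemma net_dual {ι : Type*} [Fintype ι] {N : Finset (ι → ℝ)} (hN : IsNet N) (w : ι → ℝ)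
    (τ : ℝ) (h : ∀ y ∈ N, |∑ i, y i * w i| ≤ τ) : Real.sqrt (∑ i, w i ^ 2) ≤ 2 * τ := by
  set W := Real.sqrt (∑ i, w i ^ 2) with hW
  have hs0 : 0 ≤ ∑ i, w i ^ 2 := Finset.sum_nonneg fun i _ => sq_nonneg _
  have hW2 : W ^ 2 = ∑ i, w i ^ 2 := Real.sq_sqrt hs0
  have hW0 : 0 ≤ W := Real.sqrt_nonneg _
  rcases hW0.eq_or_lt with h0 | hpos
  · obtain ⟨y, hy, _⟩ := hN.2 (fun _ => 0) (by simp)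
    have := (abs_nonneg _).trans (h y hy)
    linarith
  · obtain ⟨y, hy, hxy⟩ := hN.2 (fun i => w i / W) (by
      simp only [div_pow]
      rw [← Finset.sum_div, ← hW2, div_self (by positivity)])
    have h1 : ∑ i, (w i / W) * w i = W := by
      have : ∑ i, (w i / W) * w i = (∑ i, w i ^ 2) / W := by
        rw [Finset.sum_div]; exact Finset.sum_congr rfl fun i _ => by ring
      rw [this, ← hW2]; field_simp
    have h2 : ∑ i, (w i / W) * w i = ∑ i, y i * w i + ∑ i, (w i / W - y i) * w i := by
      rw [← Finset.sum_add_distrib]; exact Finset.sum_congr rfl fun i _ => by ring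
    have h3 := abs_sum_mul_le Finset.univ (fun i => w i / W - y i) w
    have h4 : Real.sqrt (∑ i, (w i / W - y i) ^ 2) ≤ 1 / 2 := by
      rw [Real.sqrt_le_left (by norm_num)]
      norm_num at hxy ⊢; exact hxy
    have h5 := (abs_le.1 (h y hy)).2
    have h6 := (abs_le.1 h3).2
    have h7 : Real.sqrt (∑ i, (w i / W - y i) ^ 2) * W ≤ 1 / 2 * W :=
      mul_le_mul_of_nonneg_right h4 hW0
    rw [← hW] at h6
    linarith

lemma net_bilin {ι κ : Type*} [Fintype ι] [Fintype κ] {N1 : Finset (ι → ℝ)}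
    {N2 : Finset (κ → ℝ)} (h1 : IsNet N1) (h2 : IsNet N2) (K : ι → κ → ℝ) (τ : ℝ)
    (h : ∀ x ∈ N1, ∀ y ∈ N2, |∑ i, ∑ j, x i * K i j * y j| ≤ τ) (x : ι → ℝ) (y : κ → ℝ) :
    |∑ i, ∑ j, x i * K i j * y j| ≤
      4 * τ * (Real.sqrt (∑ i, x i ^ 2) * Real.sqrt (∑ j, y j ^ 2)) := by
  have e1 : ∀ (x : ι → ℝ) (y : κ → ℝ), ∑ i, ∑ j, x i * K i j * y j =
      ∑ i, x i * ∑ j, K i j * y j := fun x y => by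
    refine Finset.sum_congr rfl fun i _ => ?_
    rw [Finset.mul_sum]; exact Finset.sum_congr rfl fun j _ => by ring
  have e2 : ∀ (x : ι → ℝ) (y : κ → ℝ), ∑ i, ∑ j, x i * K i j * y j =
      ∑ j, y j * ∑ i, x i * K i j := fun x y => by
    rw [Finset.sum_comm]
    refine Finset.sum_congr rfl fun i _ => ?_
    rw [Finset.mul_sum]; exact Finset.sum_congr rfl fun j _ => by ring
  have hy : ∀ y ∈ N2, Real.sqrt (∑ i, (∑ j, K i j * y j) ^ 2) ≤ 2 * τ := fun y hy =>
    net_dual h1 _ τ fun x hx => by rw [← e1]; exact h x hx y hy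
  have hx : Real.sqrt (∑ j, (∑ i, x i * K i j) ^ 2) ≤
      2 * (Real.sqrt (∑ i, x i ^ 2) * (2 * τ)) :=
    net_dual h2 _ _ fun y hy' => by
      rw [← e2, e1]
      exact (abs_sum_mul_le _ _ _).trans
        (mul_le_mul_of_nonneg_left (hy y hy') (Real.sqrt_nonneg _))
  rw [e2]
  refine (abs_sum_mul_le _ _ _).trans ?_
  have := mul_le_mul_of_nonneg_left hx (Real.sqrt_nonneg (∑ j, y j ^ 2))
  linarith

/-- Edges of `H` inside `A × B`. -/
def edges {ι κ : Type*} (H : Finset (ι × κ)) (A : Finset ι) (B : Finset κ) : Finset (ι × κ) :=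
  H.filter fun e => e.1 ∈ A ∧ e.2 ∈ B

lemma peel {ι κ : Type*} (H : Finset (ι × κ)) (P Q w : ι × κ → ℝ) (F : ι → ℝ) (G : κ → ℝ)
    (l d1 d2 : ℝ) (hl : 0 < l) (hF : ∀ i, 0 ≤ F i) (hG : ∀ j, 0 ≤ G j)
    (hP0 : ∀ e, 0 ≤ P e) (hQ0 : ∀ e, 0 ≤ Q e)
    (hQF : ∀ e, Q e ≤ F e.1) (hPG : ∀ e, P e ≤ G e.2)
    (hw1 : ∀ e, w e ≤ l / 2 * Q e + 1 / (2 * l) * P e)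
    (hw2 : ∀ e, w e ≤ l / 2 * P e + 1 / (2 * l) * Q e)
    (hH : ∀ A B, ((edges H A B).card : ℝ) ≤ d1 * A.card + d2 * B.card) :
    ∀ (k : ℕ) (A : Finset ι) (B : Finset κ), A.card + B.card = k →
      ∑ e ∈ edges H A B, w e ≤ l * (d1 * ∑ i ∈ A, F i + d2 * ∑ j ∈ B, G j) +
        1 / (2 * l) * ∑ e ∈ edges H A B, (P e + Q e) := by
  intro k
  induction k with
  | zero =>
    intro A B h
    have hA : A = ∅ := by rw [← Finset.card_eq_zero]; omega
    have hB : B = ∅ := by rw [← Finset.card_eq_zero]; omega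
    subst hA; subst hB
    simp [edges]
  | succ k ih =>
    intro A B h
    have rowdeg : ((edges H A B).card : ℝ) = ∑ i ∈ A, ((edges H {i} B).card : ℝ) := by
      have := Finset.card_eq_sum_card_fiberwise (s := edges H A B) (t := A) (f := Prod.fst)
        (fun e he => by
          simp only [edges, Finset.coe_filter, Set.mem_ofPred_eq] at he; exact he.2.1)
      rw [this]; push_cast
      refine Finset.sum_congr rfl fun i hi => ?_
      congr 2; ext e; simp only [edges, Finset.mem_filter, Finset.mem_singleton]
      constructor
      · rintro ⟨⟨h1, h2, h3⟩, h4⟩; exact ⟨h1, h4, h3⟩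
      · rintro ⟨h1, h4, h3⟩; exact ⟨⟨h1, h4 ▸ hi, h3⟩, h4⟩
    have coldeg : ((edges H A B).card : ℝ) = ∑ j ∈ B, ((edges H A {j}).card : ℝ) := by
      have := Finset.card_eq_sum_card_fiberwise (s := edges H A B) (t := B) (f := Prod.snd)
        (fun e he => by
          simp only [edges, Finset.coe_filter, Set.mem_ofPred_eq] at he; exact he.2.2)
      rw [this]; push_cast
      refine Finset.sum_congr rfl fun i hi => ?_
      congr 2; ext e; simp only [edges, Finset.mem_filter, Finset.mem_singleton]
      constructor
      · rintro ⟨⟨h1, h2, h3⟩, h4⟩; exact ⟨h1, h2, h4⟩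
      · rintro ⟨h1, h2, h4⟩; exact ⟨⟨h1, h2, h4 ▸ hi⟩, h4⟩
    have hex : (∃ i ∈ A, ((edges H {i} B).card : ℝ) ≤ 2 * d1) ∨
        (∃ j ∈ B, ((edges H A {j}).card : ℝ) ≤ 2 * d2) := by
      by_contra! hcon
      obtain ⟨hr, hc⟩ := hcon
      have hAs : ∑ i ∈ A, (2 * d1) ≤ ∑ i ∈ A, ((edges H {i} B).card : ℝ) :=
        Finset.sum_le_sum fun i hi => (hr i hi).le
      have hBs : ∑ j ∈ B, (2 * d2) ≤ ∑ j ∈ B, ((edges H A {j}).card : ℝ) :=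
        Finset.sum_le_sum fun i hi => (hc i hi).le
      have hHH := hH A B
      rcases A.eq_empty_or_nonempty with hA | hA
      · have hB : B.Nonempty := by
          rw [Finset.nonempty_iff_ne_empty]; rintro rfl; subst hA; simp at h
        have hBs := Finset.sum_lt_sum_of_nonempty hB hc
        rw [← rowdeg, Finset.sum_const, nsmul_eq_mul] at hAs
        rw [← coldeg, Finset.sum_const, nsmul_eq_mul] at hBs
        linarith
      · have hAs := Finset.sum_lt_sum_of_nonempty hA hr
        rw [← rowdeg, Finset.sum_const, nsmul_eq_mul] at hAs
        rw [← coldeg, Finset.sum_const, nsmul_eq_mul] at hBs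
        linarith
    rcases hex with ⟨i, hi, hdeg⟩ | ⟨j, hj, hdeg⟩
    · have hsplit : edges H A B = (edges H (A.erase i) B) ∪ (edges H {i} B) := by
        ext e; simp only [edges, Finset.mem_filter, Finset.mem_union, Finset.mem_erase,
          Finset.mem_singleton]
        by_cases hei : e.1 = i
        · simp [hei, hi]
        · simp [hei]
      have hdis : Disjoint (edges H (A.erase i) B) (edges H {i} B) := by
        rw [Finset.disjoint_left]; intro e
        simp only [edges, Finset.mem_filter, Finset.mem_erase, Finset.mem_singleton]
        tauto
      have hih := ih (A.erase i) B (by rw [Finset.card_erase_of_mem hi]; 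
                                       have := Finset.card_pos.2 ⟨i, hi⟩; omega)
      have hFs : ∑ i ∈ A, F i = F i + ∑ i ∈ A.erase i, F i :=
        (Finset.add_sum_erase A F hi).symm
      have hnew : ∑ e ∈ edges H {i} B, w e ≤ l * (d1 * F i) +
          1 / (2 * l) * ∑ e ∈ edges H {i} B, (P e + Q e) := by
        have a1 : ∑ e ∈ edges H {i} B, w e ≤
            ∑ e ∈ edges H {i} B, (l / 2 * F i + 1 / (2 * l) * (P e + Q e)) := by
          refine Finset.sum_le_sum fun e he => ?_
          have hei : e.1 = i := by
            simp only [edges, Finset.mem_filter, Finset.mem_singleton] at he; exact he.2.1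
          have b1 := hw1 e
          have b2 := hQF e
          rw [hei] at b2
          have b3 : l / 2 * Q e ≤ l / 2 * F i := mul_le_mul_of_nonneg_left b2 (by positivity)
          have b4 : 0 ≤ 1 / (2 * l) * Q e := mul_nonneg (by positivity) (hQ0 e)
          linarith
        rw [Finset.sum_add_distrib, Finset.sum_const, nsmul_eq_mul, ← Finset.mul_sum] at a1
        have b5 := mul_le_mul_of_nonneg_right hdeg
          (show 0 ≤ l / 2 * F i from mul_nonneg (by positivity) (hF i))
        linarith
      rw [hsplit, Finset.sum_union hdis, Finset.sum_union hdis, hFs]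
      linarith
    · have hsplit : edges H A B = (edges H A (B.erase j)) ∪ (edges H A {j}) := by
        ext e; simp only [edges, Finset.mem_filter, Finset.mem_union, Finset.mem_erase,
          Finset.mem_singleton]
        by_cases hei : e.2 = j
        · simp [hei, hj]
        · simp [hei]
      have hdis : Disjoint (edges H A (B.erase j)) (edges H A {j}) := by
        rw [Finset.disjoint_left]; intro e
        simp only [edges, Finset.mem_filter, Finset.mem_erase, Finset.mem_singleton]
        tauto
      have hih := ih A (B.erase j) (by rw [Finset.card_erase_of_mem hj]; 
                                       have := Finset.card_pos.2 ⟨j, hj⟩; omega)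
      have hFs : ∑ i ∈ B, G i = G j + ∑ i ∈ B.erase j, G i :=
        (Finset.add_sum_erase B G hj).symm
      have hnew : ∑ e ∈ edges H A {j}, w e ≤ l * (d2 * G j) +
          1 / (2 * l) * ∑ e ∈ edges H A {j}, (P e + Q e) := by
        have a1 : ∑ e ∈ edges H A {j}, w e ≤
            ∑ e ∈ edges H A {j}, (l / 2 * G j + 1 / (2 * l) * (P e + Q e)) := by
          refine Finset.sum_le_sum fun e he => ?_
          have hei : e.2 = j := by
            simp only [edges, Finset.mem_filter, Finset.mem_singleton] at he; exact he.2.2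
          have b1 := hw2 e
          have b2 := hPG e
          rw [hei] at b2
          have b3 : l / 2 * P e ≤ l / 2 * G j := mul_le_mul_of_nonneg_left b2 (by positivity)
          have b4 : 0 ≤ 1 / (2 * l) * P e := mul_nonneg (by positivity) (hP0 e)
          linarith
        rw [Finset.sum_add_distrib, Finset.sum_const, nsmul_eq_mul, ← Finset.mul_sum] at a1
        have b5 := mul_le_mul_of_nonneg_right hdeg
          (show 0 ≤ l / 2 * G j from mul_nonneg (by positivity) (hG j))
        linarith
      rw [hsplit, Finset.sum_union hdis, Finset.sum_union hdis, hFs]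
      linarith

lemma cube_max {ι : Type*} [Fintype ι] (φ x : ι → ℝ) (X K : ℝ) (hX : 0 ≤ X)
    (hx0 : ∀ i, 0 ≤ x i) (hxX : ∀ i, x i ≤ X) (h : ∀ A : Finset ι, ∑ i ∈ A, φ i ≤ K) :
    ∑ i, x i * φ i ≤ X * K := by
  have h1 := h (Finset.univ.filter fun i => 0 < φ i)
  have h2 : ∑ i, x i * φ i ≤ ∑ i, X * (if 0 < φ i then φ i else 0) := by
    refine Finset.sum_le_sum fun i _ => ?_
    split_ifs with hp
    · exact mul_le_mul_of_nonneg_right (hxX i) hp.le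
    · have := mul_nonneg (hx0 i) (show 0 ≤ - φ i by linarith)
      linarith
  rw [← Finset.mul_sum, ← Finset.sum_filter] at h2
  exact h2.trans (mul_le_mul_of_nonneg_left h1 hX)

lemma vertex_bound {ι κ : Type*} [Fintype ι] [Fintype κ] (Ω : Finset (ι × κ))
    (c T1 T2 X Y : ℝ) (hX : 0 ≤ X) (hY : 0 ≤ Y)
    (h : ∀ A B, ((edges Ω A B).card : ℝ) ≤ c * (A.card * B.card) + T1 * A.card + T2 * B.card)
    (x : ι → ℝ) (y : κ → ℝ) (hx0 : ∀ i, 0 ≤ x i) (hxX : ∀ i, x i ≤ X)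
    (hy0 : ∀ j, 0 ≤ y j) (hyY : ∀ j, y j ≤ Y) :
    ∑ e ∈ Ω, x e.1 * y e.2 ≤
      c * ((∑ i, x i) * ∑ j, y j) + T1 * Y * ∑ i, x i + T2 * X * ∑ j, y j := by
  let χ : ι → κ → ℝ := fun i j => if (i, j) ∈ Ω then 1 else 0
  have hcard : ∀ A B, ((edges Ω A B).card : ℝ) = ∑ i ∈ A, ∑ j ∈ B, χ i j := by
    intro A B
    rw [← Finset.sum_product']
    simp only [χ]
    rw [← Finset.sum_filter, Finset.sum_const, nsmul_eq_mul, mul_one]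
    congr 2; ext e; simp [edges, Finset.mem_product]; tauto
  have s1 : ∀ B : Finset κ, ∑ i, x i * (∑ j ∈ B, χ i j - c * B.card - T1) ≤
      X * (T2 * B.card) := by
    intro B
    refine cube_max _ x X _ hX hx0 hxX fun A => ?_
    rw [Finset.sum_sub_distrib, Finset.sum_sub_distrib, ← hcard]
    simp only [Finset.sum_const, nsmul_eq_mul]
    linarith [h A B]
  have s2 := cube_max (fun j => ∑ i, x i * χ i j - c * ∑ i, x i - X * T2) y Y
    (T1 * ∑ i, x i) hY hy0 hyY (fun B => by
      have := s1 B
      rw [Finset.sum_sub_distrib, Finset.sum_sub_distrib, Finset.sum_comm]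
      simp only [Finset.sum_const, nsmul_eq_mul]
      simp only [mul_sub, Finset.sum_sub_distrib, ← Finset.sum_mul] at this
      simp only [← Finset.mul_sum]
      linarith)
  have s3 : ∑ e ∈ Ω, x e.1 * y e.2 = ∑ j, y j * ∑ i, x i * χ i j := by
    simp_rw [Finset.mul_sum]
    rw [Finset.sum_comm, ← Fintype.sum_prod_type']
    simp only [χ]
    rw [← Finset.sum_filter_add_sum_filter_not Finset.univ (fun e : ι × κ => e ∈ Ω)]
    rw [Finset.sum_eq_zero (s := Finset.univ.filter fun e : ι × κ => e ∉ Ω), add_zero]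
    · rw [Finset.filter_univ_mem]
      exact Finset.sum_congr rfl fun e he => by simp [he]; ring
    · intro e he
      simp only [Finset.mem_filter] at he
      simp [he.2]
  rw [s3]
  simp only [mul_sub, Finset.sum_sub_distrib, ← Finset.sum_mul] at s2
  linarith

/-- Staircase region. -/
def stair {m n : ℕ} (h : Fin m → Fin (n + 2)) (R : Fin n → Fin (n + 2)) :
    Finset (Fin m × Fin n) :=
  Finset.univ.filter fun e => R e.2 < h e.1

lemma stair_exists {m n : ℕ} (f : Fin m → ℝ) (g : Fin n → ℝ) (θ : ℝ) (hf : ∀ i, 0 ≤ f i)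
    (A : Finset (Fin m)) (B : Finset (Fin n)) :
    ∃ (h : Fin m → Fin (n + 2)) (R : Fin n → Fin (n + 2)),
      (∀ e : Fin m × Fin n, e ∈ stair h R ↔ (θ ≤ f e.1 * g e.2 ∧ e.1 ∈ A ∧ e.2 ∈ B)) ∧
      (Finset.univ.filter fun i => h i ≠ 0) ⊆ A ∧
      (Finset.univ.filter fun j => R j ≠ Fin.last (n + 1)) ⊆ B := by
  let hc : Fin m → ℕ := fun i => (Finset.univ.filter fun j => θ ≤ f i * g j).card
  let Rc : Fin n → ℕ := fun j => (Finset.univ.filter fun j' => g j < g j').card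
  have hcn : ∀ i, hc i ≤ n := fun i => (Finset.card_le_univ _).trans (by simp)
  have Rcn : ∀ i, Rc i ≤ n := fun i => (Finset.card_le_univ _).trans (by simp)
  refine ⟨fun i => if i ∈ A then ⟨hc i, by have := hcn i; omega⟩ else 0,
    fun j => if j ∈ B then ⟨Rc j, by have := Rcn j; omega⟩ else Fin.last (n + 1), ?_, ?_, ?_⟩
  · rintro ⟨i, j⟩
    simp only [stair, Finset.mem_filter, Finset.mem_univ, true_and]
    by_cases hi : i ∈ A
    · by_cases hj : j ∈ B
      · simp only [hi, hj, if_true, and_true, Fin.mk_lt_mk]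
        constructor
        · intro hlt
          by_contra! hcon
          have : hc i ≤ Rc j := by
            refine Finset.card_le_card fun j' hj' => ?_
            simp only [Finset.mem_filter, Finset.mem_univ, true_and] at hj' ⊢
            by_contra! h2
            have := mul_le_mul_of_nonneg_left h2 (hf i)
            linarith
          omega
        · intro hθ
          refine Finset.card_lt_card ?_
          rw [Finset.ssubset_iff_of_subset]
          · exact ⟨j, by simpa using hθ, by simp⟩
          · intro j' hj'
            simp only [Finset.mem_filter, Finset.mem_univ, true_and] at hj' ⊢
            exact hθ.trans (mul_le_mul_of_nonneg_left hj'.le (hf i))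
      · simp only [hi, hj, if_true, if_false, and_false, iff_false, not_lt]
        exact Fin.le_last _
    · simp only [hi, if_false, false_and, and_false, iff_false, not_lt]
      exact Fin.zero_le _
  · intro i hi
    simp only [Finset.mem_filter, Finset.mem_univ, true_and] at hi
    by_contra h; simp [h] at hi
  · intro i hi
    simp only [Finset.mem_filter, Finset.mem_univ, true_and] at hi
    by_contra h; simp [h] at hi


/-! ### Part C: probability of the good events -/

lemma not_all_imp {τ : Type*} (s : Finset τ) (P : τ → Prop) (h : ¬ ∀ t ∈ s, ¬ P t) : ∃ t ∈ s, P t := by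
  by_contra! hc
  exact h hc

lemma gram_gen {ι : Type*} [Fintype ι] {r : ℕ} {p R : ℝ} (h0 : 0 ≤ p) (h1 : p ≤ 1) (hR : 0 < R)
    (u : ι → Fin r → ℝ) (huR : ∀ e, ∑ k, u e k ^ 2 ≤ R)
    (hu : ∀ x : Fin r → ℝ, ∑ e, (∑ k, u e k * x k) ^ 2 = ∑ k, x k ^ 2) :
    BPr p (fun Ω : Finset ι => ¬ ∀ a : Fin r → ℝ,
      |∑ e ∈ Ω, (∑ k, u e k * a k) ^ 2 - p * ∑ k, a k ^ 2| ≤ p / 4 * ∑ k, a k ^ 2) ≤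
      25 ^ r * (2 * Real.exp (-(p / (1024 * R)))) := by
  obtain ⟨N, hNc, hN1, hN2⟩ := exists_net (Fin r)
  have hN : IsNet N := ⟨hN1, hN2⟩
  let P : (Fin r → ℝ) × (Fin r → ℝ) → Finset ι → Prop := fun t Ω =>
    p / 16 ≤ |∑ e ∈ Ω, (∑ k, u e k * t.1 k) * (∑ k, u e k * t.2 k) -
      p * ∑ e, (∑ k, u e k * t.1 k) * (∑ k, u e k * t.2 k)|
  have step : ∀ t ∈ N ×ˢ N, BPr p (P t) ≤ 2 * Real.exp (-(p / (1024 * R))) := by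
    intro t ht
    rw [Finset.mem_product] at ht
    have hcs : ∀ (x : Fin r → ℝ), ∑ k, x k ^ 2 ≤ 1 → ∀ e, (∑ k, u e k * x k) ^ 2 ≤ R := by
      intro x hx e
      refine (Finset.sum_mul_sq_le_sq_mul_sq _ _ _).trans ?_
      have h2 : 0 ≤ ∑ k, u e k ^ 2 := Finset.sum_nonneg fun i _ => sq_nonneg _
      have h3 : 0 ≤ ∑ k, x k ^ 2 := Finset.sum_nonneg fun i _ => sq_nonneg _
      nlinarith [huR e]
    have c1 := hcs t.1 (hN1 _ ht.1)
    have c2 := hcs t.2 (hN1 _ ht.2)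
    have := BPr_bern h0 h1 (fun e => (∑ k, u e k * t.1 k) * (∑ k, u e k * t.2 k))
      (1 / (32 * R)) (p / 16) R R (by positivity) (fun e => by
        refine abs_le_of_sq_le_sq ?_ hR.le
        rw [mul_pow, sq R]
        exact mul_le_mul (c1 e) (c2 e) (sq_nonneg _) hR.le) (by
        calc _ ≤ ∑ e, R * (∑ k, u e k * t.2 k) ^ 2 := by
              refine Finset.sum_le_sum fun e _ => ?_
              rw [mul_pow]
              exact mul_le_mul_of_nonneg_right (c1 e) (sq_nonneg _)
          _ ≤ R := by
              rw [← Finset.mul_sum, hu]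
              nlinarith [hN1 _ ht.2]) (by
        rw [div_mul_eq_mul_div, div_le_one (by positivity)]; linarith)
    refine this.trans (le_of_eq ?_)
    congr 2
    field_simp
    ring
  have hun := BPr_union h0 h1 (N ×ˢ N) P
  refine (BPr_mono h0 h1 (Q := fun Ω => ∃ t ∈ N ×ˢ N, P t Ω) ?_).trans
    (hun.trans ((Finset.sum_le_sum step).trans ?_))
  · intro Ω hΩ
    by_contra hc
    push Not at hc
    apply hΩ
    intro a
    have key := net_bilin hN hN (fun k l => ∑ e ∈ Ω, u e k * u e l - p * ∑ e, u e k * u e l)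
      (p / 16) (fun x hx y hy => by
        have := hc (x, y) (Finset.mem_product.2 ⟨hx, hy⟩)
        simp only [P, not_le] at this
        refine le_trans (le_of_eq ?_) this.le
        congr 1
        have : ∀ s : Finset ι, ∑ e ∈ s, (∑ k, u e k * x k) * (∑ k, u e k * y k) =
            ∑ k, ∑ l, x k * (∑ e ∈ s, u e k * u e l) * y l := by
          intro s
          simp_rw [Finset.sum_mul_sum, Finset.mul_sum, Finset.sum_mul]
          rw [Finset.sum_comm]
          refine Finset.sum_congr rfl fun k _ => ?_
          rw [Finset.sum_comm]
          refine Finset.sum_congr rfl fun l _ => Finset.sum_congr rfl fun e _ => by ring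
        rw [this, this]
        rw [Finset.mul_sum, ← Finset.sum_sub_distrib]
        refine Finset.sum_congr rfl fun k _ => ?_
        rw [Finset.mul_sum, ← Finset.sum_sub_distrib]
        refine Finset.sum_congr rfl fun l _ => by ring) a a
    have e1 : ∀ s : Finset ι, ∑ e ∈ s, (∑ k, u e k * a k) ^ 2 =
            ∑ k, ∑ l, a k * (∑ e ∈ s, u e k * u e l) * a l := by
      intro s
      simp_rw [sq, Finset.sum_mul_sum, Finset.mul_sum, Finset.sum_mul]
      rw [Finset.sum_comm]
      refine Finset.sum_congr rfl fun k _ => ?_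
      rw [Finset.sum_comm]
      refine Finset.sum_congr rfl fun l _ => Finset.sum_congr rfl fun e _ => by ring
    have e2 : ∑ k, ∑ l, a k * (∑ e ∈ Ω, u e k * u e l - p * ∑ e, u e k * u e l) * a l =
        ∑ e ∈ Ω, (∑ k, u e k * a k) ^ 2 - p * ∑ k, a k ^ 2 := by
      rw [← hu, e1, e1]
      rw [Finset.mul_sum, ← Finset.sum_sub_distrib]
      refine Finset.sum_congr rfl fun k _ => ?_
      rw [Finset.mul_sum, ← Finset.sum_sub_distrib]
      refine Finset.sum_congr rfl fun l _ => by ring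
    rw [e2, Real.mul_self_sqrt (Finset.sum_nonneg fun i _ => sq_nonneg _)] at key
    linarith
  · rw [Finset.sum_const, nsmul_eq_mul, Finset.card_product]
    refine mul_le_mul_of_nonneg_right ?_ (by positivity)
    have hc : N.card ≤ 5 ^ r := by simpa using hNc
    have : N.card * N.card ≤ 25 ^ r := by
      calc _ ≤ 5 ^ r * 5 ^ r := Nat.mul_le_mul hc hc
        _ = 25 ^ r := by rw [← mul_pow]; norm_num
    exact_mod_cast this

/-- Column and row Gram events. -/
lemma gram_cols {m n r : ℕ} {p R : ℝ} (h0 : 0 ≤ p) (h1 : p ≤ 1) (hR : 0 < R)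
    (U : Matrix (Fin m) (Fin r) ℝ) (hU : Uᵀ * U = 1) (hUR : ∀ i, ∑ k, U i k ^ 2 ≤ R) :
    BPr p (fun Ω : Finset (Fin m × Fin n) => ∃ j ∈ (Finset.univ : Finset (Fin n)),
      ¬ ∀ a : Fin r → ℝ,
      |∑ e ∈ Ω, (if e.2 = j then (∑ k, U e.1 k * a k) ^ 2 else 0) - p * ∑ k, a k ^ 2| ≤
        p / 4 * ∑ k, a k ^ 2) ≤
      n * (25 ^ r * (2 * Real.exp (-(p / (1024 * R))))) := by
  refine (BPr_union h0 h1 _ _).trans ?_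
  have : (n : ℝ) * (25 ^ r * (2 * Real.exp (-(p / (1024 * R))))) =
      ∑ j : Fin n, (25 ^ r * (2 * Real.exp (-(p / (1024 * R))))) := by simp
  rw [this]
  refine Finset.sum_le_sum fun j _ => ?_
  have hq : ∀ (e : Fin m × Fin n) (a : Fin r → ℝ),
      (∑ k, (if e.2 = j then U e.1 k else 0) * a k) ^ 2 =
        if e.2 = j then (∑ k, U e.1 k * a k) ^ 2 else 0 := by
    intro e a; split_ifs <;> simp
  have := gram_gen (ι := Fin m × Fin n) h0 h1 hR (fun e k => if e.2 = j then U e.1 k else 0)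
    (fun e => by
      split_ifs
      · exact hUR _
      · simp [hR.le]) (fun x => by
      simp_rw [hq]
      rw [Fintype.sum_prod_type]
      simp only [Finset.sum_ite_eq', Finset.mem_univ, if_true]
      have : ∑ i, (∑ k, U i k * x k) ^ 2 = (U *ᵥ x) ⬝ᵥ (U *ᵥ x) := by
        simp [dotProduct, Matrix.mulVec, sq]
      rw [this, Matrix.dotProduct_mulVec, Matrix.vecMul_mulVec, hU, Matrix.vecMul_one]
      simp [dotProduct, sq])
  simp_rw [hq] at this
  exact this

lemma gram_rows {m n r : ℕ} {p R : ℝ} (h0 : 0 ≤ p) (h1 : p ≤ 1) (hR : 0 < R)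
    (V : Matrix (Fin n) (Fin r) ℝ) (hV : Vᵀ * V = 1) (hVR : ∀ i, ∑ k, V i k ^ 2 ≤ R) :
    BPr p (fun Ω : Finset (Fin m × Fin n) => ∃ i ∈ (Finset.univ : Finset (Fin m)),
      ¬ ∀ a : Fin r → ℝ,
      |∑ e ∈ Ω, (if e.1 = i then (∑ k, V e.2 k * a k) ^ 2 else 0) - p * ∑ k, a k ^ 2| ≤
        p / 4 * ∑ k, a k ^ 2) ≤
      m * (25 ^ r * (2 * Real.exp (-(p / (1024 * R))))) := by
  refine (BPr_union h0 h1 _ _).trans ?_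
  have : (m : ℝ) * (25 ^ r * (2 * Real.exp (-(p / (1024 * R))))) =
      ∑ j : Fin m, (25 ^ r * (2 * Real.exp (-(p / (1024 * R))))) := by simp
  rw [this]
  refine Finset.sum_le_sum fun j _ => ?_
  have hq : ∀ (e : Fin m × Fin n) (a : Fin r → ℝ),
      (∑ k, (if e.1 = j then V e.2 k else 0) * a k) ^ 2 =
        if e.1 = j then (∑ k, V e.2 k * a k) ^ 2 else 0 := by
    intro e a; split_ifs <;> simp
  have := gram_gen (ι := Fin m × Fin n) h0 h1 hR (fun e k => if e.1 = j then V e.2 k else 0)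
    (fun e => by
      split_ifs
      · exact hVR _
      · simp [hR.le]) (fun x => by
      simp_rw [hq]
      rw [Fintype.sum_prod_type_right]
      simp only [Finset.sum_ite_eq', Finset.mem_univ, if_true]
      have : ∑ i, (∑ k, V i k * x k) ^ 2 = (V *ᵥ x) ⬝ᵥ (V *ᵥ x) := by
        simp [dotProduct, Matrix.mulVec, sq]
      rw [this, Matrix.dotProduct_mulVec, Matrix.vecMul_mulVec, hV, Matrix.vecMul_one]
      simp [dotProduct, sq])
  simp_rw [hq] at this
  exact this

lemma sum_fun_prod {ι κ : Type*} [Fintype ι] [Fintype κ] [DecidableEq ι] [DecidableEq κ] (q : ℝ) (z : κ) :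
    ∑ h : ι → κ, q ^ (Finset.univ.filter fun i => h i ≠ z).card =
      (1 + (Fintype.card κ - 1) * q) ^ Fintype.card ι := by
  have e1 : ∀ h : ι → κ, q ^ (Finset.univ.filter fun i => h i ≠ z).card =
      ∏ i, (if h i ≠ z then q else 1) := by
    intro h
    rw [Finset.prod_ite, Finset.prod_const, Finset.prod_const_one, mul_one]
  simp_rw [e1]
  have := Finset.prod_univ_sum (fun _ : ι => (Finset.univ : Finset κ))
    (fun _ v => if v ≠ z then q else 1)
  rw [Fintype.piFinset_univ] at this
  rw [← this]
  have e2 : ∑ v : κ, (if v ≠ z then q else 1) = 1 + ((Fintype.card κ : ℝ) - 1) * q := by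
    have : ∀ v : κ, (if v ≠ z then q else 1) = q + (if v = z then 1 - q else 0) := by
      intro v; by_cases h : v = z <;> simp [h]
    simp_rw [this]
    rw [Finset.sum_add_distrib, Finset.sum_ite_eq' Finset.univ z]
    simp; ring
  rw [e2]; simp

lemma sum_indicator_card {ι : Type*} [DecidableEq ι] (Ω T : Finset ι) :
    ∑ e ∈ Ω, (if e ∈ T then (1 : ℝ) else 0) = ((Ω.filter fun e => e ∈ T).card : ℝ) := by
  rw [← Finset.sum_filter]; simp

lemma exp_two_lt : Real.exp 2 < 8 := by
  have := Real.exp_one_lt_d9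
  have h2 : Real.exp 2 = Real.exp 1 * Real.exp 1 := by rw [← Real.exp_add]; norm_num
  rw [h2]
  nlinarith [Real.exp_pos 1]

lemma stair_prob {m n : ℕ} {p d : ℝ} (h0 : 0 ≤ p) (h1 : p ≤ 1) (hd : 0 ≤ d)
    (hq : (m : ℝ) * (n + 1) * Real.exp (-d) ≤ 1) (hnm : n ≤ m) :
    BPr p (fun Ω : Finset (Fin m × Fin n) => ∃ t ∈ (Finset.univ :
        Finset ((Fin m → Fin (n + 2)) × (Fin n → Fin (n + 2)))),
      8 * p * (stair t.1 t.2).card + d * (Finset.univ.filter fun i => t.1 i ≠ 0).card +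
        d * (Finset.univ.filter fun j => t.2 j ≠ Fin.last (n + 1)).card <
        ((Ω.filter fun e => e ∈ stair t.1 t.2).card : ℝ)) ≤ 9 * Real.exp (-d) := by
  refine (BPr_union h0 h1 _ _).trans ?_
  set q := Real.exp (-d) with hqd
  have hq0 : 0 < q := Real.exp_pos _
  have hq1 : q ≤ 1 := by rw [hqd]; exact Real.exp_le_one_iff.2 (by linarith)
  have step : ∀ t ∈ (Finset.univ : Finset ((Fin m → Fin (n + 2)) × (Fin n → Fin (n + 2)))),
      BPr p (fun Ω : Finset (Fin m × Fin n) =>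
        8 * p * (stair t.1 t.2).card + d * (Finset.univ.filter fun i => t.1 i ≠ 0).card +
        d * (Finset.univ.filter fun j => t.2 j ≠ Fin.last (n + 1)).card <
        ((Ω.filter fun e => e ∈ stair t.1 t.2).card : ℝ)) ≤
      q * (q ^ (Finset.univ.filter fun i => t.1 i ≠ 0).card *
        q ^ (Finset.univ.filter fun j => t.2 j ≠ Fin.last (n + 1)).card) := by
    rintro ⟨h, R⟩ -
    dsimp only
    set a := (Finset.univ.filter fun i => h i ≠ 0).card with ha
    set b := (Finset.univ.filter fun j => R j ≠ Fin.last (n + 1)).card with hb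
    rcases (stair h R).eq_empty_or_nonempty with hs | hs
    · rw [BPr_false]
      · positivity
      · intro Ω hΩ
        rw [hs] at hΩ
        simp at hΩ
        have : 0 ≤ d * a + d * b := by positivity
        linarith
    · have ha1 : 1 ≤ a := by
        obtain ⟨e, he⟩ := hs
        simp only [stair, Finset.mem_filter, Finset.mem_univ, true_and] at he
        refine Finset.card_pos.2 ⟨e.1, ?_⟩
        simp only [Finset.mem_filter, Finset.mem_univ, true_and]
        rintro h0
        rw [h0] at he
        exact absurd he (Fin.not_lt_zero _)
      have hch := BPr_chernoff h0 h1 (fun e => if e ∈ stair h R then (1 : ℝ) else 0) 2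
        (8 * p * (stair h R).card + d * a + d * b) (by norm_num)
      refine (BPr_mono h0 h1 ?_).trans (hch.trans ?_)
      · intro Ω hΩ
        rw [sum_indicator_card]; exact hΩ.le
      · have e1 : ∑ e, (Real.exp (2 * (if e ∈ stair h R then (1 : ℝ) else 0)) - 1) =
            (Real.exp 2 - 1) * (stair h R).card := by
          have : ∀ e, (Real.exp (2 * (if e ∈ stair h R then (1 : ℝ) else 0)) - 1) =
              (if e ∈ stair h R then Real.exp 2 - 1 else 0) := by
            intro e; split_ifs <;> simp
          simp_rw [this]
          rw [← Finset.sum_filter]; simp; ring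
        rw [e1, ← pow_add, ← pow_succ', hqd, ← Real.exp_nat_mul, Real.exp_le_exp]
        push_cast
        have e2 := exp_two_lt
        have e3 : 0 ≤ p * (stair h R).card := by positivity
        have e4 : (1 : ℝ) ≤ a := by exact_mod_cast ha1
        have e5 : (0 : ℝ) ≤ b := by positivity
        nlinarith
  refine (Finset.sum_le_sum step).trans ?_
  rw [← Finset.mul_sum, ← Finset.univ_product_univ, Finset.sum_product]
  simp_rw [← Finset.mul_sum, ← Finset.sum_mul]
  rw [sum_fun_prod q (0 : Fin (n + 2)), sum_fun_prod q (Fin.last (n + 1))]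
  simp only [Fintype.card_fin]
  have b1 : (1 + (((n + 2 : ℕ) : ℝ) - 1) * q) ^ m ≤ Real.exp 1 := by
    have : 1 + (((n + 2 : ℕ) : ℝ) - 1) * q ≤ Real.exp ((n + 1) * q) := by
      have := Real.add_one_le_exp ((n + 1) * q)
      push_cast; linarith
    refine (pow_le_pow_left₀ (by push_cast; nlinarith [(Nat.cast_nonneg n : (0:ℝ) ≤ n)]) this m).trans ?_
    rw [← Real.exp_nat_mul, Real.exp_le_exp]; linarith
  have b2 : (1 + (((n + 2 : ℕ) : ℝ) - 1) * q) ^ n ≤ Real.exp 1 := by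
    refine le_trans (pow_le_pow_right₀ ?_ hnm) b1
    push_cast; nlinarith [(Nat.cast_nonneg n : (0:ℝ) ≤ n)]
  have b3 : 0 ≤ (1 + (((n + 2 : ℕ) : ℝ) - 1) * q) := by
    push_cast; nlinarith [(Nat.cast_nonneg n : (0:ℝ) ≤ n)]
  have b4 := mul_le_mul b1 b2 (pow_nonneg b3 n) (Real.exp_pos 1).le
  have b5 : Real.exp 1 * Real.exp 1 ≤ 9 := by
    rw [← Real.exp_add]; norm_num; linarith [exp_two_lt]
  nlinarith

lemma choose_bd (m a : ℕ) : (m.choose a : ℝ) * ((Real.exp 1 * m / a) ^ a)⁻¹ ≤ 1 := by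
  rcases Nat.eq_zero_or_pos a with rfl | ha
  · simp
  rcases Nat.eq_zero_or_pos m with rfl | hm
  · rw [Nat.choose_eq_zero_of_lt ha]; simp
  have h1 := Nat.choose_le_pow_div (α := ℝ) a m
  have h2 := Real.pow_div_factorial_le_exp (a : ℝ) (by positivity) a
  have ha' : (0 : ℝ) < a := by exact_mod_cast ha
  have hm' : (0 : ℝ) < m := by exact_mod_cast hm
  have h3 : (0 : ℝ) < (a.factorial : ℝ) := by exact_mod_cast a.factorial_pos
  rw [← div_eq_mul_inv, div_le_one (by positivity)]
  refine h1.trans ?_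
  rw [div_pow, mul_pow, ← Real.exp_nat_mul, mul_one]
  rw [div_le_div_iff₀ h3 (by positivity)]
  rw [div_le_iff₀ h3] at h2
  nlinarith [pow_pos hm' a]

lemma sum_sets_bd (m : ℕ) : ∑ A : Finset (Fin m), ((Real.exp 1 * m / A.card) ^ A.card)⁻¹ ≤ (m + 1 : ℝ) := by
  have := Finset.sum_powerset_apply_card (fun k => ((Real.exp 1 * m / (k : ℝ)) ^ k)⁻¹)
    (x := (Finset.univ : Finset (Fin m)))
  rw [Finset.powerset_univ] at this
  rw [this]
  refine (Finset.sum_le_sum (g := fun _ => (1 : ℝ)) fun k _ => ?_).trans ?_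
  · rw [nsmul_eq_mul]
    simpa using choose_bd m k
  · simp

set_option maxHeartbeats 2000000 in
lemma rect_prob {m n : ℕ} {p ε T : ℝ} (hp0 : 0 < p) (h1 : p ≤ 1) (hnm : n ≤ m) (hn : 1 ≤ n)
    (hε : 0 < ε) (hε1 : ε ≤ 1) (hT : T = ε * (p * n)) (hT2 : 30 * (3 + 1 / ε) ≤ T) :
    BPr p (fun Ω : Finset (Fin m × Fin n) => ∃ t ∈ (Finset.univ :
        Finset (Finset (Fin m) × Finset (Fin n))),
      8 * p * ((t.1.card : ℝ) * t.2.card) + T * t.1.card + T * ((m : ℝ) / n) * t.2.card <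
        ((edges Ω t.1 t.2).card : ℝ)) ≤ (m + 1) * (n + 1) * ((n : ℝ) ^ 29)⁻¹ := by
  have h0 := hp0.le
  refine (BPr_union h0 h1 _ _).trans ?_
  have hn' : (1 : ℝ) ≤ n := by exact_mod_cast hn
  have hnm' : (n : ℝ) ≤ m := by exact_mod_cast hnm
  have hT0 : 0 < T := by rw [hT]; positivity
  have step : ∀ t ∈ (Finset.univ : Finset (Finset (Fin m) × Finset (Fin n))),
      BPr p (fun Ω : Finset (Fin m × Fin n) => 
      8 * p * ((t.1.card : ℝ) * t.2.card) + T * t.1.card + T * ((m : ℝ) / n) * t.2.card <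
        ((edges Ω t.1 t.2).card : ℝ)) ≤
      ((n : ℝ) ^ 29)⁻¹ * (((Real.exp 1 * m / t.1.card) ^ t.1.card)⁻¹ *
        ((Real.exp 1 * n / t.2.card) ^ t.2.card)⁻¹) := by
    rintro ⟨A, B⟩ -
    dsimp only
    by_cases hAB : A = ∅ ∨ B = ∅
    · rw [BPr_false]
      · positivity
      · intro Ω hΩ
        have : edges Ω A B = ∅ := by
          ext e; simp only [edges, Finset.mem_filter]; rcases hAB with rfl | rfl <;> simp
        rw [this] at hΩ
        simp only [Finset.card_empty, Nat.cast_zero] at hΩ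
        have : 0 ≤ 8 * p * ((A.card : ℝ) * B.card) + T * A.card + T * ((m : ℝ) / n) * B.card := by
          positivity
        linarith
    · push Not at hAB
      have ha : (1 : ℝ) ≤ A.card := by
        exact_mod_cast Finset.card_pos.2 hAB.1
      have hb : (1 : ℝ) ≤ B.card := by
        exact_mod_cast Finset.card_pos.2 hAB.2
      have ham : (A.card : ℝ) ≤ m := by
        exact_mod_cast (Finset.card_le_univ A).trans (by simp)
      have hbn : (B.card : ℝ) ≤ n := by
        exact_mod_cast (Finset.card_le_univ B).trans (by simp)
      have hcard : ((A ×ˢ B).card : ℝ) = A.card * B.card := by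
        rw [Finset.card_product]; push_cast; rfl
      set a : ℝ := (A.card : ℝ) with hadef
      set b : ℝ := (B.card : ℝ) with hbdef
      set α : ℝ := (m : ℝ) / n with hα
      have hα1 : 1 ≤ α := by rw [hα, le_div_iff₀ (by linarith)]; linarith
      set s := 8 * p * (a * b) + T * a + T * α * b with hs
      set w := n / b + m / a with hw
      set u := 8 + ε * w with hu
      have hsu : s = p * (a * b) * u := by
        rw [hs, hu, hw, hT, hα]; field_simp; ring
      have hw1 : 1 ≤ n / b := by rw [le_div_iff₀ (by linarith)]; linarith
      have hw2 : 1 ≤ m / a := by rw [le_div_iff₀ (by linarith)]; linarith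
      have hw0 : 0 < w := by rw [hw]; linarith
      have hu8 : 8 ≤ u := by rw [hu]; have := mul_pos hε hw0; linarith
      set L := Real.log u - 1 with hL
      have hL1 : 1 ≤ L := by
        have : 2 ≤ Real.log u := by
          rw [Real.le_log_iff_exp_le (by linarith)]; linarith [exp_two_lt]
        linarith
      have hch := BPr_chernoff h0 h1 (fun e : Fin m × Fin n => if e ∈ A ×ˢ B then (1 : ℝ) else 0)
        (Real.log u) s (by linarith)
      refine (BPr_mono h0 h1 ?_).trans (hch.trans ?_)
      · intro Ω hΩ
        rw [sum_indicator_card]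
        refine hΩ.le.trans (le_of_eq ?_)
        congr 2
        ext e; simp [edges]
      · have e1 : ∑ e : Fin m × Fin n, (Real.exp (Real.log u * (if e ∈ A ×ˢ B then (1 : ℝ) else 0)) - 1) =
            (u - 1) * (a * b) := by
          have : ∀ e : Fin m × Fin n, (Real.exp (Real.log u * (if e ∈ A ×ˢ B then (1 : ℝ) else 0)) - 1) =
              (if e ∈ A ×ˢ B then u - 1 else 0) := by
            intro e; split_ifs
            · rw [mul_one, Real.exp_log (by linarith)]
            · simp
          simp_rw [this]
          rw [← Finset.sum_filter, Finset.sum_const, nsmul_eq_mul, Finset.filter_mem_eq_inter,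
            Finset.univ_inter, hcard]
          ring
        rw [e1]
        -- exponent bound
        have e2 : -(Real.log u * s) + p * ((u - 1) * (a * b)) ≤ -(s * L) := by
          have : 0 ≤ p * (a * b) := by positivity
          have : p * ((u - 1) * (a * b)) ≤ s := by rw [hsu]; linarith
          rw [hL]; linarith
        have lw : Real.log w ≤ 1 + L + 1 / ε := by
          have x1 : Real.log w ≤ Real.log (u * (1 / ε)) := by
            apply Real.log_le_log hw0
            rw [mul_one_div, le_div_iff₀ hε, hu]; linarith
          rw [Real.log_mul (by linarith) (by positivity)] at x1
          have x2 : Real.log (1 / ε) ≤ 1 / ε := by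
            have := Real.log_le_sub_one_of_pos (show 0 < 1 / ε by positivity)
            linarith
          linarith
        have hε2 : 0 < 1 / ε := by positivity
        have lw2 : 1 + Real.log w ≤ L * (3 + 1 / ε) := by
          have := mul_nonneg (sub_nonneg.2 hL1) hε2.le
          linarith
        have lwp : 0 < 1 + Real.log w := by
          have : 0 ≤ Real.log w := Real.log_nonneg (by rw [hw]; linarith)
          linarith
        have e3 : 30 * (a + b) * (1 + Real.log w) ≤ s * L := by
          have y1 : T * (a + b) ≤ s := by
            have z1 : 0 ≤ 8 * p * (a * b) := by positivity
            have z2 : T * b ≤ T * α * b := by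
              have : 0 ≤ T * b * (α - 1) := mul_nonneg (by positivity) (by linarith)
              linarith
            rw [hs]; linarith
          calc 30 * (a + b) * (1 + Real.log w) ≤ 30 * (a + b) * (L * (3 + 1 / ε)) := by
                apply mul_le_mul_of_nonneg_left lw2; positivity
            _ = (30 * (3 + 1 / ε)) * ((a + b) * L) := by ring
            _ ≤ T * ((a + b) * L) := by
                apply mul_le_mul_of_nonneg_right hT2; positivity
            _ = (T * (a + b)) * L := by ring
            _ ≤ s * L := by apply mul_le_mul_of_nonneg_right y1; linarith
        have lA : Real.log ((Real.exp 1 * m / a) ^ A.card) ≤ a * (1 + Real.log w) := by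
          rw [Real.log_pow, mul_div_assoc, Real.log_mul (Real.exp_pos 1).ne' (by linarith), Real.log_exp]
          apply mul_le_mul_of_nonneg_left _ (by linarith)
          have := Real.log_le_log (by linarith) (show (m : ℝ) / a ≤ w by rw [hw]; linarith)
          linarith
        have lB : Real.log ((Real.exp 1 * n / b) ^ B.card) ≤ b * (1 + Real.log w) := by
          rw [Real.log_pow, mul_div_assoc, Real.log_mul (Real.exp_pos 1).ne' (by linarith), Real.log_exp]
          apply mul_le_mul_of_nonneg_left _ (by linarith)
          have := Real.log_le_log (by linarith) (show (n : ℝ) / b ≤ w by rw [hw]; linarith)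
          linarith
        have lN : Real.log n ≤ (a + b) * (1 + Real.log w) := by
          have x1 : Real.log n = Real.log (n / b) + Real.log b := by
            rw [← Real.log_mul (by linarith) (by linarith)]; congr 1; field_simp
          have x2 := Real.log_le_log (by linarith) (show (n : ℝ) / b ≤ w by rw [hw]; linarith)
          have x3 := Real.log_le_sub_one_of_pos (show 0 < b by linarith)
          have x4 : 0 ≤ Real.log w := by linarith [Real.log_nonneg hw1]
          have x5 : 0 ≤ (a + b - 1) * Real.log w := mul_nonneg (by linarith) x4
          linarith
        have key : -(Real.log u * s) + p * ((u - 1) * (a * b)) ≤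
            -(29 * Real.log n + Real.log ((Real.exp 1 * m / a) ^ A.card) +
              Real.log ((Real.exp 1 * n / b) ^ B.card)) := by linarith
        refine (Real.exp_le_exp.2 key).trans (le_of_eq ?_)
        have hm0 : (0 : ℝ) < m := by linarith
        have pa : 0 < (Real.exp 1 * m / a) ^ A.card := by positivity
        have pb : 0 < (Real.exp 1 * n / b) ^ B.card := by positivity
        rw [Real.exp_neg, Real.exp_add, Real.exp_add, Real.exp_log pa, Real.exp_log pb, mul_inv,
          mul_inv, mul_assoc]
        congr 2
        rw [show (29 : ℝ) = ((29 : ℕ) : ℝ) by norm_num, ← Real.log_pow, Real.exp_log (by positivity)]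
  refine (Finset.sum_le_sum step).trans ?_
  rw [← Finset.mul_sum, ← Finset.univ_product_univ, Finset.sum_product]
  simp_rw [← Finset.mul_sum, ← Finset.sum_mul]
  rw [mul_comm]
  apply mul_le_mul_of_nonneg_right _ (by positivity)
  exact mul_le_mul (sum_sets_bd m) (sum_sets_bd n)
    (Finset.sum_nonneg fun _ _ => by positivity) (by positivity)

/-- The bilinear entry `(U_i·x_j)(y_i·V_j)`. -/
def bl {m n r : ℕ} (U : Matrix (Fin m) (Fin r) ℝ) (V : Matrix (Fin n) (Fin r) ℝ)
    (x : Fin n × Fin r → ℝ) (y : Fin m × Fin r → ℝ) (e : Fin m × Fin n) : ℝ :=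
  (∑ k, U e.1 k * x (e.2, k)) * (∑ k, V e.2 k * y (e.1, k))

/-- squared norm of a row -/
def rsq {m r : ℕ} (x : Fin m × Fin r → ℝ) (i : Fin m) : ℝ := ∑ k, x (i, k) ^ 2

lemma rsq_nonneg {m r : ℕ} (x : Fin m × Fin r → ℝ) (i : Fin m) : 0 ≤ rsq x i :=
  Finset.sum_nonneg fun _ _ => sq_nonneg _

lemma sum_rsq {m r : ℕ} (x : Fin m × Fin r → ℝ) : ∑ i, rsq x i = ∑ q, x q ^ 2 := by
  rw [Fintype.sum_prod_type]; rfl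

lemma bl_left {m n r : ℕ} {U : Matrix (Fin m) (Fin r) ℝ} {Ru : ℝ}
    (hU : ∀ i, ∑ k, U i k ^ 2 ≤ Ru) (x : Fin n × Fin r → ℝ) (i : Fin m) (j : Fin n) :
    (∑ k, U i k * x (j, k)) ^ 2 ≤ rsq x j * Ru := by
  refine (Finset.sum_mul_sq_le_sq_mul_sq _ _ _).trans ?_
  rw [mul_comm]
  exact mul_le_mul_of_nonneg_left (hU i) (rsq_nonneg x j)

lemma bl_sq {m n r : ℕ} {U : Matrix (Fin m) (Fin r) ℝ} {V : Matrix (Fin n) (Fin r) ℝ} {Ru Rv : ℝ}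
    (hU : ∀ i, ∑ k, U i k ^ 2 ≤ Ru) (hV : ∀ i, ∑ k, V i k ^ 2 ≤ Rv) (hRu : 0 ≤ Ru)
    (x : Fin n × Fin r → ℝ) (y : Fin m × Fin r → ℝ)
    (e : Fin m × Fin n) : bl U V x y e ^ 2 ≤ Ru * Rv * (rsq y e.1 * rsq x e.2) := by
  rw [bl, mul_pow]
  have h1 := bl_left hU x e.1 e.2
  have h2 := bl_left hV y e.2 e.1
  have := mul_le_mul h1 h2 (sq_nonneg _) (mul_nonneg (rsq_nonneg x _) hRu)
  linarith

/-- The truncated (light) coefficient. -/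
def lt' {m n r : ℕ} (θ : ℝ) (U : Matrix (Fin m) (Fin r) ℝ) (V : Matrix (Fin n) (Fin r) ℝ)
    (x : Fin n × Fin r → ℝ) (y : Fin m × Fin r → ℝ) (e : Fin m × Fin n) : ℝ :=
  if θ ≤ rsq y e.1 * rsq x e.2 then 0 else bl U V x y e

lemma sum_rsq_mul {m n r : ℕ} {x : Fin n × Fin r → ℝ} {y : Fin m × Fin r → ℝ}
    (hx : ∑ q, x q ^ 2 ≤ 1) (hy : ∑ q, y q ^ 2 ≤ 1) :
    ∑ e : Fin m × Fin n, rsq y e.1 * rsq x e.2 ≤ 1 := by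
  rw [Fintype.sum_prod_type]
  simp only
  rw [← Finset.sum_mul_sum, sum_rsq, sum_rsq]
  have h1 : 0 ≤ ∑ q, x q ^ 2 := Finset.sum_nonneg fun _ _ => sq_nonneg _
  have h2 : 0 ≤ ∑ q, y q ^ 2 := Finset.sum_nonneg fun _ _ => sq_nonneg _
  nlinarith

lemma light_prob {m n r : ℕ} {p Ru Rv : ℝ} (h0 : 0 ≤ p) (h1 : p ≤ 1) (hRu : 0 < Ru) (hRv : 0 < Rv)
    (U : Matrix (Fin m) (Fin r) ℝ) (V : Matrix (Fin n) (Fin r) ℝ)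
    (hU : ∀ i, ∑ k, U i k ^ 2 ≤ Ru) (hV : ∀ i, ∑ k, V i k ^ 2 ≤ Rv)
    (N1 : Finset (Fin n × Fin r → ℝ)) (N2 : Finset (Fin m × Fin r → ℝ))
    (hN1 : ∀ x ∈ N1, ∑ q, x q ^ 2 ≤ 1) (hN2 : ∀ x ∈ N2, ∑ q, x q ^ 2 ≤ 1) :
    BPr p (fun Ω : Finset (Fin m × Fin n) => ∃ t ∈ N1 ×ˢ N2,
      p / 100 ≤ |∑ e ∈ Ω, lt' (10 ^ 14 * (Ru * Rv)) U V t.1 t.2 e -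
        p * ∑ e, lt' (10 ^ 14 * (Ru * Rv)) U V t.1 t.2 e|) ≤
      ((N1 ×ˢ N2).card : ℝ) * (2 * Real.exp (-(p / (2 * 10 ^ 9 * (Ru * Rv))))) := by
  refine (BPr_union h0 h1 _ _).trans ?_
  rw [← nsmul_eq_mul, ← Finset.sum_const]
  refine Finset.sum_le_sum fun t ht => ?_
  rw [Finset.mem_product] at ht
  set W := Ru * Rv with hW
  have hW0 : 0 < W := by positivity
  have hsq : ∀ e, lt' (10 ^ 14 * W) U V t.1 t.2 e ^ 2 ≤ W * (rsq t.2 e.1 * rsq t.1 e.2) := by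
    intro e
    have := bl_sq hU hV hRu.le t.1 t.2 e
    rw [lt']; split_ifs
    · have := mul_nonneg (rsq_nonneg t.2 e.1) (rsq_nonneg t.1 e.2)
      simp only [ne_eq, OfNat.ofNat_ne_zero, not_false_eq_true, zero_pow]
      positivity
    · exact this
  have := BPr_bern h0 h1 (lt' (10 ^ 14 * W) U V t.1 t.2)
    (1 / (10 ^ 7 * W)) (p / 100) (10 ^ 7 * W) W (by positivity) (fun e => by
      refine abs_le_of_sq_le_sq ?_ (by positivity)
      by_cases hc : 10 ^ 14 * W ≤ rsq t.2 e.1 * rsq t.1 e.2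
      · rw [lt', if_pos hc, zero_pow two_ne_zero]; positivity
      · have h3 := hsq e
        push Not at hc
        have := mul_le_mul_of_nonneg_left hc.le hW0.le
        linarith) (by
      refine (Finset.sum_le_sum fun e _ => hsq e).trans ?_
      rw [← Finset.mul_sum]
      have := sum_rsq_mul (hN1 _ ht.1) (hN2 _ ht.2)
      nlinarith) (by
      rw [one_div, inv_mul_cancel₀ (by positivity)])
  refine this.trans ?_
  refine mul_le_mul_of_nonneg_left (Real.exp_le_exp.2 ?_) (by norm_num)
  have e1 : -(1 / (10 ^ 7 * W) * (p / 100)) + p * (1 / (10 ^ 7 * W)) ^ 2 * W = 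
    -((10 ^ 5 - 1) * (p / (10 ^ 14 * W))) := by
    field_simp; ring
  have e2 : p / (2 * 10 ^ 9 * W) = 50000 * (p / (10 ^ 14 * W)) := by
    field_simp; ring
  rw [e1, e2]
  have : 0 ≤ p / (10 ^ 14 * W) := by positivity
  linarith

lemma sum_cols {m n r : ℕ} {p : ℝ} {Ω : Finset (Fin m × Fin n)} {U : Matrix (Fin m) (Fin r) ℝ}
    (hG : ∀ j (a : Fin r → ℝ),
      |∑ e ∈ Ω, (if e.2 = j then (∑ k, U e.1 k * a k) ^ 2 else 0) - p * ∑ k, a k ^ 2| ≤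
        p / 4 * ∑ k, a k ^ 2) (x : Fin n × Fin r → ℝ) :
    |∑ e ∈ Ω, (∑ k, U e.1 k * x (e.2, k)) ^ 2 - p * ∑ q, x q ^ 2| ≤ p / 4 * ∑ q, x q ^ 2 := by
  have e1 : ∑ e ∈ Ω, (∑ k, U e.1 k * x (e.2, k)) ^ 2 = ∑ j, ∑ e ∈ Ω,
      (if e.2 = j then (∑ k, U e.1 k * x (j, k)) ^ 2 else 0) := by
    rw [Finset.sum_comm]
    refine Finset.sum_congr rfl fun e _ => ?_
    rw [Finset.sum_ite_eq]; simp
  rw [e1, Fintype.sum_prod_type, Finset.mul_sum, Finset.mul_sum, ← Finset.sum_sub_distrib]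
  refine (Finset.abs_sum_le_sum_abs _ _).trans (Finset.sum_le_sum fun j _ => hG j _)

lemma sum_rows {m n r : ℕ} {p : ℝ} {Ω : Finset (Fin m × Fin n)} {V : Matrix (Fin n) (Fin r) ℝ}
    (hG : ∀ j (a : Fin r → ℝ),
      |∑ e ∈ Ω, (if e.1 = j then (∑ k, V e.2 k * a k) ^ 2 else 0) - p * ∑ k, a k ^ 2| ≤
        p / 4 * ∑ k, a k ^ 2) (x : Fin m × Fin r → ℝ) :
    |∑ e ∈ Ω, (∑ k, V e.2 k * x (e.1, k)) ^ 2 - p * ∑ q, x q ^ 2| ≤ p / 4 * ∑ q, x q ^ 2 := by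
  have e1 : ∑ e ∈ Ω, (∑ k, V e.2 k * x (e.1, k)) ^ 2 = ∑ j, ∑ e ∈ Ω,
      (if e.1 = j then (∑ k, V e.2 k * x (j, k)) ^ 2 else 0) := by
    rw [Finset.sum_comm]
    refine Finset.sum_congr rfl fun e _ => ?_
    rw [Finset.sum_ite_eq]; simp
  rw [e1, Fintype.sum_prod_type, Finset.mul_sum, Finset.mul_sum, ← Finset.sum_sub_distrib]
  refine (Finset.abs_sum_le_sum_abs _ _).trans (Finset.sum_le_sum fun j _ => hG j _)

lemma heavy_arith {p Ru Rv t a b ca cb : ℝ} (h0 : 0 ≤ p) (hRu : 0 < Ru) (hRv : 0 < Rv)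
    (hRuv : Ru ≤ Rv) (ha : 0 ≤ a) (hb : 0 ≤ b) (ht0 : 0 ≤ t) (hca : ca ≤ a) (hcb : cb ≤ b)
    (t1 : t ≤ a * b) (t2 : t * (10 ^ 14 * (Ru * Rv)) ≤ 1) :
    8 * p * t + 5 / 10 ^ 6 * (p / Rv) * ca + 5 / 10 ^ 6 * (p / Rv) * cb ≤
      1 / 160000 * (p / Rv) * a + 1 / 160000 * (p / Ru) * b := by
  set a' := a / Rv with ha'
  set b' := b / Ru with hb'
  have ha'0 : 0 ≤ a' := by positivity
  have hb'0 : 0 ≤ b' := by positivity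
  have t3 : t ≤ (a' + b') / (2 * 10 ^ 7) := by
    refine abs_le_of_sq_le_sq' ?_ (by positivity) |>.2
    have q1 : a = a' * Rv := by rw [ha']; field_simp
    have q2 : b = b' * Ru := by rw [hb']; field_simp
    have : t ^ 2 ≤ a' * b' / 10 ^ 14 := by
      have z1 : t * t ≤ t * (a' * b' * (Ru * Rv)) := by
        rw [q1, q2] at t1
        have := mul_le_mul_of_nonneg_left t1 ht0
        linarith
      have z2 : a' * b' * (t * (10 ^ 14 * (Ru * Rv))) ≤ a' * b' * 1 :=
        mul_le_mul_of_nonneg_left t2 (by positivity)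
      rw [le_div_iff₀ (by norm_num)]
      linarith
    refine this.trans ?_
    rw [div_pow, div_le_div_iff₀ (by norm_num) (by norm_num)]
    linarith [sq_nonneg (a' - b')]
  have f1 : p / Rv * a = p * a' := by rw [ha']; ring
  have f2 : p / Ru * b = p * b' := by rw [hb']; ring
  have f3 : p / Rv * b ≤ p * b' := by
    rw [← f2]; gcongr
  have f4 : p / Rv * ca ≤ p / Rv * a := by gcongr
  have f5 : p / Rv * cb ≤ p / Rv * b := by gcongr
  have f6 : p * t ≤ p * ((a' + b') / (2 * 10 ^ 7)) := mul_le_mul_of_nonneg_left t3 h0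
  have f7 : 0 ≤ p * a' := by positivity
  have f8 : 0 ≤ p * b' := by positivity
  have g1 : 1 / 160000 * (p / Rv) * a + 1 / 160000 * (p / Ru) * b = 1 / 160000 * (p * a' + p * b') := by
    rw [← f1, ← f2]; ring
  rw [g1]
  linarith

lemma heavy_count {m n r : ℕ} {p Ru Rv : ℝ} (h0 : 0 ≤ p) (hRu : 0 < Ru) (hRv : 0 < Rv)
    (hRuv : Ru ≤ Rv) (Ω : Finset (Fin m × Fin n))
    (hS : ∀ (h : Fin m → Fin (n + 2)) (R : Fin n → Fin (n + 2)),
      ((Ω.filter fun e => e ∈ stair h R).card : ℝ) ≤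
      8 * p * (stair h R).card + 5 / 10 ^ 6 * (p / Rv) * (Finset.univ.filter fun i => h i ≠ 0).card +
        5 / 10 ^ 6 * (p / Rv) * (Finset.univ.filter fun j => R j ≠ Fin.last (n + 1)).card)
    (x : Fin n × Fin r → ℝ) (y : Fin m × Fin r → ℝ)
    (hx : ∑ q, x q ^ 2 ≤ 1) (hy : ∑ q, y q ^ 2 ≤ 1) (A : Finset (Fin m)) (B : Finset (Fin n)) :
    ((edges (Ω.filter fun e => 10 ^ 14 * (Ru * Rv) ≤ rsq y e.1 * rsq x e.2) A B).card : ℝ) ≤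
      1 / 160000 * (p / Rv) * A.card + 1 / 160000 * (p / Ru) * B.card := by
  obtain ⟨h, R, hst, hA, hB⟩ := stair_exists (rsq y) (rsq x) (10 ^ 14 * (Ru * Rv))
    (rsq_nonneg y) A B
  have hh := hS h R
  have e1 : (edges (Ω.filter fun e => 10 ^ 14 * (Ru * Rv) ≤ rsq y e.1 * rsq x e.2) A B) =
      Ω.filter fun e => e ∈ stair h R := by
    ext e
    simp only [edges, Finset.mem_filter, hst]
    tauto
  rw [e1]
  have cA : ((Finset.univ.filter fun i => h i ≠ 0).card : ℝ) ≤ A.card := by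
    exact_mod_cast Finset.card_le_card hA
  have cB : ((Finset.univ.filter fun j => R j ≠ Fin.last (n + 1)).card : ℝ) ≤ B.card := by
    exact_mod_cast Finset.card_le_card hB
  have t1 : ((stair h R).card : ℝ) ≤ A.card * B.card := by
    have : (stair h R) ⊆ A ×ˢ B := by
      intro e he; rw [Finset.mem_product]; exact ((hst e).1 he).2
    have := Finset.card_le_card this
    rw [Finset.card_product] at this
    exact_mod_cast this
  have t2 : ((stair h R).card : ℝ) * (10 ^ 14 * (Ru * Rv)) ≤ 1 := by
    rw [← nsmul_eq_mul, ← Finset.sum_const]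
    refine le_trans (Finset.sum_le_sum fun e he => ((hst e).1 he).1) ?_
    refine le_trans (Finset.sum_le_sum_of_subset_of_nonneg (Finset.subset_univ _)
      fun e _ _ => mul_nonneg (rsq_nonneg _ _) (rsq_nonneg _ _)) (sum_rsq_mul hx hy)
  refine hh.trans ?_
  exact heavy_arith h0 hRu hRv hRuv (by positivity) (by positivity) (by positivity) cA cB t1 t2


lemma R3_net {m n r : ℕ} {p Ru Rv : ℝ} (h0 : 0 ≤ p) (hRu : 0 < Ru) (hRv : 0 < Rv)
    (hRuv : Ru ≤ Rv) (Ω : Finset (Fin m × Fin n))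
    (U : Matrix (Fin m) (Fin r) ℝ) (V : Matrix (Fin n) (Fin r) ℝ)
    (hU : ∀ i, ∑ k, U i k ^ 2 ≤ Ru) (hV : ∀ i, ∑ k, V i k ^ 2 ≤ Rv)
    (hG1 : ∀ x : Fin n × Fin r → ℝ,
      |∑ e ∈ Ω, (∑ k, U e.1 k * x (e.2, k)) ^ 2 - p * ∑ q, x q ^ 2| ≤ p / 4 * ∑ q, x q ^ 2)
    (hG2 : ∀ x : Fin m × Fin r → ℝ,
      |∑ e ∈ Ω, (∑ k, V e.2 k * x (e.1, k)) ^ 2 - p * ∑ q, x q ^ 2| ≤ p / 4 * ∑ q, x q ^ 2)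
    (x : Fin n × Fin r → ℝ) (y : Fin m × Fin r → ℝ)
    (hH : ∀ (A : Finset (Fin m)) (B : Finset (Fin n)),
      ((edges (Ω.filter fun e => 10 ^ 14 * (Ru * Rv) ≤ rsq y e.1 * rsq x e.2) A B).card : ℝ) ≤
      1 / 160000 * (p / Rv) * A.card + 1 / 160000 * (p / Ru) * B.card)
    (hx : ∑ q, x q ^ 2 ≤ 1) (hy : ∑ q, y q ^ 2 ≤ 1)
    (hL : |∑ e ∈ Ω, lt' (10 ^ 14 * (Ru * Rv)) U V x y e -
        p * ∑ e, lt' (10 ^ 14 * (Ru * Rv)) U V x y e| ≤ p / 100) :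
    |∑ e ∈ Ω, bl U V x y e - p * ∑ e, bl U V x y e| ≤ p / 40 := by
  set W := Ru * Rv with hW
  have hW0 : 0 < W := by positivity
  have split : ∀ s : Finset (Fin m × Fin n), ∑ e ∈ s, bl U V x y e =
      ∑ e ∈ s, lt' (10 ^ 14 * W) U V x y e +
        ∑ e ∈ s.filter (fun e => 10 ^ 14 * W ≤ rsq y e.1 * rsq x e.2), bl U V x y e := by
    intro s
    rw [Finset.sum_filter, ← Finset.sum_add_distrib]
    refine Finset.sum_congr rfl fun e _ => ?_
    rw [lt']; split_ifs <;> ring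
  -- heavy mean
  have hmean : |∑ e ∈ Finset.univ.filter (fun e : Fin m × Fin n =>
      10 ^ 14 * W ≤ rsq y e.1 * rsq x e.2), bl U V x y e| ≤ 1 / 10 ^ 7 := by
    refine (Finset.abs_sum_le_sum_abs _ _).trans ?_
    have h1 : ∀ e ∈ Finset.univ.filter (fun e : Fin m × Fin n =>
        10 ^ 14 * W ≤ rsq y e.1 * rsq x e.2),
        |bl U V x y e| ≤ 1 / 10 ^ 7 * (rsq y e.1 * rsq x e.2) := by
      intro e he
      simp only [Finset.mem_filter, Finset.mem_univ, true_and] at he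
      have hz : 0 ≤ rsq y e.1 * rsq x e.2 := mul_nonneg (rsq_nonneg _ _) (rsq_nonneg _ _)
      refine abs_le_of_sq_le_sq ?_ (by positivity)
      refine (bl_sq hU hV hRu.le x y e).trans ?_
      rw [← hW]
      have := mul_le_mul_of_nonneg_right he hz
      linarith
    refine (Finset.sum_le_sum h1).trans ?_
    rw [← Finset.mul_sum]
    have h2 : ∑ e ∈ Finset.univ.filter (fun e : Fin m × Fin n =>
        10 ^ 14 * W ≤ rsq y e.1 * rsq x e.2), rsq y e.1 * rsq x e.2 ≤ 1 :=
      le_trans (Finset.sum_le_sum_of_subset_of_nonneg (Finset.subset_univ _)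
        fun e _ _ => mul_nonneg (rsq_nonneg _ _) (rsq_nonneg _ _)) (sum_rsq_mul hx hy)
    refine (mul_le_mul_of_nonneg_left h2 (by norm_num)).trans ?_
    norm_num
  -- heavy sample
  have hs : |∑ e ∈ Ω.filter (fun e : Fin m × Fin n =>
      10 ^ 14 * W ≤ rsq y e.1 * rsq x e.2), bl U V x y e| ≤ 1 / 100 * p := by
    refine (Finset.abs_sum_le_sum_abs _ _).trans ?_
    set H := Ω.filter (fun e : Fin m × Fin n => 10 ^ 14 * W ≤ rsq y e.1 * rsq x e.2) with hHd
    have hp := peel H (fun e => (∑ k, U e.1 k * x (e.2, k)) ^ 2)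
      (fun e => (∑ k, V e.2 k * y (e.1, k)) ^ 2) (fun e => |bl U V x y e|)
      (fun i => rsq y i * Rv) (fun j => rsq x j * Ru) 400
      (1 / 160000 * (p / Rv)) (1 / 160000 * (p / Ru)) (by norm_num)
      (fun i => mul_nonneg (rsq_nonneg _ _) hRv.le) (fun i => mul_nonneg (rsq_nonneg _ _) hRu.le)
      (fun e => sq_nonneg _) (fun e => sq_nonneg _) (fun e => bl_left hV y e.2 e.1)
      (fun e => bl_left hU x e.1 e.2) (fun e => by
        simp only [bl]
        set u := ∑ k, U e.1 k * x (e.2, k)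
        set v := ∑ k, V e.2 k * y (e.1, k)
        rw [abs_mul, ← sq_abs u, ← sq_abs v]
        nlinarith [sq_nonneg (400 * |v| - |u|)]) (fun e => by
        simp only [bl]
        set u := ∑ k, U e.1 k * x (e.2, k)
        set v := ∑ k, V e.2 k * y (e.1, k)
        rw [abs_mul, ← sq_abs u, ← sq_abs v]
        nlinarith [sq_nonneg (400 * |u| - |v|)]) hH _ Finset.univ Finset.univ rfl
    have he : edges H Finset.univ Finset.univ = H := by
      simp [edges]
    rw [he] at hp
    refine hp.trans ?_
    rw [← Finset.sum_mul, ← Finset.sum_mul, sum_rsq, sum_rsq, Finset.sum_add_distrib]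
    have a1 : ∑ e ∈ H, (∑ k, U e.1 k * x (e.2, k)) ^ 2 ≤ ∑ e ∈ Ω, (∑ k, U e.1 k * x (e.2, k)) ^ 2 :=
      Finset.sum_le_sum_of_subset_of_nonneg (Finset.filter_subset _ _) fun e _ _ => sq_nonneg _
    have a2 : ∑ e ∈ H, (∑ k, V e.2 k * y (e.1, k)) ^ 2 ≤ ∑ e ∈ Ω, (∑ k, V e.2 k * y (e.1, k)) ^ 2 :=
      Finset.sum_le_sum_of_subset_of_nonneg (Finset.filter_subset _ _) fun e _ _ => sq_nonneg _
    have a3 := (abs_le.1 (hG1 x)).2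
    have a4 := (abs_le.1 (hG2 y)).2
    have a5 : 1 / 160000 * (p / Rv) * ((∑ q, y q ^ 2) * Rv) = 1 / 160000 * (p * ∑ q, y q ^ 2) := by
      field_simp
    have a6 : 1 / 160000 * (p / Ru) * ((∑ q, x q ^ 2) * Ru) = 1 / 160000 * (p * ∑ q, x q ^ 2) := by
      field_simp
    rw [a5, a6]
    have a7 : p * ∑ q, x q ^ 2 ≤ p * 1 := mul_le_mul_of_nonneg_left hx h0
    have a8 : p * ∑ q, y q ^ 2 ≤ p * 1 := mul_le_mul_of_nonneg_left hy h0
    linarith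
  rw [split Ω, split Finset.univ]
  rw [abs_le] at *
  have m1 : p * ∑ e ∈ Finset.univ.filter (fun e : Fin m × Fin n =>
      10 ^ 14 * W ≤ rsq y e.1 * rsq x e.2), bl U V x y e ≤ p * (1 / 10 ^ 7) :=
    mul_le_mul_of_nonneg_left hmean.2 h0
  have m2 : p * -(1 / 10 ^ 7) ≤ p * ∑ e ∈ Finset.univ.filter (fun e : Fin m × Fin n =>
      10 ^ 14 * W ≤ rsq y e.1 * rsq x e.2), bl U V x y e :=
    mul_le_mul_of_nonneg_left hmean.1 h0
  constructor <;> linarith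

lemma R3_expand {m n r : ℕ} (p : ℝ) (Ω : Finset (Fin m × Fin n))
    (U : Matrix (Fin m) (Fin r) ℝ) (V : Matrix (Fin n) (Fin r) ℝ)
    (x : Fin n × Fin r → ℝ) (y : Fin m × Fin r → ℝ) :
    ∑ q, ∑ q', x q * (((if (q'.1, q.1) ∈ Ω then 1 else 0) - p) * (U q'.1 q.2 * V q.1 q'.2)) * y q' =
      ∑ e ∈ Ω, bl U V x y e - p * ∑ e, bl U V x y e := by
  have e1 : ∑ e ∈ Ω, bl U V x y e - p * ∑ e, bl U V x y e =
      ∑ e, ((if e ∈ Ω then 1 else 0) - p) * bl U V x y e := by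
    rw [Finset.mul_sum]
    simp_rw [sub_mul]
    rw [Finset.sum_sub_distrib]
    congr 1
    simp only [ite_mul, one_mul, zero_mul]
    rw [← Finset.sum_filter, Finset.filter_univ_mem]
  rw [e1]
  simp only [Fintype.sum_prod_type, bl, Finset.sum_mul_sum]
  simp only [Finset.mul_sum]
  have : ∀ (f : Fin n → Fin r → Fin m → Fin r → ℝ),
      ∑ j, ∑ k, ∑ i, ∑ l, f j k i l = ∑ i, ∑ j, ∑ k, ∑ l, f j k i l := by
    intro f
    rw [Finset.sum_comm (s := (Finset.univ : Finset (Fin m)))]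
    refine Finset.sum_congr rfl fun j _ => ?_
    rw [Finset.sum_comm]
  rw [this]
  refine Finset.sum_congr rfl fun i _ => Finset.sum_congr rfl fun j _ =>
    Finset.sum_congr rfl fun k _ => Finset.sum_congr rfl fun l _ => by ring

lemma R3_full {m n r : ℕ} {p : ℝ} (Ω : Finset (Fin m × Fin n))
    (U : Matrix (Fin m) (Fin r) ℝ) (V : Matrix (Fin n) (Fin r) ℝ)
    {N1 : Finset (Fin n × Fin r → ℝ)} {N2 : Finset (Fin m × Fin r → ℝ)}
    (hN1 : IsNet N1) (hN2 : IsNet N2)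
    (h : ∀ x ∈ N1, ∀ y ∈ N2, |∑ e ∈ Ω, bl U V x y e - p * ∑ e, bl U V x y e| ≤ p / 40)
    (x : Fin n × Fin r → ℝ) (y : Fin m × Fin r → ℝ) :
    |∑ e ∈ Ω, bl U V x y e - p * ∑ e, bl U V x y e| ≤
      p / 10 * (Real.sqrt (∑ q, x q ^ 2) * Real.sqrt (∑ q, y q ^ 2)) := by
  have := net_bilin hN1 hN2
    (fun q q' => (((if (q'.1, q.1) ∈ Ω then 1 else 0) - p) * (U q'.1 q.2 * V q.1 q'.2))) (p / 40)
    (fun x hx y hy => by rw [R3_expand]; exact h x hx y hy) x y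
  rw [R3_expand] at this
  refine this.trans (le_of_eq (by ring))

/-- The good sampling event. -/
def GoodSample {m n r : ℕ} (p T : ℝ) (U : Matrix (Fin m) (Fin r) ℝ) (V : Matrix (Fin n) (Fin r) ℝ)
    (Ω : Finset (Fin m × Fin n)) : Prop :=
  (∀ x : Fin n × Fin r → ℝ,
      |∑ e ∈ Ω, (∑ k, U e.1 k * x (e.2, k)) ^ 2 - p * ∑ q, x q ^ 2| ≤ p / 4 * ∑ q, x q ^ 2) ∧
  (∀ x : Fin m × Fin r → ℝ,
      |∑ e ∈ Ω, (∑ k, V e.2 k * x (e.1, k)) ^ 2 - p * ∑ q, x q ^ 2| ≤ p / 4 * ∑ q, x q ^ 2) ∧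
  (∀ (x : Fin n × Fin r → ℝ) (y : Fin m × Fin r → ℝ),
    |∑ e ∈ Ω, bl U V x y e - p * ∑ e, bl U V x y e| ≤
      p / 10 * (Real.sqrt (∑ q, x q ^ 2) * Real.sqrt (∑ q, y q ^ 2))) ∧
  (∀ A B, ((edges Ω A B).card : ℝ) ≤
    8 * p * ((A.card : ℝ) * B.card) + T * A.card + T * ((m : ℝ) / n) * B.card)

lemma BPr_or3 {ι : Type*} [Fintype ι] {p : ℝ} (h0 : 0 ≤ p) (h1 : p ≤ 1)
    (G P1 P2 P3 P4 P5 : Finset ι → Prop) (b1 b2 b3 b4 b5 : ℝ)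
    (hG : ∀ Ω, ¬ P1 Ω → ¬ P2 Ω → ¬ P3 Ω → ¬ P4 Ω → ¬ P5 Ω → G Ω)
    (k1 : BPr p P1 ≤ b1) (k2 : BPr p P2 ≤ b2) (k3 : BPr p P3 ≤ b3) (k4 : BPr p P4 ≤ b4)
    (k5 : BPr p P5 ≤ b5) : BPr p (fun Ω => ¬ G Ω) ≤ b1 + b2 + b3 + b4 + b5 := by
  have q1 := BPr_or h0 h1 P1 P2
  have q2 := BPr_or h0 h1 (fun Ω => P1 Ω ∨ P2 Ω) P3
  have q3 := BPr_or h0 h1 (fun Ω => (P1 Ω ∨ P2 Ω) ∨ P3 Ω) P4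
  have q4 := BPr_or h0 h1 (fun Ω => ((P1 Ω ∨ P2 Ω) ∨ P3 Ω) ∨ P4 Ω) P5
  have q5 : BPr p (fun Ω => ¬ G Ω) ≤
      BPr p (fun Ω => (((P1 Ω ∨ P2 Ω) ∨ P3 Ω) ∨ P4 Ω) ∨ P5 Ω) :=
    BPr_mono h0 h1 fun Ω hΩ => by
      by_contra hc
      push Not at hc
      exact hΩ (hG Ω hc.1.1.1.1 hc.1.1.1.2 hc.1.1.2 hc.1.2 hc.2)
  linarith

lemma pow25 (k : ℕ) : (25 : ℝ) ^ k ≤ Real.exp (4 * k) := by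
  have h : (25 : ℝ) ≤ Real.exp 4 := by
    have h1 : Real.exp 4 = Real.exp 1 ^ 4 := by rw [← Real.exp_nat_mul]; norm_num
    have h2 := Real.exp_one_gt_d9
    rw [h1]
    calc (25 : ℝ) ≤ 2.7 ^ 4 := by norm_num
      _ ≤ _ := by gcongr; linarith
  calc (25 : ℝ) ^ k ≤ Real.exp 4 ^ k := by gcongr
    _ = _ := by rw [← Real.exp_nat_mul]; ring_nf

lemma exp_bd {n k : ℕ} {x : ℝ} (hn : 1 ≤ n) (hx : 20 * Real.log n + 4 * k ≤ x) :
    25 ^ k * (2 * Real.exp (-x)) ≤ 2 * ((n : ℝ) ^ 20)⁻¹ := by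
  have hn' : (0 : ℝ) < n := by exact_mod_cast hn
  have h1 : Real.exp (-x) ≤ Real.exp (-(4 * k)) * ((n : ℝ) ^ 20)⁻¹ := by
    have : ((n : ℝ) ^ 20)⁻¹ = Real.exp (-(20 * Real.log n)) := by
      rw [Real.exp_neg, show (20 : ℝ) = ((20 : ℕ) : ℝ) by norm_num, ← Real.log_pow,
        Real.exp_log (by positivity)]
    rw [this, ← Real.exp_add, Real.exp_le_exp]; linarith
  have h2 := pow25 k
  have h3 : (0 : ℝ) ≤ ((n : ℝ) ^ 20)⁻¹ := by positivity
  have h4 : Real.exp (4 * k) * Real.exp (-(4 * k)) = 1 := by rw [← Real.exp_add]; simp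
  calc 25 ^ k * (2 * Real.exp (-x)) ≤
      Real.exp (4 * k) * (2 * (Real.exp (-(4 * k)) * ((n : ℝ) ^ 20)⁻¹)) := by gcongr
    _ = 2 * ((n : ℝ) ^ 20)⁻¹ * (Real.exp (4 * k) * Real.exp (-(4 * k))) := by ring
    _ = _ := by rw [h4, mul_one]

lemma final_sum {n m : ℝ} (hn : 10 ^ 20 ≤ n) (hm : m ≤ n ^ 3) :
    n * (2 * (n ^ 20)⁻¹) + m * (2 * (n ^ 20)⁻¹) + 2 * (n ^ 20)⁻¹ + 9 * (n ^ 20)⁻¹ +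
      (m + 1) * (n + 1) * (n ^ 29)⁻¹ ≤ 1 / (2 * n ^ 8) := by
  have hn1 : 1 ≤ n := by linarith
  have h0 : 0 < n := by linarith
  have a1 : n ≤ n ^ 3 := by
    calc n = n ^ 1 := by ring
      _ ≤ n ^ 3 := pow_le_pow_right₀ hn1 (by norm_num)
  have a0 : (n ^ 29)⁻¹ = (n ^ 20)⁻¹ * (n ^ 9)⁻¹ := by rw [← mul_inv]; ring_nf
  have h20 : 0 < (n ^ 20)⁻¹ := by positivity
  have a2 : (m + 1) * (n + 1) * (n ^ 9)⁻¹ ≤ 4 := by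
    rw [← div_eq_mul_inv, div_le_iff₀ (by positivity)]
    have b1 : m + 1 ≤ 2 * n ^ 3 := by linarith
    have b2 : n + 1 ≤ 2 * n ^ 3 := by linarith
    have b3 : (m + 1) * (n + 1) ≤ (2 * n ^ 3) * (2 * n ^ 3) :=
      mul_le_mul b1 b2 (by linarith) (by positivity)
    have b4 : n ^ 6 ≤ n ^ 9 := pow_le_pow_right₀ hn1 (by norm_num)
    linarith
  have a3 : n * (2 * (n ^ 20)⁻¹) + m * (2 * (n ^ 20)⁻¹) + 2 * (n ^ 20)⁻¹ + 9 * (n ^ 20)⁻¹ +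
      (m + 1) * (n + 1) * (n ^ 29)⁻¹ = (2 * n + 2 * m + 11 + (m + 1) * (n + 1) * (n ^ 9)⁻¹) * (n ^ 20)⁻¹ := by
    rw [a0]; ring
  rw [a3]
  have a4 : 2 * n + 2 * m + 11 + (m + 1) * (n + 1) * (n ^ 9)⁻¹ ≤ 19 * n ^ 3 := by linarith
  refine (mul_le_mul_of_nonneg_right a4 h20.le).trans ?_
  rw [← div_eq_mul_inv, div_le_div_iff₀ (by positivity) (by positivity)]
  have a5 : n ^ 20 = n ^ 11 * n ^ 9 := by ring
  have a6 : n ^ 3 * n ^ 8 = n ^ 11 := by ring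
  have a7 : 38 ≤ n ^ 9 := by
    calc (38 : ℝ) ≤ n := by linarith
      _ = n ^ 1 := by ring
      _ ≤ n ^ 9 := pow_le_pow_right₀ hn1 (by norm_num)
  have a8 : 0 < n ^ 11 := by positivity
  calc 19 * n ^ 3 * (2 * n ^ 8) = n ^ 11 * 38 := by ring
    _ ≤ n ^ 11 * n ^ 9 := by gcongr
    _ = 1 * n ^ 20 := by ring

lemma good_prob {m n r : ℕ} {p μ κ : ℝ} (hp0 : 0 < p) (h1 : p ≤ 1) (hn : (10 : ℝ) ^ 20 ≤ n)
    (hnm : n ≤ m) (hm : (m : ℝ) ≤ (n : ℝ) ^ 3) (hr : 1 ≤ r) (hμ : 1 ≤ μ) (hκ : 1 ≤ κ)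
    (hP1 : 10 ^ 20 * r * μ * Real.log n ≤ p * n) (hP2 : 10 ^ 20 * (r : ℝ) ^ 7 * μ ^ 2 * κ ^ 6 ≤ p * n)
    (U : Matrix (Fin m) (Fin r) ℝ) (V : Matrix (Fin n) (Fin r) ℝ)
    (hU1 : Uᵀ * U = 1) (hV1 : Vᵀ * V = 1)
    (hU : ∀ i, ∑ k, U i k ^ 2 ≤ μ * r / m) (hV : ∀ i, ∑ k, V i k ^ 2 ≤ μ * r / n) :
    BPr p (fun Ω => ¬ GoodSample p (1 / 10 ^ 6 / (μ * r ^ 3 * κ ^ 2) * (p * n)) U V Ω) ≤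
      1 / (2 * (n : ℝ) ^ 8) := by
  have h0 := hp0.le
  have hn1 : 1 ≤ n := by
    have : (1 : ℝ) ≤ n := le_trans (by norm_num) hn
    exact_mod_cast this
  have hn' : (1 : ℝ) ≤ n := by exact_mod_cast hn1
  have hnm' : (n : ℝ) ≤ m := by exact_mod_cast hnm
  have hr' : (1 : ℝ) ≤ r := by exact_mod_cast hr
  have hn0 : (0 : ℝ) < n := by linarith
  have hm0 : (0 : ℝ) < m := by linarith
  have hμ0 : 0 < μ := by linarith
  have hr0 : (0 : ℝ) < r := by linarith
  have hlog : 0 ≤ Real.log n := Real.log_nonneg hn'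
  have hlogn : Real.log n ≤ n := (Real.log_le_sub_one_of_pos hn0).trans (by linarith)
  set Ru := μ * r / m with hRu
  set Rv := μ * r / n with hRv
  have hRu0 : 0 < Ru := by positivity
  have hRv0 : 0 < Rv := by positivity
  have hRuv : Ru ≤ Rv := by rw [hRu, hRv]; gcongr
  have hκ6 : 1 ≤ κ ^ 6 := one_le_pow₀ hκ
  have hr6 : (r : ℝ) ≤ (r : ℝ) ^ 6 := by
    calc (r : ℝ) = r ^ 1 := by ring
      _ ≤ r ^ 6 := pow_le_pow_right₀ hr' (by norm_num)
  have hr5 : (r : ℝ) ≤ (r : ℝ) ^ 5 := by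
    calc (r : ℝ) = r ^ 1 := by ring
      _ ≤ r ^ 5 := pow_le_pow_right₀ hr' (by norm_num)
  have hP3 : 10 ^ 20 * (r : ℝ) ^ 7 * μ ^ 2 ≤ p * n := by
    refine le_trans ?_ hP2
    have : 0 ≤ 10 ^ 20 * (r : ℝ) ^ 7 * μ ^ 2 := by positivity
    nlinarith
  have D1 : 10 ^ 20 * Real.log n ≤ p / Rv := by
    rw [hRv, div_div_eq_mul_div, le_div_iff₀ (by positivity)]; linarith
  have D2 : 10 ^ 20 * (r : ℝ) ≤ p / Rv := by
    rw [hRv, div_div_eq_mul_div, le_div_iff₀ (by positivity)]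
    refine le_trans ?_ hP3
    have : μ ≤ μ ^ 2 := by nlinarith
    calc 10 ^ 20 * (r : ℝ) * (μ * r) ≤ 10 ^ 20 * (r : ℝ) ^ 6 * (μ ^ 2 * r) := by gcongr
      _ = 10 ^ 20 * (r : ℝ) ^ 7 * μ ^ 2 := by ring
  have D3 : p / Rv ≤ p / Ru := by gcongr
  have x1 : 20 * Real.log n + 4 * (r : ℕ) ≤ p / (1024 * Ru) := by
    have : p / (1024 * Ru) = p / Ru / 1024 := by field_simp
    rw [this]; linarith
  have x2 : 20 * Real.log n + 4 * (r : ℕ) ≤ p / (1024 * Rv) := by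
    have : p / (1024 * Rv) = p / Rv / 1024 := by field_simp
    rw [this]; linarith
  have x3 : 20 * Real.log n + 4 * ((m * r : ℕ) : ℝ) ≤ p / (2 * 10 ^ 9 * (Ru * Rv)) := by
    have e1 : p / (2 * 10 ^ 9 * (Ru * Rv)) = m * (p * n / (μ ^ 2 * r ^ 2)) / (2 * 10 ^ 9) := by
      rw [hRu, hRv]; field_simp
    have e2 : 10 ^ 20 * (r : ℝ) ≤ p * n / (μ ^ 2 * r ^ 2) := by
      rw [le_div_iff₀ (by positivity)]
      refine le_trans ?_ hP3
      calc 10 ^ 20 * (r : ℝ) * (μ ^ 2 * r ^ 2) ≤ 10 ^ 20 * (r : ℝ) ^ 5 * (μ ^ 2 * r ^ 2) := by gcongr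
        _ = 10 ^ 20 * (r : ℝ) ^ 7 * μ ^ 2 := by ring
    have e3 : (m : ℝ) * (10 ^ 20 * (r : ℝ)) ≤ m * (p * n / (μ ^ 2 * r ^ 2)) := by gcongr
    rw [e1]
    push_cast
    have e4 : (m : ℝ) ≤ m * r := by nlinarith
    linarith
  have x4 : Real.exp (-(5 / 10 ^ 6 * (p / Rv))) ≤ ((n : ℝ) ^ 20)⁻¹ := by
    have := exp_bd (k := 0) (x := 5 / 10 ^ 6 * (p / Rv)) hn1 (by push_cast; linarith)
    rw [pow_zero, one_mul] at this
    linarith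
  obtain ⟨N1, hN1c, hN1⟩ := exists_net (Fin n × Fin r)
  obtain ⟨N2, hN2c, hN2⟩ := exists_net (Fin m × Fin r)
  have g1 := (gram_cols (n := n) h0 h1 hRu0 U hU1 hU).trans
    (mul_le_mul_of_nonneg_left (exp_bd hn1 x1) hn0.le)
  have g2 := (gram_rows (m := m) h0 h1 hRv0 V hV1 hV).trans
    (mul_le_mul_of_nonneg_left (exp_bd hn1 x2) hm0.le)
  have g3 := light_prob h0 h1 hRu0 hRv0 U V hU hV N1 N2 hN1.1 hN2.1
  have hcard : ((N1 ×ˢ N2).card : ℝ) ≤ 25 ^ (m * r) := by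
    rw [Finset.card_product]
    have z1 : N1.card ≤ 5 ^ (m * r) := by
      refine hN1c.trans (Nat.pow_le_pow_right (by norm_num) ?_)
      simpa using Nat.mul_le_mul_right r hnm
    have z2 : N2.card ≤ 5 ^ (m * r) := by simpa using hN2c
    have : N1.card * N2.card ≤ 25 ^ (m * r) := by
      calc _ ≤ 5 ^ (m * r) * 5 ^ (m * r) := Nat.mul_le_mul z1 z2
        _ = 25 ^ (m * r) := by rw [← mul_pow]; norm_num
    exact_mod_cast this
  have g3' := g3.trans ((mul_le_mul_of_nonneg_right hcard (by positivity)).trans (exp_bd hn1 x3))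
  have hdd : 0 ≤ 5 / 10 ^ 6 * (p / Rv) := by positivity
  have hn20 : (0 : ℝ) < (n : ℝ) ^ 20 := by positivity
  have g4 := (stair_prob (m := m) (n := n) h0 h1 hdd (by
    calc (m : ℝ) * (n + 1) * Real.exp (-(5 / 10 ^ 6 * (p / Rv))) ≤
        (n : ℝ) ^ 3 * (n + n) * ((n : ℝ) ^ 20)⁻¹ := by gcongr
      _ ≤ 1 := by
        rw [← div_eq_mul_inv, div_le_one hn20]
        have : (n : ℝ) ^ 5 ≤ n ^ 20 := pow_le_pow_right₀ hn' (by norm_num)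
        have h2 : (2 : ℝ) * n ^ 4 ≤ n * n ^ 4 := by
          have : (2 : ℝ) ≤ n := by linarith
          gcongr
        linarith [this, h2, show (n : ℝ) ^ 3 * (n + n) = 2 * n ^ 4 by ring,
          show (n : ℝ) * n ^ 4 = n ^ 5 by ring]) hnm).trans
    (mul_le_mul_of_nonneg_left x4 (by norm_num))
  have hκ0 : 0 < κ := by linarith
  set lam := μ * (r : ℝ) ^ 3 * κ ^ 2 with hlam
  have hlam1 : 1 ≤ lam := by
    rw [hlam]
    have z1 : 1 ≤ (r : ℝ) ^ 3 := one_le_pow₀ hr'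
    have z2 : 1 ≤ κ ^ 2 := one_le_pow₀ hκ
    exact one_le_mul_of_one_le_of_one_le (one_le_mul_of_one_le_of_one_le hμ z1) z2
  have hT2 : 30 * (3 + 1 / (1 / 10 ^ 6 / lam)) ≤ 1 / 10 ^ 6 / lam * (p * n) := by
    have z1 : 1 / (1 / 10 ^ 6 / lam) = 10 ^ 6 * lam := by field_simp
    have z2 : 10 ^ 20 * (lam * lam) ≤ p * n := by
      refine le_trans ?_ hP2
      have y1 : lam * lam = (r : ℝ) ^ 6 * μ ^ 2 * κ ^ 4 := by rw [hlam]; ring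
      rw [y1]
      have y2 : (r : ℝ) ^ 6 ≤ r ^ 7 := pow_le_pow_right₀ hr' (by norm_num)
      have y3 : κ ^ 4 ≤ κ ^ 6 := pow_le_pow_right₀ hκ (by norm_num)
      calc 10 ^ 20 * ((r : ℝ) ^ 6 * μ ^ 2 * κ ^ 4) ≤ 10 ^ 20 * ((r : ℝ) ^ 7 * μ ^ 2 * κ ^ 6) := by gcongr
        _ = _ := by ring
    have z3 : 1 / 10 ^ 6 / lam * (p * n) = p * n / lam / 10 ^ 6 := by field_simp
    have z4 : 10 ^ 20 * lam ≤ p * n / lam := by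
      rw [le_div_iff₀ (by linarith)]; linarith
    rw [z1, z3]; linarith
  have g5 := rect_prob (m := m) (n := n) hp0 h1 hnm hn1 (ε := 1 / 10 ^ 6 / lam) (by positivity)
    (by rw [div_le_one (by linarith)]; norm_num; linarith) rfl hT2
  refine (BPr_or3 h0 h1 _ _ _ _ _ _ _ _ _ _ _ ?_ g1 g2 g3' g4 g5).trans (final_sum hn hm)
  intro Ω f1 f2 f3 f4 f5
  push Not at f1 f2 f3 f4 f5
  have c1 := sum_cols (Ω := Ω) (U := U) (p := p) fun j a => f1 j (Finset.mem_univ j) a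
  have c2 := sum_rows (Ω := Ω) (V := V) (p := p) fun j a => f2 j (Finset.mem_univ j) a
  refine ⟨c1, c2, ?_, ?_⟩
  · refine R3_full Ω U V hN1 hN2 fun x hx y hy => ?_
    exact R3_net h0 hRu0 hRv0 hRuv Ω U V hU hV c1 c2 x y
      (heavy_count h0 hRu0 hRv0 hRuv Ω (fun h R => f4 (h, R) (Finset.mem_univ _)) x y
        (hN1.1 x hx) (hN2.1 y hy)) (hN1.1 x hx) (hN2.1 y hy)
      (f3 (x, y) (Finset.mem_product.2 ⟨hx, hy⟩)).le
  · intro A B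
    exact f5 (A, B) (Finset.mem_univ _)


section toolbox

lemma le_of_sq_le_sq_aux {a b : ℝ} (h : a ^ 2 ≤ b ^ 2) (hb : 0 ≤ b) : a ≤ b :=
  abs_le_of_sq_le_sq h hb |> le_trans (le_abs_self a)

def nsq {m n : ℕ} (A : Matrix (Fin m) (Fin n) ℝ) : ℝ := ∑ i, ∑ j, A i j ^ 2

lemma nsq_nonneg {m n : ℕ} (A : Matrix (Fin m) (Fin n) ℝ) : 0 ≤ nsq A :=
  Finset.sum_nonneg fun _ _ => Finset.sum_nonneg fun _ _ => sq_nonneg _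

lemma frob_sq {m n : ℕ} (A : Matrix (Fin m) (Fin n) ℝ) : frob A ^ 2 = nsq A :=
  Real.sq_sqrt (nsq_nonneg A)

lemma frob_nonneg {m n : ℕ} (A : Matrix (Fin m) (Fin n) ℝ) : 0 ≤ frob A := Real.sqrt_nonneg _

lemma frob_eq_sqrt {m n : ℕ} (A : Matrix (Fin m) (Fin n) ℝ) : frob A = Real.sqrt (nsq A) := rfl

lemma rowNorm_sq {m n : ℕ} (A : Matrix (Fin m) (Fin n) ℝ) (i : Fin m) :
    rowNorm A i ^ 2 = ∑ j, A i j ^ 2 :=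
  Real.sq_sqrt (Finset.sum_nonneg fun _ _ => sq_nonneg _)

lemma rowNorm_nonneg {m n : ℕ} (A : Matrix (Fin m) (Fin n) ℝ) (i : Fin m) : 0 ≤ rowNorm A i :=
  Real.sqrt_nonneg _

lemma nsq_eq_zero {m n : ℕ} {A : Matrix (Fin m) (Fin n) ℝ} (h : nsq A = 0) : A = 0 := by
  ext i j
  have h1 := (Finset.sum_eq_zero_iff_of_nonneg
    (fun i _ => Finset.sum_nonneg fun j _ => sq_nonneg (A i j))).1 h i (Finset.mem_univ _)
  have h2 := (Finset.sum_eq_zero_iff_of_nonneg (fun j _ => sq_nonneg (A i j))).1 h1 j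
    (Finset.mem_univ _)
  simpa using h2

lemma nsq_transpose {m n : ℕ} (A : Matrix (Fin m) (Fin n) ℝ) : nsq Aᵀ = nsq A := by
  unfold nsq; rw [Finset.sum_comm]; rfl

lemma frob_transpose {m n : ℕ} (A : Matrix (Fin m) (Fin n) ℝ) : frob Aᵀ = frob A := by
  rw [frob_eq_sqrt, frob_eq_sqrt, nsq_transpose]

lemma finner_trace {m n : ℕ} (A B : Matrix (Fin m) (Fin n) ℝ) :
    finner A B = Matrix.trace (Aᵀ * B) := by
  unfold finner; rw [Finset.sum_comm]
  simp [Matrix.trace, Matrix.mul_apply]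

lemma finner_self {m n : ℕ} (A : Matrix (Fin m) (Fin n) ℝ) : finner A A = nsq A := by
  unfold finner nsq; simp [sq]

lemma finner_comm {m n : ℕ} (A B : Matrix (Fin m) (Fin n) ℝ) : finner A B = finner B A := by
  unfold finner; simp [mul_comm]

lemma finner_add_left {m n : ℕ} (A B C : Matrix (Fin m) (Fin n) ℝ) :
    finner (A + B) C = finner A C + finner B C := by
  unfold finner; simp [add_mul, Finset.sum_add_distrib]

lemma finner_add_right {m n : ℕ} (A B C : Matrix (Fin m) (Fin n) ℝ) :
    finner A (B + C) = finner A B + finner A C := by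
  unfold finner; simp [mul_add, Finset.sum_add_distrib]

lemma finner_sub_right {m n : ℕ} (A B C : Matrix (Fin m) (Fin n) ℝ) :
    finner A (B - C) = finner A B - finner A C := by
  unfold finner; simp [mul_sub, Finset.sum_sub_distrib]

lemma finner_smul_left {m n : ℕ} (c : ℝ) (A B : Matrix (Fin m) (Fin n) ℝ) :
    finner (c • A) B = c * finner A B := by
  unfold finner; simp [Finset.mul_sum, mul_assoc]

lemma finner_zero_left {m n : ℕ} (B : Matrix (Fin m) (Fin n) ℝ) :
    finner 0 B = 0 := by
  unfold finner; simp

/-- move a right factor across -/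
lemma finner_mul_left {m n r : ℕ} (A : Matrix (Fin m) (Fin n) ℝ) (B : Matrix (Fin n) (Fin r) ℝ)
    (C : Matrix (Fin m) (Fin r) ℝ) : finner (A * B) C = finner A (C * Bᵀ) := by
  rw [finner_trace, finner_trace, Matrix.transpose_mul, Matrix.mul_assoc, Matrix.trace_mul_comm,
    Matrix.mul_assoc]

/-- move a left factor across -/
lemma finner_mul_left' {m n r : ℕ} (A : Matrix (Fin m) (Fin n) ℝ) (B : Matrix (Fin n) (Fin r) ℝ)
    (C : Matrix (Fin m) (Fin r) ℝ) : finner (A * B) C = finner B (Aᵀ * C) := by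
  rw [finner_trace, finner_trace, Matrix.transpose_mul, Matrix.mul_assoc]

lemma finner_transpose {m n : ℕ} (A B : Matrix (Fin m) (Fin n) ℝ) :
    finner Aᵀ Bᵀ = finner A B := by
  unfold finner; rw [Finset.sum_comm]; rfl

lemma finner_sq_le {m n : ℕ} (A B : Matrix (Fin m) (Fin n) ℝ) :
    finner A B ^ 2 ≤ nsq A * nsq B := by
  have h := Finset.sum_mul_sq_le_sq_mul_sq (Finset.univ : Finset (Fin m × Fin n))
    (fun e => A e.1 e.2) (fun e => B e.1 e.2)
  simpa [Fintype.sum_prod_type, finner, nsq] using h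

lemma abs_finner_le {m n : ℕ} (A B : Matrix (Fin m) (Fin n) ℝ) :
    |finner A B| ≤ frob A * frob B := by
  apply abs_le_of_sq_le_sq
  · rw [mul_pow, frob_sq, frob_sq]; exact finner_sq_le A B
  · exact mul_nonneg (frob_nonneg _) (frob_nonneg _)

lemma nsq_add {m n : ℕ} (A B : Matrix (Fin m) (Fin n) ℝ) :
    nsq (A + B) = nsq A + 2 * finner A B + nsq B := by
  rw [← finner_self, finner_add_left, finner_add_right, finner_add_right, finner_self, finner_self,
    finner_comm B A]; ring

lemma frob_add_le {m n : ℕ} (A B : Matrix (Fin m) (Fin n) ℝ) :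
    frob (A + B) ≤ frob A + frob B := by
  apply le_of_sq_le_sq_aux _ (add_nonneg (frob_nonneg _) (frob_nonneg _))
  rw [frob_sq, nsq_add, ← frob_sq, ← frob_sq]
  have := (abs_le.1 (abs_finner_le A B)).2
  nlinarith

lemma frob_neg {m n : ℕ} (A : Matrix (Fin m) (Fin n) ℝ) : frob (-A) = frob A := by
  simp [frob]

lemma frob_sub_le {m n : ℕ} (A B : Matrix (Fin m) (Fin n) ℝ) :
    frob (A - B) ≤ frob A + frob B := by
  rw [sub_eq_add_neg, ← frob_neg B]; exact frob_add_le _ _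

lemma frob_sub_comm {m n : ℕ} (A B : Matrix (Fin m) (Fin n) ℝ) :
    frob (A - B) = frob (B - A) := by
  rw [← frob_neg, neg_sub]

lemma rowsq_mul_le {m n r : ℕ} (A : Matrix (Fin m) (Fin n) ℝ) (B : Matrix (Fin n) (Fin r) ℝ)
    (i : Fin m) : ∑ j, (A * B) i j ^ 2 ≤ (∑ k, A i k ^ 2) * nsq B := by
  have h : ∀ j, (A * B) i j ^ 2 ≤ (∑ k, A i k ^ 2) * ∑ k, B k j ^ 2 := fun j => by
    rw [Matrix.mul_apply]; exact Finset.sum_mul_sq_le_sq_mul_sq _ _ _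
  refine (Finset.sum_le_sum fun j _ => h j).trans (le_of_eq ?_)
  rw [← Finset.mul_sum, nsq, Finset.sum_comm]

lemma nsq_mul_le {m n r : ℕ} (A : Matrix (Fin m) (Fin n) ℝ) (B : Matrix (Fin n) (Fin r) ℝ) :
    nsq (A * B) ≤ nsq A * nsq B := by
  refine (Finset.sum_le_sum fun i _ => rowsq_mul_le A B i).trans (le_of_eq ?_)
  rw [← Finset.sum_mul]; rfl

lemma frob_mul_le {m n r : ℕ} (A : Matrix (Fin m) (Fin n) ℝ) (B : Matrix (Fin n) (Fin r) ℝ) :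
    frob (A * B) ≤ frob A * frob B := by
  apply le_of_sq_le_sq_aux _ (mul_nonneg (frob_nonneg _) (frob_nonneg _))
  rw [mul_pow, frob_sq, frob_sq, frob_sq]; exact nsq_mul_le A B

lemma nsq_orth_mul {m n r : ℕ} {U : Matrix (Fin m) (Fin r) ℝ} (hU : Uᵀ * U = 1)
    (B : Matrix (Fin r) (Fin n) ℝ) : nsq (U * B) = nsq B := by
  rw [← finner_self, finner_mul_left', ← Matrix.mul_assoc, hU, Matrix.one_mul, finner_self]

lemma frob_orth_mul {m n r : ℕ} {U : Matrix (Fin m) (Fin r) ℝ} (hU : Uᵀ * U = 1)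
    (B : Matrix (Fin r) (Fin n) ℝ) : frob (U * B) = frob B := by
  rw [frob_eq_sqrt, frob_eq_sqrt, nsq_orth_mul hU]

lemma nsq_pyth {m n r : ℕ} {U : Matrix (Fin m) (Fin r) ℝ} (hU : Uᵀ * U = 1)
    (X : Matrix (Fin m) (Fin n) ℝ) :
    nsq X = nsq (Uᵀ * X) + nsq (X - U * (Uᵀ * X)) := by
  have h : X = U * (Uᵀ * X) + (X - U * (Uᵀ * X)) := by abel
  have h0 : finner (U * (Uᵀ * X)) (X - U * (Uᵀ * X)) = 0 := by
    rw [finner_mul_left', Matrix.mul_sub, ← Matrix.mul_assoc Uᵀ U, hU, Matrix.one_mul, sub_self,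
      finner_comm, finner_zero_left]
  conv_lhs => rw [h, nsq_add, h0, nsq_orth_mul hU]
  ring

lemma nsq_orthT_le {m n r : ℕ} {U : Matrix (Fin m) (Fin r) ℝ} (hU : Uᵀ * U = 1)
    (X : Matrix (Fin m) (Fin n) ℝ) : nsq (Uᵀ * X) ≤ nsq X := by
  have := nsq_pyth hU X
  have := nsq_nonneg (X - U * (Uᵀ * X)); linarith

lemma nsq_perp_le {m n r : ℕ} {U : Matrix (Fin m) (Fin r) ℝ} (hU : Uᵀ * U = 1)
    (X : Matrix (Fin m) (Fin n) ℝ) : nsq (X - U * (Uᵀ * X)) ≤ nsq X := by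
  have := nsq_pyth hU X
  have := nsq_nonneg (Uᵀ * X); linarith

lemma frob_le_of_nsq {m n m' n' : ℕ} {A : Matrix (Fin m) (Fin n) ℝ}
    {B : Matrix (Fin m') (Fin n') ℝ} (h : nsq A ≤ nsq B) : frob A ≤ frob B :=
  Real.sqrt_le_sqrt h

/-- solving against a diagonally dominated matrix -/
lemma solve_bound {m r : ℕ} (σ : Fin r → ℝ) (s : ℝ) (hs : 0 < s) (hσ : ∀ k, s ≤ σ k)
    (Eh : Matrix (Fin r) (Fin r) ℝ) (hE : frob Eh ≤ s / 2) (c : Matrix (Fin m) (Fin r) ℝ) :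
    s / 2 * frob c ≤ frob (c * (Matrix.diagonal σ + Eh)) := by
  have h1 : s * frob c ≤ frob (c * Matrix.diagonal σ) := by
    apply le_of_sq_le_sq_aux _ (frob_nonneg _)
    rw [mul_pow, frob_sq, frob_sq, nsq, nsq, Finset.mul_sum]
    refine Finset.sum_le_sum fun i _ => ?_
    rw [Finset.mul_sum]
    refine Finset.sum_le_sum fun j _ => ?_
    rw [Matrix.mul_diagonal, mul_pow, mul_comm]
    have := hσ j
    gcongr
  have h2 : c * Matrix.diagonal σ = c * (Matrix.diagonal σ + Eh) - c * Eh := by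
    rw [Matrix.mul_add]; abel
  have h3 := frob_sub_le (c * (Matrix.diagonal σ + Eh)) (c * Eh)
  rw [← h2] at h3
  have h4 := frob_mul_le c Eh
  have h5 : frob c * frob Eh ≤ frob c * (s / 2) := mul_le_mul_of_nonneg_left hE (frob_nonneg _)
  linarith

lemma solve_bound' {m r : ℕ} (σ : Fin r → ℝ) (s : ℝ) (hs : 0 < s) (hσ : ∀ k, s ≤ σ k)
    (Eh : Matrix (Fin r) (Fin r) ℝ) (hE : frob Eh ≤ s / 2) (c : Matrix (Fin r) (Fin m) ℝ) :
    s / 2 * frob c ≤ frob ((Matrix.diagonal σ + Eh) * c) := by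
  have := solve_bound σ s hs hσ Ehᵀ (by rwa [frob_transpose]) cᵀ
  rw [frob_transpose, ← frob_transpose (cᵀ * _)] at this
  simpa using this

lemma solve_unit {r : ℕ} (σ : Fin r → ℝ) (s : ℝ) (hs : 0 < s) (hσ : ∀ k, s ≤ σ k)
    (Eh : Matrix (Fin r) (Fin r) ℝ) (hE : frob Eh ≤ s / 2) :
    IsUnit (Matrix.diagonal σ + Eh).det := by
  rw [isUnit_iff_ne_zero]
  intro h0
  obtain ⟨v, hv, hv0⟩ := Matrix.exists_vecMul_eq_zero_iff.2 h0
  have h := solve_bound σ s hs hσ Eh hE (Matrix.of fun (_ : Fin 1) j => v j)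
  have hz : (Matrix.of fun (_ : Fin 1) j => v j) * (Matrix.diagonal σ + Eh) = 0 := by
    ext i j
    have := congrFun hv0 j
    simpa [Matrix.vecMul, Matrix.mul_apply, dotProduct] using this
  rw [hz] at h
  have hf0 : frob (0 : Matrix (Fin 1) (Fin r) ℝ) = 0 := by simp [frob]
  rw [hf0] at h
  have hc : frob (Matrix.of fun (_ : Fin 1) j => v j) = 0 := by
    have := frob_nonneg (Matrix.of fun (_ : Fin 1) j => v j)
    nlinarith
  have hc' : nsq (Matrix.of fun (_ : Fin 1) j => v j) = 0 := by
    rw [← frob_sq, hc]; norm_num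
  apply hv
  ext j
  have := congrFun (congrFun (nsq_eq_zero hc') 0) j
  simpa using this

end toolbox


lemma samp_L {m n r : ℕ} {p T : ℝ} (hp : 0 ≤ p) {U : Matrix (Fin m) (Fin r) ℝ}
    {V : Matrix (Fin n) (Fin r) ℝ} {Ω : Finset (Fin m × Fin n)} (hG : GoodSample p T U V Ω)
    (a : Matrix (Fin r) (Fin n) ℝ) (b : Matrix (Fin m) (Fin r) ℝ) (hb : Uᵀ * b = 0) :
    0.65 * p * (nsq a + nsq b) ≤ ∑ e ∈ Ω, (U * a + b * Vᵀ) e.1 e.2 ^ 2 := by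
  obtain ⟨R1, R2, R3, -⟩ := hG
  have h1 := R1 (fun q => a q.2 q.1)
  have h2 := R2 (fun q => b q.1 q.2)
  have h3 := R3 (fun q => a q.2 q.1) (fun q => b q.1 q.2)
  have ea : ∑ q : Fin n × Fin r, a q.2 q.1 ^ 2 = nsq a := by
    rw [Fintype.sum_prod_type, Finset.sum_comm]; rfl
  have eb : ∑ q : Fin m × Fin r, b q.1 q.2 ^ 2 = nsq b := by
    rw [Fintype.sum_prod_type]; rfl
  have e0 : ∑ e : Fin m × Fin n, bl U V (fun q => a q.2 q.1) (fun q => b q.1 q.2) e = 0 := by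
    have : ∑ e : Fin m × Fin n, bl U V (fun q => a q.2 q.1) (fun q => b q.1 q.2) e =
        finner (U * a) (b * Vᵀ) := by
      rw [Fintype.sum_prod_type]
      unfold finner bl
      refine Finset.sum_congr rfl fun i _ => Finset.sum_congr rfl fun j _ => ?_
      rw [Matrix.mul_apply, Matrix.mul_apply]
      congr 1
      exact Finset.sum_congr rfl fun k _ => mul_comm _ _
    rw [this, finner_mul_left', ← Matrix.mul_assoc, hb, Matrix.zero_mul, finner_comm,
      finner_zero_left]
  rw [ea] at h1 h3
  rw [eb] at h2 h3
  rw [e0] at h3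
  have ex : ∑ e ∈ Ω, (U * a + b * Vᵀ) e.1 e.2 ^ 2 =
      ∑ e ∈ Ω, (∑ k, U e.1 k * a k e.2) ^ 2 + ∑ e ∈ Ω, (∑ k, V e.2 k * b e.1 k) ^ 2 +
      2 * ∑ e ∈ Ω, bl U V (fun q => a q.2 q.1) (fun q => b q.1 q.2) e := by
    rw [Finset.mul_sum, ← Finset.sum_add_distrib, ← Finset.sum_add_distrib]
    refine Finset.sum_congr rfl fun e _ => ?_
    rw [Matrix.add_apply, Matrix.mul_apply, Matrix.mul_apply]
    unfold bl
    have : ∑ k, b e.1 k * Vᵀ k e.2 = ∑ k, V e.2 k * b e.1 k :=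
      Finset.sum_congr rfl fun k _ => mul_comm _ _
    rw [this]; ring
  rw [ex]
  have g1 := (abs_le.1 h1).1
  have g2 := (abs_le.1 h2).1
  have g3 := (abs_le.1 h3).1
  have am : √(nsq a) * √(nsq b) ≤ (nsq a + nsq b) / 2 := by
    have := sq_nonneg (√(nsq a) - √(nsq b))
    have u1 := Real.sq_sqrt (nsq_nonneg a)
    have u2 := Real.sq_sqrt (nsq_nonneg b)
    nlinarith
  have := mul_le_mul_of_nonneg_left am (by positivity : 0 ≤ p / 10)
  simp only at g1 g2 g3
  linarith

lemma samp_L' {m n r : ℕ} {p T : ℝ} {U : Matrix (Fin m) (Fin r) ℝ}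
    {V : Matrix (Fin n) (Fin r) ℝ} {Ω : Finset (Fin m × Fin n)} (hG : GoodSample p T U V Ω)
    (a : Matrix (Fin r) (Fin n) ℝ) :
    ∑ e ∈ Ω, (U * a) e.1 e.2 ^ 2 ≤ 1.25 * p * nsq a := by
  obtain ⟨R1, -, -, -⟩ := hG
  have h1 := R1 (fun q => a q.2 q.1)
  have ea : ∑ q : Fin n × Fin r, a q.2 q.1 ^ 2 = nsq a := by
    rw [Fintype.sum_prod_type, Finset.sum_comm]; rfl
  rw [ea] at h1
  have g1 := (abs_le.1 h1).2
  have ex : ∑ e ∈ Ω, (U * a) e.1 e.2 ^ 2 = ∑ e ∈ Ω, (∑ k, U e.1 k * a k e.2) ^ 2 :=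
    Finset.sum_congr rfl fun e _ => by rw [Matrix.mul_apply]
  rw [ex]
  simp only at g1
  linarith

lemma samp_Q {m n r : ℕ} {p T a b : ℝ} {U : Matrix (Fin m) (Fin r) ℝ}
    {V : Matrix (Fin n) (Fin r) ℝ} {Ω : Finset (Fin m × Fin n)} (hG : GoodSample p T U V Ω)
    (X : Matrix (Fin m) (Fin r) ℝ) (Y : Matrix (Fin n) (Fin r) ℝ) (ha : 0 ≤ a) (hb : 0 ≤ b)
    (hX : ∀ i, ∑ k, X i k ^ 2 ≤ a) (hY : ∀ j, ∑ k, Y j k ^ 2 ≤ b) :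
    ∑ e ∈ Ω, (X * Yᵀ) e.1 e.2 ^ 2 ≤
      8 * p * (nsq X * nsq Y) + T * b * nsq X + T * ((m : ℝ) / n) * a * nsq Y := by
  obtain ⟨-, -, -, R4⟩ := hG
  have h := vertex_bound Ω (8 * p) T (T * ((m : ℝ) / n)) a b ha hb R4
    (fun i => ∑ k, X i k ^ 2) (fun j => ∑ k, Y j k ^ 2)
    (fun i => Finset.sum_nonneg fun _ _ => sq_nonneg _) hX
    (fun j => Finset.sum_nonneg fun _ _ => sq_nonneg _) hY
  refine le_trans (Finset.sum_le_sum fun e _ => ?_) h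
  rw [Matrix.mul_apply]
  exact Finset.sum_mul_sq_le_sq_mul_sq _ _ _

/-- the final comparison on the sample -/
lemma samp_final {m n : ℕ} (Ω : Finset (Fin m × Fin n)) (L L' Q : Matrix (Fin m) (Fin n) ℝ)
    (h : finner (projOmega Ω (L + Q)) (L + L' + (2 : ℝ) • Q) ≤ 0) :
    1 / 2 * ∑ e ∈ Ω, L e.1 e.2 ^ 2 ≤
      2 * ∑ e ∈ Ω, L' e.1 e.2 ^ 2 + 9 * ∑ e ∈ Ω, Q e.1 e.2 ^ 2 := by
  have e1 : finner (projOmega Ω (L + Q)) (L + L' + (2 : ℝ) • Q) =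
      ∑ e ∈ Ω, (L e.1 e.2 + Q e.1 e.2) * (L e.1 e.2 + L' e.1 e.2 + 2 * Q e.1 e.2) := by
    unfold finner projOmega
    rw [← Fintype.sum_prod_type' (f := fun i j => (Matrix.of fun i j => if (i, j) ∈ Ω then
      (L + Q) i j else 0) i j * (L + L' + (2 : ℝ) • Q) i j)]
    simp only [Matrix.of_apply, ite_mul, zero_mul, Prod.mk.eta, Finset.sum_ite_mem,
      Finset.univ_inter, Matrix.add_apply, Matrix.smul_apply, smul_eq_mul]
  rw [e1] at h
  have : 1 / 2 * ∑ e ∈ Ω, L e.1 e.2 ^ 2 - 2 * ∑ e ∈ Ω, L' e.1 e.2 ^ 2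
      - 9 * ∑ e ∈ Ω, Q e.1 e.2 ^ 2 ≤
      ∑ e ∈ Ω, (L e.1 e.2 + Q e.1 e.2) * (L e.1 e.2 + L' e.1 e.2 + 2 * Q e.1 e.2) := by
    rw [Finset.mul_sum, Finset.mul_sum, Finset.mul_sum, ← Finset.sum_sub_distrib,
      ← Finset.sum_sub_distrib]
    refine Finset.sum_le_sum fun e _ => ?_
    nlinarith [sq_nonneg (L e.1 e.2 / 2 + L' e.1 e.2), sq_nonneg (L e.1 e.2 / 2 + 3 * Q e.1 e.2),
      sq_nonneg (Q e.1 e.2 + L' e.1 e.2), sq_nonneg (Q e.1 e.2), sq_nonneg (L' e.1 e.2)]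
  linarith


/-- decomposition data -/
lemma decomp {m n r : ℕ} {M : Matrix (Fin m) (Fin n) ℝ} {Uh : Matrix (Fin m) (Fin r) ℝ}
    {Vh : Matrix (Fin n) (Fin r) ℝ} {σ : Fin r → ℝ} {s ε : ℝ} (hs : 0 < s)
    (hU : Uhᵀ * Uh = 1) (hV : Vhᵀ * Vh = 1) (hσ : ∀ k, s ≤ σ k)
    (hM : M = Uh * Matrix.diagonal σ * Vhᵀ)
    (X : Matrix (Fin m) (Fin r) ℝ) (Y : Matrix (Fin n) (Fin r) ℝ)
    (hε : ε ≤ 1 / 2) (hE : frob (X * Yᵀ - M) ≤ ε * s) :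
    ∃ (W a a' : Matrix _ _ ℝ) (b : Matrix (Fin m) (Fin r) ℝ),
      frob (W : Matrix (Fin r) (Fin r) ℝ) ≤ 2 * ε ∧
      frob (a' : Matrix (Fin r) (Fin n) ℝ) ≤ 2 * ε * frob (a : Matrix (Fin r) (Fin n) ℝ) ∧
      Uhᵀ * b = 0 ∧ frob a ≤ ε * s ∧ frob b ≤ ε * s ∧
      X * Yᵀ - M = (Uh * a + b * Vhᵀ) +
        (X - Uh * (Uhᵀ * X)) * (Y - Vh * (Vhᵀ * Y))ᵀ ∧
      (X - Uh * (Uhᵀ * X) + Uh * (W * (Uhᵀ * X))) * Yᵀ + X * (Y - Vh * (Vhᵀ * Y))ᵀ =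
        (Uh * a + b * Vhᵀ) + Uh * a' +
        (2 : ℝ) • ((X - Uh * (Uhᵀ * X)) * (Y - Vh * (Vhᵀ * Y))ᵀ) ∧
      s / 2 * frob (X - Uh * (Uhᵀ * X)) ≤ frob b * frob X ∧
      s / 2 * frob (Y - Vh * (Vhᵀ * Y)) ≤ frob a * frob Y := by
  set E := X * Yᵀ - M with hEdef
  set P := Uhᵀ * X with hP
  set Q := Vhᵀ * Y with hQ
  set Xp := X - Uh * P with hXp
  set Yp := Y - Vh * Q with hYp
  set Eh := Uhᵀ * E * Vh with hEh
  have e0 := frob_nonneg E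
  have hε0 : 0 ≤ ε := by
    by_contra hc
    push Not at hc
    nlinarith
  have hUE : frob (Uhᵀ * E) ≤ frob E := frob_le_of_nsq (nsq_orthT_le hU E)
  have hAV : ∀ {k : ℕ} (A : Matrix (Fin k) (Fin n) ℝ), frob (A * Vh) ≤ frob A := fun A => by
    rw [← frob_transpose (A * Vh), ← frob_transpose A, Matrix.transpose_mul]
    exact frob_le_of_nsq (nsq_orthT_le hV Aᵀ)
  have hEhb : frob Eh ≤ ε * s := ((hAV _).trans hUE).trans hE
  have hEh2 : frob Eh ≤ s / 2 := hEhb.trans (by nlinarith)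
  have hN : Matrix.diagonal σ + Eh = P * Qᵀ := by
    rw [hEh, hEdef, hM, Matrix.mul_sub, Matrix.sub_mul]
    have : Uhᵀ * (Uh * Matrix.diagonal σ * Vhᵀ) * Vh = Matrix.diagonal σ := by
      rw [Matrix.mul_assoc Uh, ← Matrix.mul_assoc Uhᵀ, hU, Matrix.one_mul, Matrix.mul_assoc, hV,
        Matrix.mul_one]
    rw [this, hP, hQ, Matrix.transpose_mul, Matrix.transpose_transpose]
    simp only [Matrix.mul_assoc]; abel
  set N := Matrix.diagonal σ + Eh with hNdef
  have hNu : IsUnit N.det := solve_unit σ s hs hσ Eh hEh2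
  have hNi : N * N⁻¹ = 1 := Matrix.mul_nonsing_inv _ hNu
  have hiN : N⁻¹ * N = 1 := Matrix.nonsing_inv_mul _ hNu
  have hQP : Qᵀ * N⁻¹ * P = 1 := by
    rw [mul_eq_one_comm, ← Matrix.mul_assoc, ← hN, hNi]
  set W := Eh * N⁻¹ with hW
  have hWN : W * N = Eh := by rw [hW, Matrix.mul_assoc, hiN, Matrix.mul_one]
  have hWb : frob W ≤ 2 * ε := by
    have := solve_bound σ s hs hσ Eh hEh2 W
    rw [← hNdef, hWN] at this
    have h3 := this.trans hEhb
    by_contra hc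
    push Not at hc
    nlinarith
  have hUp : ∀ {k : ℕ} (A : Matrix (Fin m) (Fin k) ℝ), Uhᵀ * (A - Uh * (Uhᵀ * A)) = 0 := fun A => by
    rw [Matrix.mul_sub, ← Matrix.mul_assoc Uhᵀ Uh, hU, Matrix.one_mul, sub_self]
  have hXpU : Uhᵀ * Xp = 0 := hUp X
  have hVYp : Vhᵀ * Yp = 0 := by
    rw [hYp, Matrix.mul_sub, ← Matrix.mul_assoc Vhᵀ Vh, hV, Matrix.one_mul, sub_self]
  have hYV : Ypᵀ * Vh = 0 := by
    have := congrArg Matrix.transpose hVYp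
    simpa [Matrix.transpose_mul] using this
  have hY : Y = Vh * Q + Yp := by rw [hYp]; abel
  have hX : X = Uh * P + Xp := by rw [hXp]; abel
  have hYT : Yᵀ = Qᵀ * Vhᵀ + Ypᵀ := by
    conv_lhs => rw [hY]
    rw [Matrix.transpose_add, Matrix.transpose_mul]
  set F := P * Ypᵀ with hF
  set b := Xp * Qᵀ with hb
  have hXYT : X * Yᵀ = Uh * N * Vhᵀ + Uh * F + b * Vhᵀ + Xp * Ypᵀ := by
    rw [hYT]
    conv_lhs => rw [hX]
    rw [Matrix.add_mul, Matrix.mul_add, Matrix.mul_add, hN, hF, hb]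
    simp only [Matrix.mul_assoc]; abel
  have hEeq : E = Uh * (Eh * Vhᵀ + F) + b * Vhᵀ + Xp * Ypᵀ := by
    rw [hEdef, hXYT, hM, hNdef]
    simp only [Matrix.mul_add, Matrix.add_mul, Matrix.mul_assoc]; abel
  have hUb : Uhᵀ * b = 0 := by rw [hb, ← Matrix.mul_assoc, hXpU, Matrix.zero_mul]
  have hUEeq : Uhᵀ * E = Eh * Vhᵀ + F := by
    rw [hEeq, Matrix.mul_add, Matrix.mul_add, ← Matrix.mul_assoc Uhᵀ Uh, hU, Matrix.one_mul,
      ← Matrix.mul_assoc Uhᵀ b, hUb, Matrix.zero_mul, ← Matrix.mul_assoc Uhᵀ Xp, hXpU,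
      Matrix.zero_mul, add_zero, add_zero]
  have hFle : frob F ≤ frob (Eh * Vhᵀ + F) := by
    rw [← frob_transpose F, ← frob_transpose (Eh * Vhᵀ + F)]
    have := nsq_perp_le hV (Eh * Vhᵀ + F)ᵀ
    have hh : (Eh * Vhᵀ + F)ᵀ - Vh * (Vhᵀ * (Eh * Vhᵀ + F)ᵀ) = Fᵀ := by
      have hVF : Vhᵀ * Fᵀ = 0 := by
        rw [hF, Matrix.transpose_mul, Matrix.transpose_transpose, ← Matrix.mul_assoc Vhᵀ Yp, hVYp,
          Matrix.zero_mul]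
      have h1 : (Eh * Vhᵀ + F)ᵀ = Vh * Ehᵀ + Fᵀ := by
        rw [Matrix.transpose_add, Matrix.transpose_mul Eh Vhᵀ, Matrix.transpose_transpose]
      rw [h1, Matrix.mul_add, hVF, ← Matrix.mul_assoc Vhᵀ Vh, hV, Matrix.one_mul, add_zero]
      abel
    rw [hh] at this
    exact frob_le_of_nsq this
  have hPX : frob P ≤ frob X := frob_le_of_nsq (nsq_orthT_le hU X)
  have hQY : frob Q ≤ frob Y := frob_le_of_nsq (nsq_orthT_le hV Y)
  refine ⟨W, Eh * Vhᵀ + F, W * F, b, hWb, ?_, hUb, ?_, ?_, ?_, ?_, ?_, ?_⟩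
  · refine (frob_mul_le _ _).trans ?_
    exact mul_le_mul hWb hFle (frob_nonneg _) (by positivity)
  · rw [← hUEeq]; exact hUE.trans hE
  · have : b = E * Vh - Uh * (Uhᵀ * (E * Vh)) := by
      have hEV : E * Vh = Uh * Eh + b := by
        rw [hEeq]
        simp only [Matrix.add_mul, Matrix.mul_add, Matrix.mul_assoc, hV, Matrix.mul_one, hYV,
          Matrix.mul_zero, hF, add_zero]
      rw [← Matrix.mul_assoc Uhᵀ, ← hEh, hEV]; abel
    rw [this]
    exact ((frob_le_of_nsq (nsq_perp_le hU _)).trans (hAV E)).trans hE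
  · exact hEeq
  · have h1 : Uh * (W * P) * Yᵀ = Uh * (Eh * Vhᵀ) + Uh * (W * F) := by
      rw [hYT, Matrix.mul_add, ← hWN, hN, hF]
      simp only [Matrix.mul_assoc]
    have h2 : Xp * Yᵀ = b * Vhᵀ + Xp * Ypᵀ := by
      rw [hYT, Matrix.mul_add, hb, Matrix.mul_assoc]
    have h3 : X * Ypᵀ = Uh * F + Xp * Ypᵀ := by
      conv_lhs => rw [hX]
      rw [Matrix.add_mul, hF, Matrix.mul_assoc]
    rw [Matrix.add_mul, h1, h2, h3, Matrix.mul_add, two_smul]; abel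
  · have h1 : Xp = b * N⁻¹ * P := by
      rw [hb, Matrix.mul_assoc, Matrix.mul_assoc, ← Matrix.mul_assoc Qᵀ, hQP, Matrix.mul_one]
    have h2 := solve_bound σ s hs hσ Eh hEh2 (b * N⁻¹)
    rw [← hNdef, Matrix.mul_assoc b, hiN, Matrix.mul_one] at h2
    have h3 := frob_mul_le (b * N⁻¹) P
    rw [← h1] at h3
    calc s / 2 * frob Xp ≤ s / 2 * (frob (b * N⁻¹) * frob P) := by gcongr
      _ = s / 2 * frob (b * N⁻¹) * frob P := by ring
      _ ≤ frob b * frob X := mul_le_mul h2 hPX (frob_nonneg _) (frob_nonneg _)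
  · have h1 : Ypᵀ = Qᵀ * (N⁻¹ * F) := by
      rw [hF, ← Matrix.mul_assoc, ← Matrix.mul_assoc, hQP, Matrix.one_mul]
    have h2 := solve_bound' σ s hs hσ Eh hEh2 (N⁻¹ * F)
    rw [← hNdef, ← Matrix.mul_assoc N N⁻¹ F, hNi, Matrix.one_mul] at h2
    have h3 := frob_mul_le Qᵀ (N⁻¹ * F)
    rw [← h1, frob_transpose, frob_transpose] at h3
    calc s / 2 * frob Yp ≤ s / 2 * (frob Q * frob (N⁻¹ * F)) := by gcongr
      _ = s / 2 * frob (N⁻¹ * F) * frob Q := by ring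
      _ ≤ frob (Eh * Vhᵀ + F) * frob Y :=
        mul_le_mul (h2.trans hFle) hQY (frob_nonneg _) (frob_nonneg _)


def wt (ρ β t : ℝ) : ℝ := ρ * G0' (3 * t ^ 2 / (2 * β ^ 2)) * (3 / β ^ 2)

lemma wt_nonneg {ρ : ℝ} (hρ : 0 ≤ ρ) (β t : ℝ) : 0 ≤ wt ρ β t := by
  unfold wt G0'; positivity

lemma wt_active {ρ β t : ℝ} (hβ : 0 < β) (h : wt ρ β t ≠ 0) : 2 / 3 * β ^ 2 ≤ t ^ 2 := by
  by_contra hc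
  push Not at hc
  apply h
  have : 3 * t ^ 2 / (2 * β ^ 2) - 1 ≤ 0 := by
    rw [sub_nonpos, div_le_one (by positivity)]; linarith
  unfold wt G0'
  rw [max_eq_left this]; ring

lemma gradG1_eq {m r : ℕ} (ρ β βT : ℝ) (X : Matrix (Fin m) (Fin r) ℝ) :
    gradG1 ρ β βT X = Matrix.diagonal (fun i => wt ρ β (rowNorm X i)) * X
      + wt ρ βT (frob X) • X := by
  unfold gradG1
  congr 1
  ext i j
  rw [Matrix.diagonal_mul, Matrix.sum_apply]
  simp only [Matrix.smul_apply, rowMat, Matrix.of_apply, smul_eq_mul, mul_ite, mul_zero]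
  rw [Finset.sum_ite_eq]
  simp [wt]

lemma finner_diag {m r : ℕ} (d : Fin m → ℝ) (X A : Matrix (Fin m) (Fin r) ℝ) :
    finner (Matrix.diagonal d * X) A = ∑ i, d i * ∑ k, X i k * A i k := by
  unfold finner
  refine Finset.sum_congr rfl fun i _ => ?_
  rw [Finset.mul_sum]
  refine Finset.sum_congr rfl fun k _ => ?_
  rw [Matrix.diagonal_mul]; ring

lemma finner_gram {m n r : ℕ} (d : Fin m → ℝ) (X : Matrix (Fin m) (Fin r) ℝ)
    (Y : Matrix (Fin n) (Fin r) ℝ) :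
    finner (Xᵀ * (Matrix.diagonal d * X)) (Yᵀ * Y) = ∑ i, d i * ∑ j, (X * Yᵀ) i j ^ 2 := by
  rw [finner_mul_left', Matrix.transpose_transpose, ← Matrix.mul_assoc, finner_comm,
    finner_mul_left, Matrix.mul_assoc, finner_comm, finner_diag]
  simp only [sq]

lemma finner_gram' {m n r : ℕ} (X : Matrix (Fin m) (Fin r) ℝ)
    (Y : Matrix (Fin n) (Fin r) ℝ) :
    finner (Xᵀ * X) (Yᵀ * Y) = nsq (X * Yᵀ) := by
  have := finner_gram (fun _ => 1) X Y
  simpa [nsq] using this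

lemma nsq_gram {n r : ℕ} (Y : Matrix (Fin n) (Fin r) ℝ) :
    nsq Y ^ 2 ≤ r * nsq (Yᵀ * Y) := by
  have h1 : nsq Y = ∑ k, (Yᵀ * Y) k k := by
    rw [← finner_self, finner_trace]; rfl
  have h2 := sq_sum_le_card_mul_sum_sq (s := (Finset.univ : Finset (Fin r)))
    (f := fun k => (Yᵀ * Y) k k)
  rw [← h1] at h2
  refine h2.trans ?_
  rw [Finset.card_univ, Fintype.card_fin]
  gcongr
  unfold nsq
  refine Finset.sum_le_sum fun k _ => ?_
  exact Finset.single_le_sum (f := fun j => (Yᵀ * Y) k j ^ 2) (fun j _ => sq_nonneg _)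
    (Finset.mem_univ k)

lemma bal_half {m n r : ℕ} (d : Fin m → ℝ) (s : Fin n → ℝ) (dx dy : ℝ)
    (hd : ∀ i, 0 ≤ d i) (hs : ∀ j, 0 ≤ s j) (hdy : 0 ≤ dy)
    (X : Matrix (Fin m) (Fin r) ℝ) (Y : Matrix (Fin n) (Fin r) ℝ)
    (hbal : Xᵀ * (Matrix.diagonal d * X + dx • X) = Yᵀ * (Matrix.diagonal s * Y + dy • Y)) :
    dy * nsq Y ^ 2 ≤ r * (dx * nsq (X * Yᵀ) + (∑ i, d i * ∑ k, X i k ^ 2) * nsq Y) := by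
  have h := congrArg (fun A => finner A (Yᵀ * Y)) hbal
  simp only [Matrix.mul_add, Matrix.mul_smul, finner_add_left, finner_smul_left, finner_gram,
    finner_gram'] at h
  have h1 : ∑ i, d i * ∑ j, (X * Yᵀ) i j ^ 2 ≤ (∑ i, d i * ∑ k, X i k ^ 2) * nsq Y := by
    rw [Finset.sum_mul]
    refine Finset.sum_le_sum fun i _ => ?_
    rw [mul_assoc]
    refine mul_le_mul_of_nonneg_left ?_ (hd i)
    have := rowsq_mul_le X Yᵀ i
    rwa [nsq_transpose] at this
  have h2 : 0 ≤ ∑ j, s j * ∑ i, (Y * Yᵀ) j i ^ 2 :=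
    Finset.sum_nonneg fun j _ => mul_nonneg (hs j) (Finset.sum_nonneg fun _ _ => sq_nonneg _)
  have h3 : nsq Y ^ 2 ≤ r * nsq (Y * Yᵀ) := by
    rw [← finner_gram', finner_self]; exact nsq_gram Y
  have h4 : dy * nsq (Y * Yᵀ) ≤ dx * nsq (X * Yᵀ) + (∑ i, d i * ∑ k, X i k ^ 2) * nsq Y := by
    linarith
  calc dy * nsq Y ^ 2 ≤ dy * (r * nsq (Y * Yᵀ)) := by gcongr
    _ = r * (dy * nsq (Y * Yᵀ)) := by ring
    _ ≤ _ := by gcongr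

lemma arith_bal {r S x y dx dy K hx : ℝ} (hr : 1 ≤ r) (hS : 0 < S) (hdx : 0 ≤ dx)
    (hK : K ≤ 4 * r * S ^ 2)
    (hx4 : 4 * r * S ≤ x) (hy4 : 4 * r * S ≤ y)
    (h : dy * y ^ 2 ≤ r * (dx * K + hx * y)) : dy * y ≤ dx * x / 4 + r * hx := by
  have hy0 : 0 < y := lt_of_lt_of_le (by positivity) hy4
  have h1 : r * (dx * K) ≤ dx * x / 4 * y := by
    calc r * (dx * K) ≤ r * (dx * (4 * r * S ^ 2)) := by gcongr
      _ = dx * (4 * r * S) / 4 * (4 * r * S) := by ring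
      _ ≤ dx * x / 4 * y := by
        have : 0 ≤ 4 * r * S := by positivity
        have hx0 : 0 ≤ x := this.trans hx4
        gcongr
  have h2 : dy * y * y ≤ (dx * x / 4 + r * hx) * y := by nlinarith
  exact le_of_mul_le_mul_right h2 hy0

lemma bal_bound {m n r : ℕ} (hr : 1 ≤ r) (d : Fin m → ℝ) (s : Fin n → ℝ) (dx dy S : ℝ)
    (hS : 0 < S)
    (hd : ∀ i, 0 ≤ d i) (hs : ∀ j, 0 ≤ s j) (hdx : 0 ≤ dx) (hdy : 0 ≤ dy)
    (X : Matrix (Fin m) (Fin r) ℝ) (Y : Matrix (Fin n) (Fin r) ℝ)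
    (hbal : Xᵀ * (Matrix.diagonal d * X + dx • X) = Yᵀ * (Matrix.diagonal s * Y + dy • Y))
    (hx : dx ≠ 0 → 4 * r * S ≤ nsq X) (hy : dy ≠ 0 → 4 * r * S ≤ nsq Y)
    (hK : nsq (X * Yᵀ) ≤ 4 * r * S ^ 2) :
    dx * nsq X ≤ 4 / 3 * r * (∑ i, d i * ∑ k, X i k ^ 2 + ∑ j, s j * ∑ k, Y j k ^ 2) := by
  have hr' : (1 : ℝ) ≤ r := by exact_mod_cast hr
  have q1 : 0 ≤ ∑ i, d i * ∑ k, X i k ^ 2 :=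
    Finset.sum_nonneg fun j _ => mul_nonneg (hd j) (Finset.sum_nonneg fun _ _ => sq_nonneg _)
  have q2 : 0 ≤ ∑ j, s j * ∑ k, Y j k ^ 2 :=
    Finset.sum_nonneg fun j _ => mul_nonneg (hs j) (Finset.sum_nonneg fun _ _ => sq_nonneg _)
  by_cases hdx0 : dx = 0
  · rw [hdx0]; rw [zero_mul]; positivity
  by_cases hdy0 : dy = 0
  · have ht : ∀ {k : ℕ} (d : Fin k → ℝ) (dx : ℝ) (X : Matrix (Fin k) (Fin r) ℝ),
        Matrix.trace (Xᵀ * (Matrix.diagonal d * X + dx • X)) =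
          ∑ i, d i * ∑ k, X i k ^ 2 + dx * nsq X := fun d dx X => by
      rw [← finner_trace, finner_comm, finner_add_left, finner_smul_left, finner_self, finner_diag]
      simp only [sq]
    have h := congrArg Matrix.trace hbal
    rw [ht, ht, hdy0, zero_mul, add_zero] at h
    nlinarith
  have b1 := bal_half d s dx dy hd hs hdy X Y hbal
  have b2 := bal_half s d dy dx hs hd hdx Y X hbal.symm
  have hK' : nsq (Y * Xᵀ) ≤ 4 * r * S ^ 2 := by
    rw [← nsq_transpose]; simpa using hK
  have c1 := arith_bal hr' hS hdx hK (hx hdx0) (hy hdy0) b1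
  have c2 := arith_bal hr' hS hdy hK' (hy hdy0) (hx hdx0) b2
  have : 0 ≤ dy * nsq Y := mul_nonneg hdy (nsq_nonneg _)
  nlinarith

/-- an active row is aligned with the direction -/
lemma row_align {m r : ℕ} (X U : Matrix (Fin m) (Fin r) ℝ) (i : Fin m) (c : ℝ)
    (h1 : ∑ k, U i k ^ 2 ≤ 1.21 * c) (h2 : 2 * c ≤ ∑ k, X i k ^ 2) :
    1 / 5 * ∑ k, X i k ^ 2 ≤ ∑ k, X i k * (X - U) i k := by
  have e : ∑ k, X i k * (X - U) i k = ∑ k, X i k ^ 2 - ∑ k, X i k * U i k := by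
    rw [← Finset.sum_sub_distrib]
    refine Finset.sum_congr rfl fun k _ => ?_
    rw [Matrix.sub_apply]; ring
  have hc := Finset.sum_mul_sq_le_sq_mul_sq Finset.univ (fun k => X i k) (fun k => U i k)
  have hx0 : 0 ≤ ∑ k, X i k ^ 2 := Finset.sum_nonneg fun _ _ => sq_nonneg _
  have : ∑ k, X i k * U i k ≤ 4 / 5 * ∑ k, X i k ^ 2 := by
    apply le_of_sq_le_sq_aux _ (by positivity)
    refine hc.trans ?_
    have : ∑ k, U i k ^ 2 ≤ 16 / 25 * ∑ k, X i k ^ 2 := by linarith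
    nlinarith
  rw [e]; linarith

lemma reg_rows {m r : ℕ} (d : Fin m → ℝ) (hd : ∀ i, 0 ≤ d i) (X U : Matrix (Fin m) (Fin r) ℝ)
    (c : ℝ) (h1 : ∀ i, ∑ k, U i k ^ 2 ≤ 1.21 * c) (h2 : ∀ i, d i ≠ 0 → 2 * c ≤ ∑ k, X i k ^ 2) :
    1 / 5 * (∑ i, d i * ∑ k, X i k ^ 2) ≤ finner (Matrix.diagonal d * X) (X - U) := by
  rw [finner_diag, Finset.mul_sum]
  refine Finset.sum_le_sum fun i _ => ?_
  by_cases h : d i = 0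
  · rw [h]; simp
  have := row_align X U i c (h1 i) (h2 i h)
  have := mul_le_mul_of_nonneg_left this (hd i)
  linarith

/-- the regularizer contribution is nonnegative -/
lemma reg_nonneg {m n r : ℕ} (hr : 1 ≤ r) {Uh : Matrix (Fin m) (Fin r) ℝ}
    {Vh : Matrix (Fin n) (Fin r) ℝ} (hU : Uhᵀ * Uh = 1) (hV : Vhᵀ * Vh = 1)
    (d : Fin m → ℝ) (s : Fin n → ℝ) (dx dy S ε c1 c2 B : ℝ)
    (hS : 0 < S) (hε0 : 0 ≤ ε) (hε : ε * r ≤ 1 / 100)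
    (hd : ∀ i, 0 ≤ d i) (hs : ∀ j, 0 ≤ s j) (hdx : 0 ≤ dx) (hdy : 0 ≤ dy)
    (X : Matrix (Fin m) (Fin r) ℝ) (Y : Matrix (Fin n) (Fin r) ℝ)
    (W : Matrix (Fin r) (Fin r) ℝ) (hW : frob W ≤ 2 * ε)
    (hbal : Xᵀ * (Matrix.diagonal d * X + dx • X) = Yᵀ * (Matrix.diagonal s * Y + dy • Y))
    (hx : dx ≠ 0 → 4 * r * S ≤ nsq X) (hy : dy ≠ 0 → 4 * r * S ≤ nsq Y)
    (hK : nsq (X * Yᵀ) ≤ 4 * r * S ^ 2)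
    (hUi : ∀ i, ∑ k, Uh i k ^ 2 ≤ c1) (hVj : ∀ j, ∑ k, Vh j k ^ 2 ≤ c2)
    (hc1 : 0 ≤ c1) (hc2 : 0 ≤ c2) (hB : 0 ≤ B) (hXB : frob X ≤ B) (hYB : frob Y ≤ B)
    (hdX : ∀ i, d i ≠ 0 → 2 * (c1 * B ^ 2) ≤ ∑ k, X i k ^ 2)
    (hsY : ∀ j, s j ≠ 0 → 2 * (c2 * B ^ 2) ≤ ∑ k, Y j k ^ 2) :
    0 ≤ finner (Matrix.diagonal d * X + dx • X) (X - Uh * (Uhᵀ * X) + Uh * (W * (Uhᵀ * X))) +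
      finner (Matrix.diagonal s * Y + dy • Y) (Y - Vh * (Vhᵀ * Y)) := by
  have hr' : (1 : ℝ) ≤ r := by exact_mod_cast hr
  have hbb := bal_bound hr d s dx dy S hS hd hs hdx hdy X Y hbal hx hy hK
  have hP : frob (Uhᵀ * X) ≤ frob X := frob_le_of_nsq (nsq_orthT_le hU X)
  have hQ : frob (Vhᵀ * Y) ≤ frob Y := frob_le_of_nsq (nsq_orthT_le hV Y)
  have hε1 : ε ≤ 1 / 100 := by nlinarith
  have rowU : ∀ i, ∑ k, (Uh * (Uhᵀ * X - W * (Uhᵀ * X))) i k ^ 2 ≤ 1.21 * (c1 * B ^ 2) := by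
    intro i
    refine (rowsq_mul_le _ _ i).trans ?_
    have h1 : frob (Uhᵀ * X - W * (Uhᵀ * X)) ≤ 1.1 * B := by
      refine (frob_sub_le _ _).trans ?_
      have h2 := frob_mul_le W (Uhᵀ * X)
      have h3 : frob W * frob (Uhᵀ * X) ≤ 0.1 * B :=
        mul_le_mul (by linarith) (hP.trans hXB) (frob_nonneg _) (by norm_num)
      linarith
    have h2 : nsq (Uhᵀ * X - W * (Uhᵀ * X)) ≤ 1.21 * B ^ 2 := by
      rw [← frob_sq]
      have := frob_nonneg (Uhᵀ * X - W * (Uhᵀ * X))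
      calc _ ≤ (1.1 * B) ^ 2 := by gcongr
        _ = _ := by ring
    calc _ ≤ c1 * (1.21 * B ^ 2) := mul_le_mul (hUi i) h2 (nsq_nonneg _) hc1
      _ = _ := by ring
  have rowV : ∀ j, ∑ k, (Vh * (Vhᵀ * Y)) j k ^ 2 ≤ 1.21 * (c2 * B ^ 2) := by
    intro j
    refine (rowsq_mul_le _ _ j).trans ?_
    have h2 : nsq (Vhᵀ * Y) ≤ B ^ 2 := by
      rw [← frob_sq]
      have := frob_nonneg (Vhᵀ * Y)
      have := hQ.trans hYB
      gcongr
    calc _ ≤ c2 * B ^ 2 := mul_le_mul (hVj j) h2 (nsq_nonneg _) hc2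
      _ ≤ _ := by nlinarith [mul_nonneg hc2 (sq_nonneg B)]
  have r1 := reg_rows d hd X _ _ rowU hdX
  have r2 := reg_rows s hs Y _ _ rowV hsY
  have eA : X - Uh * (Uhᵀ * X) + Uh * (W * (Uhᵀ * X)) =
      X - Uh * (Uhᵀ * X - W * (Uhᵀ * X)) := by
    rw [Matrix.mul_sub]; abel
  have perp : ∀ {k : ℕ} {U : Matrix (Fin k) (Fin r) ℝ} (_ : Uᵀ * U = 1)
      (Z : Matrix (Fin k) (Fin r) ℝ), 0 ≤ finner Z (Z - U * (Uᵀ * Z)) := fun {k U} hU Z => by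
    have h1 : finner Z (U * (Uᵀ * Z)) = nsq (Uᵀ * Z) := by
      rw [finner_comm, finner_mul_left', finner_self]
    rw [finner_sub_right, finner_self, h1]
    linarith [nsq_orthT_le hU Z]
  have t1 : -(2 * ε * nsq X) ≤ finner X (X - Uh * (Uhᵀ * X - W * (Uhᵀ * X))) := by
    rw [← eA, finner_add_right]
    have h1 := perp hU X
    have h2 : finner X (Uh * (W * (Uhᵀ * X))) = finner (W * (Uhᵀ * X)) (Uhᵀ * X) := by
      rw [finner_comm, finner_mul_left']
    rw [h2]
    have h3 := (abs_le.1 (abs_finner_le (W * (Uhᵀ * X)) (Uhᵀ * X))).1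
    have h4 : frob (W * (Uhᵀ * X)) * frob (Uhᵀ * X) ≤ 2 * ε * nsq X := by
      calc _ ≤ (frob W * frob (Uhᵀ * X)) * frob (Uhᵀ * X) :=
            mul_le_mul_of_nonneg_right (frob_mul_le _ _) (frob_nonneg _)
        _ ≤ (2 * ε * frob X) * frob X := by
            have := frob_nonneg (Uhᵀ * X)
            have := frob_nonneg W
            have := frob_nonneg X
            gcongr
        _ = 2 * ε * frob X ^ 2 := by ring
        _ = _ := by rw [frob_sq]
    linarith
  have t2 := perp hV Y
  rw [finner_add_left, finner_add_left, finner_smul_left, finner_smul_left, eA]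
  have q1 : 0 ≤ ∑ i, d i * ∑ k, X i k ^ 2 :=
    Finset.sum_nonneg fun j _ => mul_nonneg (hd j) (Finset.sum_nonneg fun _ _ => sq_nonneg _)
  have q2 : 0 ≤ ∑ j, s j * ∑ k, Y j k ^ 2 :=
    Finset.sum_nonneg fun j _ => mul_nonneg (hs j) (Finset.sum_nonneg fun _ _ => sq_nonneg _)
  have u1 := mul_le_mul_of_nonneg_left t1 hdx
  have u2 := mul_nonneg hdy t2
  have u3 : 2 * ε * (dx * nsq X) ≤ 2 * ε * (4 / 3 * r *
      (∑ i, d i * ∑ k, X i k ^ 2 + ∑ j, s j * ∑ k, Y j k ^ 2)) :=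
    mul_le_mul_of_nonneg_left hbb (by positivity)
  have u4 : 2 * ε * (4 / 3 * r *
      (∑ i, d i * ∑ k, X i k ^ 2 + ∑ j, s j * ∑ k, Y j k ^ 2)) ≤ 1 / 5 *
      (∑ i, d i * ∑ k, X i k ^ 2 + ∑ j, s j * ∑ k, Y j k ^ 2) := by
    have : 2 * ε * (4 / 3 * r) ≤ 1 / 5 := by linarith
    have := mul_le_mul_of_nonneg_right this (add_nonneg q1 q2)
    linarith
  linarith


lemma arith_perp {s x b f B r S : ℝ} (hs : 0 < s) (hx : 0 ≤ x) (hb : 0 ≤ b) (hf : 0 ≤ f)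
    (hfB : f ≤ B) (hB : B ^ 2 = 6 * r * S) (h : s / 2 * x ≤ b * f) :
    x ^ 2 ≤ 24 * r * S / s ^ 2 * b ^ 2 := by
  have h1 : s / 2 * x ≤ b * B := h.trans (by gcongr)
  have h2 : (s / 2 * x) ^ 2 ≤ (b * B) ^ 2 := by gcongr
  rw [mul_pow b B, hB] at h2
  have h3 : x ^ 2 = (s / 2 * x) ^ 2 * (4 / s ^ 2) := by field_simp; ring
  rw [h3]
  calc _ ≤ b ^ 2 * (6 * r * S) * (4 / s ^ 2) := by gcongr
    _ = _ := by ring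

lemma arith_Q {p x2 y2 na nb r S s κ μ ε m n T B2 q : ℝ} (hp : 0 ≤ p) (hr : 1 ≤ r) (hs : 0 < s)
    (hS : 0 < S) (hκ : κ = S / s) (hμ : 0 < μ) (hm : 0 < m) (hn : 0 < n)
    (hT : T = 1 / 10 ^ 6 / (μ * r ^ 3 * κ ^ 2) * (p * n)) (hB2 : B2 = 6 * r * S)
    (hε : ε ^ 2 * r ^ 2 * κ ^ 2 ≤ 1 / 10 ^ 8)
    (hx : x2 ≤ 24 * r * S / s ^ 2 * nb) (hy : y2 ≤ 24 * r * S / s ^ 2 * na)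
    (hx0 : 0 ≤ x2) (hy0 : 0 ≤ y2) (hna : 0 ≤ na) (hnb : 0 ≤ nb) (hnbε : nb ≤ (ε * s) ^ 2)
    (hq : q ≤ 8 * p * (x2 * y2) + T * (8 * (μ * r / n) * B2) * x2 +
      T * (m / n) * (8 * (μ * r / m) * B2) * y2) :
    q ≤ 0.0013 * p * (na + nb) := by
  have hκ0 : 0 < κ := by rw [hκ]; positivity
  have c1 : T * (8 * (μ * r / n) * B2) = 48 / 10 ^ 6 * p * S / (r * κ ^ 2) := by
    rw [hT, hB2]; field_simp; ring
  have c2 : T * (m / n) * (8 * (μ * r / m) * B2) = 48 / 10 ^ 6 * p * S / (r * κ ^ 2) := by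
    rw [hT, hB2]; field_simp; ring
  rw [c1, c2] at hq
  have c3 : 48 / 10 ^ 6 * p * S / (r * κ ^ 2) * (24 * r * S / s ^ 2) = 1152 / 10 ^ 6 * p := by
    rw [hκ]; field_simp; ring
  have c4 : 0 ≤ 48 / 10 ^ 6 * p * S / (r * κ ^ 2) := by positivity
  have d1 : 48 / 10 ^ 6 * p * S / (r * κ ^ 2) * x2 ≤ 1152 / 10 ^ 6 * p * nb := by
    rw [← c3, mul_assoc _ (24 * r * S / s ^ 2)]
    exact mul_le_mul_of_nonneg_left hx c4
  have d2 : 48 / 10 ^ 6 * p * S / (r * κ ^ 2) * y2 ≤ 1152 / 10 ^ 6 * p * na := by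
    rw [← c3, mul_assoc _ (24 * r * S / s ^ 2)]
    exact mul_le_mul_of_nonneg_left hy c4
  have d3 : x2 * y2 ≤ 576 / 10 ^ 8 * na := by
    calc x2 * y2 ≤ (24 * r * S / s ^ 2 * (ε * s) ^ 2) * (24 * r * S / s ^ 2 * na) := by
          apply mul_le_mul _ hy hy0 (by positivity)
          exact hx.trans (by gcongr)
      _ = 576 * (ε ^ 2 * r ^ 2 * κ ^ 2) * na := by rw [hκ]; field_simp; ring
      _ ≤ 576 * (1 / 10 ^ 8) * na := by gcongr
      _ = _ := by ring
  have d4 : 8 * p * (x2 * y2) ≤ 8 * p * (576 / 10 ^ 8 * na) := by gcongr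
  have : 0 ≤ p * na := by positivity
  have : 0 ≤ p * nb := by positivity
  nlinarith

lemma row_perp {m r : ℕ} {U : Matrix (Fin m) (Fin r) ℝ} (hU : Uᵀ * U = 1)
    (X : Matrix (Fin m) (Fin r) ℝ) {c B β : ℝ} (hc : 0 ≤ c) (hUi : ∀ i, ∑ k, U i k ^ 2 ≤ c)
    (hX : frob X ≤ B) (hβ : β ^ 2 = 3 * c * B ^ 2) (hr : ∀ i, rowNorm X i ≤ β) (i : Fin m) :
    ∑ k, (X - U * (Uᵀ * X)) i k ^ 2 ≤ 8 * c * B ^ 2 := by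
  have h1 : ∑ k, X i k ^ 2 ≤ 3 * c * B ^ 2 := by
    rw [← rowNorm_sq, ← hβ]
    have := rowNorm_nonneg X i
    have := hr i
    gcongr
  have h2 : ∑ k, (U * (Uᵀ * X)) i k ^ 2 ≤ c * B ^ 2 := by
    refine (rowsq_mul_le _ _ i).trans (mul_le_mul (hUi i) ?_ (nsq_nonneg _) hc)
    refine (nsq_orthT_le hU X).trans ?_
    rw [← frob_sq]
    have := frob_nonneg X
    gcongr
  have h3 : ∑ k, (X - U * (Uᵀ * X)) i k ^ 2 ≤
      2 * ∑ k, X i k ^ 2 + 2 * ∑ k, (U * (Uᵀ * X)) i k ^ 2 := by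
    rw [Finset.mul_sum, Finset.mul_sum, ← Finset.sum_add_distrib]
    refine Finset.sum_le_sum fun k _ => ?_
    rw [Matrix.sub_apply]
    nlinarith [sq_nonneg (X i k + (U * (Uᵀ * X)) i k)]
  linarith

set_option maxHeartbeats 2000000 in
lemma det_main {m n r : ℕ} {μ : ℝ} {M : Matrix (Fin m) (Fin n) ℝ}
    {Uh : Matrix (Fin m) (Fin r) ℝ} {Vh : Matrix (Fin n) (Fin r) ℝ} {σ : Fin r → ℝ}
    {S s p ρ ε κ βT β1 β2 : ℝ} (hm : 0 < (m : ℝ)) (hn : 0 < (n : ℝ)) (hr : 1 ≤ r) (hμ : 1 ≤ μ)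
    (hU : Uhᵀ * Uh = 1) (hV : Vhᵀ * Vh = 1) (hs : 0 < s) (hσ : ∀ k, s ≤ σ k)
    (hσS : ∀ k, σ k ≤ S) (hM : M = Uh * Matrix.diagonal σ * Vhᵀ)
    (hUi : ∀ i, ∑ k, Uh i k ^ 2 ≤ μ * r / m) (hVj : ∀ j, ∑ k, Vh j k ^ 2 ≤ μ * r / n)
    (hκ : κ = S / s) (hp : 0 < p) (hρ : 0 ≤ ρ) (hε0 : 0 ≤ ε) (hεr : ε * r ≤ 1 / 100)
    (hε : ε ^ 2 * (r : ℝ) ^ 2 * κ ^ 2 ≤ 1 / 10 ^ 8)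
    (hβT : 0 < βT) (hβT2 : βT ^ 2 = 6 * r * S)
    (hβ1 : 0 < β1) (hβ12 : β1 ^ 2 = 3 * (μ * r / m) * βT ^ 2)
    (hβ2 : 0 < β2) (hβ22 : β2 ^ 2 = 3 * (μ * r / n) * βT ^ 2)
    {Ω : Finset (Fin m × Fin n)}
    (hG : GoodSample p (1 / 10 ^ 6 / (μ * r ^ 3 * κ ^ 2) * (p * n)) Uh Vh Ω)
    (X : Matrix (Fin m) (Fin r) ℝ) (Y : Matrix (Fin n) (Fin r) ℝ)
    (k1 : K1mem β1 β2 X Y) (k2 : K2mem βT X Y) (k3 : Kmem M (ε * s) X Y)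
    (gX : gradX Ω M ρ β1 βT X Y = 0) (gY : gradY Ω M ρ β2 βT X Y = 0) : X * Yᵀ = M := by
  have hr' : (1 : ℝ) ≤ r := by exact_mod_cast hr
  have hr0 : (0 : ℝ) < r := by linarith
  have hμ0 : 0 < μ := by linarith
  have hsS : s ≤ S := (hσ ⟨0, hr⟩).trans (hσS ⟨0, hr⟩)
  have hS : 0 < S := by linarith
  have hε1 : ε ≤ 1 / 100 := by nlinarith only [hε0, hr', hεr]
  have hE : frob (X * Yᵀ - M) ≤ ε * s := by rw [frob_sub_comm]; exact k3
  obtain ⟨W, a, a', b, hW, ha', hUb, haε, hbε, hEeq, hdir, hXp, hYp⟩ :=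
    decomp hs hU hV hσ hM X Y (by linarith) hE
  -- the regularizer
  unfold gradX at gX
  unfold gradY at gY
  rw [gradG1_eq] at gX gY
  obtain ⟨d, hd⟩ : ∃ d : Fin m → ℝ, d = fun i => wt ρ β1 (rowNorm X i) := ⟨_, rfl⟩
  obtain ⟨t, ht⟩ : ∃ t : Fin n → ℝ, t = fun i => wt ρ β2 (rowNorm Y i) := ⟨_, rfl⟩
  obtain ⟨dx, hdx⟩ : ∃ dx, dx = wt ρ βT (frob X) := ⟨_, rfl⟩
  obtain ⟨dy, hdy⟩ : ∃ dy, dy = wt ρ βT (frob Y) := ⟨_, rfl⟩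
  rw [← hd, ← hdx] at gX
  rw [← ht, ← hdy] at gY
  have hbal : Xᵀ * (Matrix.diagonal d * X + dx • X) = Yᵀ * (Matrix.diagonal t * Y + dy • Y) := by
    have e1 : Matrix.diagonal d * X + dx • X = - (projOmega Ω (X * Yᵀ - M) * Y) :=
      eq_neg_of_add_eq_zero_right gX
    have e2 : Matrix.diagonal t * Y + dy • Y = - ((projOmega Ω (X * Yᵀ - M))ᵀ * X) :=
      eq_neg_of_add_eq_zero_right gY
    have e3 : (Yᵀ * (Matrix.diagonal t * Y + dy • Y))ᵀ =
        Yᵀ * (Matrix.diagonal t * Y + dy • Y) := by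
      simp only [Matrix.transpose_mul, Matrix.transpose_add, Matrix.transpose_smul,
        Matrix.transpose_transpose, Matrix.diagonal_transpose, Matrix.mul_add, Matrix.add_mul,
        Matrix.mul_smul, Matrix.smul_mul, Matrix.mul_assoc]
    rw [← e3, e1, e2]
    simp only [Matrix.mul_neg, Matrix.transpose_neg, Matrix.transpose_mul,
      Matrix.transpose_transpose, Matrix.mul_assoc]
  have hK : nsq (X * Yᵀ) ≤ 4 * r * S ^ 2 := by
    have e1 : X * Yᵀ = M + (X * Yᵀ - M) := by abel
    have e2 : nsq M ≤ r * S ^ 2 := by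
      rw [hM, Matrix.mul_assoc, nsq_orth_mul hU, ← nsq_transpose, Matrix.transpose_mul,
        Matrix.transpose_transpose, nsq_orth_mul hV, nsq_transpose]
      unfold nsq
      calc _ ≤ ∑ i : Fin r, S ^ 2 := by
            refine Finset.sum_le_sum fun i _ => ?_
            rw [Finset.sum_eq_single i]
            · rw [Matrix.diagonal_apply_eq]
              have := hσ i
              have := hσS i
              have : 0 ≤ σ i := by linarith
              gcongr
            · intro j _ hj
              rw [Matrix.diagonal_apply_ne _ hj.symm]; norm_num
            · simp
        _ = _ := by simp
    have e3 : nsq (X * Yᵀ - M) ≤ S ^ 2 := by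
      rw [← frob_sq]
      have := frob_nonneg (X * Yᵀ - M)
      have : frob (X * Yᵀ - M) ≤ S := hE.trans (by nlinarith only [hε1, hsS, hs])
      gcongr
    have e4 := (abs_le.1 (abs_finner_le M (X * Yᵀ - M))).2
    have e5 := sq_nonneg (frob M - frob (X * Yᵀ - M))
    have e6 := frob_sq M
    have e7 := frob_sq (X * Yᵀ - M)
    rw [e1, nsq_add]
    have e8 : S ^ 2 ≤ r * S ^ 2 := le_mul_of_one_le_left (sq_nonneg S) hr'
    have e9 : frob M * frob (X * Yᵀ - M) ≤ (nsq M + nsq (X * Yᵀ - M)) / 2 := by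
      rw [← e6, ← e7]; linarith only [e5]
    linarith only [e2, e3, e4, e8, e9]
  have actF : ∀ {k : ℕ} (Z : Matrix (Fin k) (Fin r) ℝ), wt ρ βT (frob Z) ≠ 0 →
      4 * r * S ≤ nsq Z := fun Z hZ => by
    have := wt_active hβT hZ
    rw [frob_sq] at this
    linarith only [this, hβT2]
  have hreg := reg_nonneg hr hU hV d t dx dy S ε (μ * r / m) (μ * r / n) βT hS hε0 hεr
    (fun i => by rw [hd]; exact wt_nonneg hρ _ _) (fun i => by rw [ht]; exact wt_nonneg hρ _ _)
    (by rw [hdx]; exact wt_nonneg hρ _ _) (by rw [hdy]; exact wt_nonneg hρ _ _) X Y W hW hbal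
    (fun h => actF X (by rwa [← hdx])) (fun h => actF Y (by rwa [← hdy])) hK hUi hVj
    (by positivity) (by positivity) hβT.le k2.1 k2.2
    (fun i h => by
      rw [hd] at h
      have := wt_active hβ1 h
      rw [rowNorm_sq] at this
      linarith only [this, hβ12])
    (fun i h => by
      rw [ht] at h
      have := wt_active hβ2 h
      rw [rowNorm_sq] at this
      linarith only [this, hβ22])
  -- stationarity in the test direction
  have hst : finner (projOmega Ω (X * Yᵀ - M))
      ((X - Uh * (Uhᵀ * X) + Uh * (W * (Uhᵀ * X))) * Yᵀ + X * (Y - Vh * (Vhᵀ * Y))ᵀ) ≤ 0 := by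
    have s1 := congrArg (fun A => finner A (X - Uh * (Uhᵀ * X) + Uh * (W * (Uhᵀ * X)))) gX
    have s2 := congrArg (fun A => finner A (Y - Vh * (Vhᵀ * Y))) gY
    rw [finner_add_left, finner_zero_left, finner_mul_left] at s1
    rw [finner_add_left, finner_zero_left, finner_mul_left', ← finner_transpose] at s2
    rw [finner_add_right]
    have s3 : finner Xᵀ ((projOmega Ω (X * Yᵀ - M))ᵀᵀ * (Y - Vh * (Vhᵀ * Y)))ᵀ =
        finner (projOmega Ω (X * Yᵀ - M)) (X * (Y - Vh * (Vhᵀ * Y))ᵀ) := by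
      rw [finner_transpose, Matrix.transpose_transpose, finner_comm, finner_mul_left]
    rw [s3] at s2
    linarith only [s1, s2, hreg]
  have hst2 := hst
  rw [hdir, hEeq] at hst2
  have hfin := samp_final Ω _ _ _ hst2
  have hL := samp_L hp.le hG a b hUb
  have hL' := samp_L' hG a'
  have hQ := samp_Q hG (X - Uh * (Uhᵀ * X)) (Y - Vh * (Vhᵀ * Y))
    (a := 8 * (μ * r / m) * βT ^ 2) (b := 8 * (μ * r / n) * βT ^ 2)
    (by positivity) (by positivity)
    (row_perp hU X (by positivity) hUi k2.1 hβ12 k1.1)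
    (row_perp hV Y (by positivity) hVj k2.2 hβ22 k1.2)
  have px := arith_perp hs (frob_nonneg _) (frob_nonneg _) (frob_nonneg _) k2.1 hβT2 hXp
  have py := arith_perp hs (frob_nonneg _) (frob_nonneg _) (frob_nonneg _) k2.2 hβT2 hYp
  rw [frob_sq, frob_sq] at px py
  have hnb : nsq b ≤ (ε * s) ^ 2 := by
    rw [← frob_sq]
    have := frob_nonneg b
    gcongr
  have hQ' := arith_Q hp.le hr' hs hS hκ hμ0 hm hn rfl hβT2 hε px py (nsq_nonneg _) (nsq_nonneg _)
    (nsq_nonneg _) (nsq_nonneg _) hnb hQ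
  have ha2 : nsq a' ≤ 0.001 * nsq a := by
    rw [← frob_sq, ← frob_sq]
    have := frob_nonneg a'
    calc frob a' ^ 2 ≤ (2 * ε * frob a) ^ 2 := by gcongr
      _ = 4 * ε ^ 2 * frob a ^ 2 := by ring
      _ ≤ 0.001 * frob a ^ 2 := by
        have : 4 * ε ^ 2 ≤ 0.001 := by nlinarith only [hε0, hε1]
        gcongr
  have hl0 : nsq a + nsq b ≤ 0 := by
    have h1 := mul_le_mul_of_nonneg_left ha2 hp.le
    have h2 : p * (nsq a + nsq b) ≤ 0 := by
      have h3 := mul_nonneg hp.le (nsq_nonneg b)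
      have h4 := mul_nonneg hp.le (nsq_nonneg a)
      linarith only [h1, h3, h4, hfin, hL, hL', hQ']
    by_contra hc
    push Not at hc
    linarith only [mul_pos hp hc, h2]
  have na0 : nsq a = 0 := by linarith only [hl0, nsq_nonneg a, nsq_nonneg b]
  have nb0 : nsq b = 0 := by linarith only [hl0, nsq_nonneg a, nsq_nonneg b]
  have hX0 : X - Uh * (Uhᵀ * X) = 0 := by
    apply nsq_eq_zero
    rw [nb0, mul_zero] at px
    exact le_antisymm px (nsq_nonneg _)
  rw [nsq_eq_zero na0, nsq_eq_zero nb0, hX0] at hEeq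
  simp only [Matrix.mul_zero, Matrix.zero_mul, add_zero] at hEeq
  exact sub_eq_zero.1 hEeq


lemma arith_S {m n r κ μ S : ℝ} (hn : 1 ≤ n) (hnm : n ≤ m) (hr : 1 ≤ r) (hμ : 1 ≤ μ) (hκ : 1 ≤ κ)
    (hSmn : S ≤ m * n)
    (hS : (10 : ℝ) ^ 20 * (m / n) * n * r * κ ^ 2 *
      max (μ * Real.log n) (Real.sqrt (m / n) * μ ^ 2 * r ^ 6 * κ ^ 4) ≤ S) :
    (10 : ℝ) ^ 20 ≤ n ∧ m ≤ n ^ 3 ∧ 10 ^ 20 * r * μ * Real.log n ≤ S / (m * n) * n ∧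
      10 ^ 20 * r ^ 7 * μ ^ 2 * κ ^ 6 ≤ S / (m * n) * n ∧ 0 < S := by
  have hn0 : 0 < n := by linarith
  have hm0 : 0 < m := by linarith
  have hr0 : 0 < r := by linarith
  have hμ0 : 0 < μ := by linarith
  have hκ0 : 0 < κ := by linarith
  have hlog : 0 ≤ Real.log n := Real.log_nonneg hn
  have hq : S / (m * n) * n = S / m := by field_simp
  have hα : 1 ≤ Real.sqrt (m / n) := by
    rw [Real.one_le_sqrt, one_le_div hn0]; exact hnm
  have hκ2 : 1 ≤ κ ^ 2 := one_le_pow₀ hκ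
  have hκ4 : 1 ≤ κ ^ 4 := one_le_pow₀ hκ
  have hr6 : 1 ≤ r ^ 6 := one_le_pow₀ hr
  have hμ2 : 1 ≤ μ ^ 2 := one_le_pow₀ hμ
  have key : ∀ z, z ≤ max (μ * Real.log n) (Real.sqrt (m / n) * μ ^ 2 * r ^ 6 * κ ^ 4) →
      10 ^ 20 * r * κ ^ 2 * z ≤ S / m := by
    intro z hz
    rw [le_div_iff₀ hm0]
    refine le_trans ?_ hS
    calc 10 ^ 20 * r * κ ^ 2 * z * m = (10 ^ 20 * (m / n) * n * r * κ ^ 2) * z := by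
          field_simp
      _ ≤ _ := mul_le_mul_of_nonneg_left hz (by positivity)
  have k1 := key _ (le_max_left _ _)
  have k2 := key _ (le_max_right _ _)
  have hSm : S / m ≤ n := by rw [div_le_iff₀ hm0]; linarith
  have k3 : (10 : ℝ) ^ 20 * Real.sqrt (m / n) ≤ S / m := by
    refine le_trans ?_ k2
    have h1 : 1 ≤ r * κ ^ 2 * (μ ^ 2 * (r ^ 6 * κ ^ 4)) := by
      have := one_le_mul_of_one_le_of_one_le hr6 hκ4
      have := one_le_mul_of_one_le_of_one_le hμ2 this
      have := one_le_mul_of_one_le_of_one_le (one_le_mul_of_one_le_of_one_le hr hκ2) this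
      exact this
    calc (10 : ℝ) ^ 20 * Real.sqrt (m / n) = 10 ^ 20 * Real.sqrt (m / n) * 1 := by ring
      _ ≤ 10 ^ 20 * Real.sqrt (m / n) * (r * κ ^ 2 * (μ ^ 2 * (r ^ 6 * κ ^ 4))) := by gcongr
      _ = _ := by ring
  refine ⟨?_, ?_, ?_, ?_, ?_⟩
  · refine le_trans ?_ (k3.trans hSm)
    linarith
  · have h1 : Real.sqrt (m / n) ≤ n := by
      refine le_trans ?_ (k3.trans hSm)
      linarith
    rw [Real.sqrt_le_left (by linarith)] at h1
    rw [div_le_iff₀ hn0] at h1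
    linarith
  · rw [hq]
    refine le_trans ?_ k1
    calc 10 ^ 20 * r * μ * Real.log n = 10 ^ 20 * r * 1 * (μ * Real.log n) := by ring
      _ ≤ _ := by gcongr
  · rw [hq]
    refine le_trans ?_ k2
    calc 10 ^ 20 * r ^ 7 * μ ^ 2 * κ ^ 6 = 10 ^ 20 * r * κ ^ 2 * (1 * μ ^ 2 * r ^ 6 * κ ^ 4) := by
          ring
      _ ≤ _ := by gcongr
  · have : 0 < S / m := lt_of_lt_of_le (by positivity) k3
    exact (div_pos_iff_of_pos_right hm0).1 this

lemma arith_eps {r κ ε : ℝ} (hr : 1 ≤ r) (hκ : 1 ≤ κ)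
    (hε : ε = 1 / (10 ^ 4 * r ^ ((3 : ℝ) / 2) * κ)) :
    0 ≤ ε ∧ ε * r ≤ 1 / 100 ∧ ε ^ 2 * r ^ 2 * κ ^ 2 ≤ 1 / 10 ^ 8 := by
  have hr0 : 0 < r := by linarith
  have hκ0 : 0 < κ := by linarith
  have h1 : r ≤ r ^ ((3 : ℝ) / 2) := by
    calc r = r ^ (1 : ℝ) := (Real.rpow_one r).symm
      _ ≤ _ := Real.rpow_le_rpow_of_exponent_le hr (by norm_num)
  have h0 : 0 < r ^ ((3 : ℝ) / 2) := by linarith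
  have e0 : 0 ≤ ε := by rw [hε]; positivity
  have h2 : ε * r * κ ≤ 1 / 10 ^ 4 := by
    have : ε * r * κ = 1 / 10 ^ 4 * (r / r ^ ((3 : ℝ) / 2)) := by
      rw [hε]; field_simp
    rw [this]
    have : r / r ^ ((3 : ℝ) / 2) ≤ 1 := by rw [div_le_one h0]; exact h1
    linarith
  have h3 : 0 ≤ ε * r := by positivity
  refine ⟨e0, ?_, ?_⟩
  · nlinarith
  · calc ε ^ 2 * r ^ 2 * κ ^ 2 = (ε * r * κ) ^ 2 := by ring
      _ ≤ (1 / 10 ^ 4) ^ 2 := by gcongr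
      _ = _ := by norm_num



set_option maxHeartbeats 400000 in
theorem stmt1_core (m n r : ℕ) (μ : ℝ) (M : Matrix (Fin m) (Fin n) ℝ)
        (Uh : Matrix (Fin m) (Fin r) ℝ) (Vh : Matrix (Fin n) (Fin r) ℝ)
        (σ : Fin r → ℝ) (Smax Smin : ℝ)
    (hn : 1 ≤ n) (hnm : n ≤ m) (hr : 1 ≤ r) (hμ : 1 ≤ μ)
    (hU : Uhᵀ * Uh = 1) (hV : Vhᵀ * Vh = 1)
    (hσ0 : ∀ k, 0 < σ k) (hM : M = Uh * Matrix.diagonal σ * Vhᵀ)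
    (hmax : (∀ k, σ k ≤ Smax) ∧ ∃ k, σ k = Smax)
    (hmin : (∀ k, Smin ≤ σ k) ∧ ∃ k, σ k = Smin)
    (hUi : ∀ i, ∑ k, Uh i k ^ 2 ≤ μ * r / m)
    (hVj : ∀ j, ∑ k, Vh j k ^ 2 ≤ μ * r / n) (S : ℕ) (κ δ δ0 p ρ βT β1 β2 : ℝ)
    (eκ : κ = Smax / Smin)
    (hS : 10 ^ 20 * ((m : ℝ) / n) * n * r * κ ^ 2 *
              max (μ * Real.log n)
                (Real.sqrt ((m : ℝ) / n) * μ ^ 2 * (r : ℝ) ^ 6 * κ ^ 4) ≤ S)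
    (eδ : δ = Smin / (10 ^ 4 * (r : ℝ) ^ ((3 : ℝ) / 2) * κ))
    (ep : p = (S : ℝ) / (m * n)) (eρ : ρ = 8 * p * δ0 ^ 2)
    (eT : βT = Real.sqrt (6 * r * Smax))
    (eb1 : β1 = βT * Real.sqrt (3 * μ * r / m))
    (eb2 : β2 = βT * Real.sqrt (3 * μ * r / n)) :
          (1 - 1 / (n : ℝ) ^ 4) *
              ((Finset.powersetCard S (Finset.univ : Finset (Fin m × Fin n))).card : ℝ) ≤
            (((Finset.powersetCard S (Finset.univ : Finset (Fin m × Fin n))).filter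
                (fun Ω =>
                  ∀ (X : Matrix (Fin m) (Fin r) ℝ) (Y : Matrix (Fin n) (Fin r) ℝ),
                    K1mem β1 β2 X Y → K2mem βT X Y → Kmem M δ X Y →
                    gradX Ω M ρ β1 βT X Y = 0 →
                    gradY Ω M ρ β2 βT X Y = 0 →
                    X * Yᵀ = M)).card : ℝ) := by
  by_cases hSmn : S ≤ m * n
  swap
  · rw [Finset.powersetCard_eq_empty.2 (by
      rw [Finset.card_univ, Fintype.card_prod, Fintype.card_fin, Fintype.card_fin]; omega)]
    simp
  obtain ⟨hσS, -⟩ := hmax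
  obtain ⟨hσs, k0, hk0⟩ := hmin
  have hs : 0 < Smin := by rw [← hk0]; exact hσ0 k0
  have hsS : Smin ≤ Smax := (hσs k0).trans (hσS k0)
  have hS0 : 0 < Smax := by linarith
  have hκ : 1 ≤ κ := by
    rw [eκ, one_le_div hs]; exact hsS
  have hn' : (1 : ℝ) ≤ n := by exact_mod_cast hn
  have hnm' : (n : ℝ) ≤ m := by exact_mod_cast hnm
  have hr' : (1 : ℝ) ≤ r := by exact_mod_cast hr
  have hn0 : (0 : ℝ) < n := by linarith
  have hm0 : (0 : ℝ) < m := by linarith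
  have hSmn' : (S : ℝ) ≤ m * n := by exact_mod_cast hSmn
  obtain ⟨a1, a2, a3, a4, a5⟩ := arith_S hn' hnm' hr' hμ hκ hSmn' hS
  have hp0 : 0 < p := by rw [ep]; exact div_pos a5 (by positivity)
  have hp1 : p ≤ 1 := by
    rw [ep, div_le_one (by positivity)]; exact hSmn'
  rw [← ep] at a3 a4
  have hgp := good_prob hp0 hp1 a1 hnm a2 hr hμ hκ a3 a4 Uh Vh hU hV hUi hVj
  have hcard : Fintype.card (Fin m × Fin n) = m * n := by simp
  obtain ⟨e1, e2, e3⟩ := arith_eps (ε := 1 / (10 ^ 4 * (r : ℝ) ^ ((3 : ℝ) / 2) * κ)) hr' hκ rfl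
  have hδ : δ = 1 / (10 ^ 4 * (r : ℝ) ^ ((3 : ℝ) / 2) * κ) * Smin := by
    rw [eδ]; ring
  have hβT : 0 < βT := by rw [eT]; exact Real.sqrt_pos.2 (by positivity)
  have hβT2 : βT ^ 2 = 6 * r * Smax := by rw [eT]; exact Real.sq_sqrt (by positivity)
  have hβ1 : 0 < β1 := by rw [eb1]; exact mul_pos hβT (Real.sqrt_pos.2 (by positivity))
  have hβ12 : β1 ^ 2 = 3 * (μ * r / m) * βT ^ 2 := by
    rw [eb1, mul_pow, Real.sq_sqrt (by positivity)]; ring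
  have hβ2 : 0 < β2 := by rw [eb2]; exact mul_pos hβT (Real.sqrt_pos.2 (by positivity))
  have hβ22 : β2 ^ 2 = 3 * (μ * r / n) * βT ^ 2 := by
    rw [eb2, mul_pow, Real.sq_sqrt (by positivity)]; ring
  have hρ : 0 ≤ ρ := by
    rw [eρ]
    positivity
  refine transfer S (by rw [hcard]; exact hSmn) (by rw [hcard]; exact Nat.mul_pos (by omega) hn)
    _ _ ?_
  have hpe : (S : ℝ) / (Fintype.card (Fin m × Fin n) : ℝ) = p := by
    rw [hcard]; push_cast; exact ep.symm
  rw [hpe, hcard]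
  have hdet : ∀ Ω : Finset (Fin m × Fin n),
      GoodSample p (1 / 10 ^ 6 / (μ * r ^ 3 * κ ^ 2) * (p * n)) Uh Vh Ω →
      ∀ (X : Matrix (Fin m) (Fin r) ℝ)
      (Y : Matrix (Fin n) (Fin r) ℝ), K1mem β1 β2 X Y → K2mem βT X Y → Kmem M δ X Y →
      gradX Ω M ρ β1 βT X Y = 0 → gradY Ω M ρ β2 βT X Y = 0 → X * Yᵀ = M := by
    intro Ω hG X Y k1 k2 k3 g1 g2
    rw [hδ] at k3
    exact det_main hm0 hn0 hr hμ hU hV hs hσs hσS hM hUi hVj eκ hp0 hρ e1 e2 e3 hβT hβT2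
        hβ1 hβ12 hβ2 hβ22 hG X Y k1 k2 k3 g1 g2
  have hmono : BPr p (fun Ω : Finset (Fin m × Fin n) => ¬ ∀ (X : Matrix (Fin m) (Fin r) ℝ)
      (Y : Matrix (Fin n) (Fin r) ℝ), K1mem β1 β2 X Y → K2mem βT X Y → Kmem M δ X Y →
      gradX Ω M ρ β1 βT X Y = 0 → gradY Ω M ρ β2 βT X Y = 0 → X * Yᵀ = M) ≤
      1 / (2 * (n : ℝ) ^ 8) := by
    refine le_trans (BPr_mono (p := p) hp0.le hp1 ?_) hgp
    intro Ω
    exact mt (hdet Ω)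
  have hmn : (((m * n : ℕ) : ℝ) + 1) ≤ 2 * (n : ℝ) ^ 4 := by
    push_cast
    have h1 : (m : ℝ) * n ≤ (n : ℝ) ^ 3 * n := by gcongr
    have h2 : (1 : ℝ) ≤ (n : ℝ) ^ 4 := one_le_pow₀ hn'
    linarith
  calc _ ≤ (((m * n : ℕ) : ℝ) + 1) * (1 / (2 * (n : ℝ) ^ 8)) :=
        mul_le_mul_of_nonneg_left hmono (by positivity)
    _ ≤ 2 * (n : ℝ) ^ 4 * (1 / (2 * (n : ℝ) ^ 8)) := by gcongr
    _ = 1 / (n : ℝ) ^ 4 := by field_simp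

/-- With probability at least `1 - 1/n⁴` (uniform sampling model, encoded
by counting subsets of size `S`), every stationary point of `F̃` in `K₁ ∩ K₂ ∩ K(δ)`
satisfies `XYᵀ = M`. -/
theorem stmt1 :
    ∃ C0 Cd CT : ℝ, 0 < C0 ∧ 0 < Cd ∧ 0 < CT ∧
      ∀ (m n r : ℕ) (μ : ℝ) (M : Matrix (Fin m) (Fin n) ℝ)
        (Uh : Matrix (Fin m) (Fin r) ℝ) (Vh : Matrix (Fin n) (Fin r) ℝ)
        (σ : Fin r → ℝ) (Smax Smin : ℝ),
        1 ≤ n → n ≤ m → 1 ≤ r → 1 ≤ μ →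
        Uhᵀ * Uh = 1 → Vhᵀ * Vh = 1 →
        (∀ k, 0 < σ k) → (∀ k l : Fin r, k ≤ l → σ l ≤ σ k) →
        M = Uh * Matrix.diagonal σ * Vhᵀ →
        ((∀ k, σ k ≤ Smax) ∧ ∃ k, σ k = Smax) →
        ((∀ k, Smin ≤ σ k) ∧ ∃ k, σ k = Smin) →
        (∀ i, ∑ k, Uh i k ^ 2 ≤ μ * r / m) →
        (∀ j, ∑ k, Vh j k ^ 2 ≤ μ * r / n) →
        ∀ S : ℕ,
          C0 * ((m : ℝ) / n) * n * r * (Smax / Smin) ^ 2 *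
              max (μ * Real.log n)
                (Real.sqrt ((m : ℝ) / n) * μ ^ 2 * (r : ℝ) ^ 6 * (Smax / Smin) ^ 4) ≤ S →
          let κ : ℝ := Smax / Smin
          let δ : ℝ := Smin / (Cd * (r : ℝ) ^ ((3 : ℝ) / 2) * κ)
          let δ0 : ℝ := δ / 6
          let p : ℝ := (S : ℝ) / (m * n)
          let ρ : ℝ := 8 * p * δ0 ^ 2
          let βT : ℝ := Real.sqrt (CT * r * Smax)
          let β1 : ℝ := βT * Real.sqrt (3 * μ * r / m)
          let β2 : ℝ := βT * Real.sqrt (3 * μ * r / n)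
          (1 - 1 / (n : ℝ) ^ 4) *
              ((Finset.powersetCard S (Finset.univ : Finset (Fin m × Fin n))).card : ℝ) ≤
            (((Finset.powersetCard S (Finset.univ : Finset (Fin m × Fin n))).filter
                (fun Ω =>
                  ∀ (X : Matrix (Fin m) (Fin r) ℝ) (Y : Matrix (Fin n) (Fin r) ℝ),
                    K1mem β1 β2 X Y → K2mem βT X Y → Kmem M δ X Y →
                    gradX Ω M ρ β1 βT X Y = 0 →
                    gradY Ω M ρ β2 βT X Y = 0 →
                    X * Yᵀ = M)).card : ℝ) := by
  refine ⟨10 ^ 20, 10 ^ 4, 6, by norm_num, by norm_num, by norm_num, ?_⟩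
  intro m n r μ M Uh Vh σ Smax Smin hn hnm hr hμ hU hV hσ0 _ hM hmax hmin hUi hVj S hS
  intro κ δ δ0 p ρ βT β1 β2
  exact stmt1_core m n r μ M Uh Vh σ Smax Smin hn hnm hr hμ hU hV hσ0 hM hmax hmin hUi hVj S
    κ δ δ0 p ρ βT β1 β2 rfl hS rfl rfl rfl rfl rfl rfl

end
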